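/- arXiv:1904.07571 — 2 statements merged into one kernel-verified Lean document; each statement's English description precedes it below -/
import Mathlib

section
/- Let n ≥ p ≥ 1, let U be an open neighborhood of 0 in ℂ^n, and let F : U → ℂ^p be holomorphic with F(0) = 0. Assume there exists a complex linear subspace Z ⊆ ℂ^n of complex dimension p such that 0 is an isolated point of Z ∩ F^{-1}(0) ∩ U (this encodes the condition that the fibre F^{-1}(0) has dimension n − p). Then (Im F, 0) = (ℂ^p, 0): for every sufficiently small ε > 0 there exists δ > 0 such that the open ball B_δ ⊆ ℂ^p is contained in F(U ∩ B_ε). If moreover Sing F ∩ F^{-1}(0) ∩ U = {0}, then also F(Sing F) is well-defined as a set germ at 0. -/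
open Metric Function

open Filter Topology in
/-- Differentiability of the determinant along a differentiable family of operators. -/
theorem diffAt_det {E : Type*} [NormedAddCommGroup E] [NormedSpace ℂ E] [FiniteDimensional ℂ E]
    {A : ℂ → E →L[ℂ] E} {x : ℂ} (hA : DifferentiableAt ℂ A x) :
    DifferentiableAt ℂ (fun ζ => (A ζ).det) x := by
  classical
  let b := Module.finBasis ℂ E
  have hentry : ∀ i j, DifferentiableAt ℂ (fun ζ => b.repr (A ζ (b j)) i) x := by
    intro i j
    have h1 : DifferentiableAt ℂ (fun ζ => A ζ (b j)) x :=
      hA.clm_apply (differentiableAt_const _)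
    have h2 := ((LinearMap.toContinuousLinearMap (b.coord i)).differentiableAt
      (x := A x (b j))).comp x h1
    exact h2
  have : (fun ζ => (A ζ).det) =
      fun ζ => ∑ σ : Equiv.Perm (Fin (Module.finrank ℂ E)),
        ((Equiv.Perm.sign σ : ℤ) : ℂ) * ∏ i, b.repr (A ζ (b i)) (σ i) := by
    funext ζ
    rw [ContinuousLinearMap.det, ← LinearMap.det_toMatrix b, Matrix.det_apply']
    simp [LinearMap.toMatrix_apply]
  rw [this]
  fun_prop

open Filter Topology in
theorem isOpen_surj {E F : Type*} [NormedAddCommGroup E] [NormedSpace ℂ E]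
    [NormedAddCommGroup F] [NormedSpace ℂ F] [FiniteDimensional ℂ F] :
    IsOpen {A : E →L[ℂ] F | Surjective A} := by
  rw [isOpen_iff_mem_nhds]
  intro A hA
  obtain ⟨B, hB⟩ := (A : E →ₗ[ℂ] F).exists_rightInverse_of_surjective
    (LinearMap.range_eq_top.2 hA)
  let B' : F →L[ℂ] E := LinearMap.toContinuousLinearMap B
  have hc : Continuous (fun A' : E →L[ℂ] F => (A'.comp B').det) :=
    ContinuousLinearMap.continuous_det.comp (by fun_prop)
  have hAB : A.comp B' = ContinuousLinearMap.id ℂ F := by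
    ext x
    exact LinearMap.congr_fun hB x
  have h1 : (A.comp B').det ≠ 0 := by
    rw [hAB]; simp [ContinuousLinearMap.det]
  filter_upwards [hc.continuousAt.eventually_ne h1] with A' hA' y
  refine ⟨B' (((A'.comp B').toContinuousLinearEquivOfDetNeZero hA').symm y), ?_⟩
  exact ((A'.comp B').toContinuousLinearEquivOfDetNeZero hA').apply_symm_apply y

open Filter Topology in
theorem core_nondeg {E : Type*} [NormedAddCommGroup E] [NormedSpace ℂ E] [FiniteDimensional ℂ E]
    (G : E → E) (ρ m : ℝ) (hρ : 0 < ρ)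
    (hG : AnalyticOnNhd ℂ G (closedBall 0 ρ)) (h0 : G 0 = 0)
    (hm : ∀ z, ‖z‖ = ρ → m ≤ ‖G z‖) (hJ : (fderiv ℂ G 0).det ≠ 0)
    (c : E) (hc : 3 * ‖c‖ < m) : ∃ z ∈ closedBall (0 : E) ρ, G z = c := by
  by_contra hno
  push Not at hno
  haveI : ProperSpace E := FiniteDimensional.proper ℂ E
  haveI : CompleteSpace E := FiniteDimensional.complete ℂ E
  let J : E → ℂ := fun z => (fderiv ℂ G z).det
  have hJc : ContinuousOn J (closedBall 0 ρ) :=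
    ContinuousLinearMap.continuous_det.comp_continuousOn hG.fderiv.continuousOn
  let D : Set (E × ℂ) := closedBall (0 : E) ρ ×ˢ closedBall (0 : ℂ) 2
  have hDc : IsCompact D := (isCompact_closedBall _ _).prod (isCompact_closedBall _ _)
  have hfst : ContinuousOn (fun q : E × ℂ => G q.1) D :=
    hG.continuousOn.comp continuousOn_fst (fun q hq => hq.1)
  let K : Set (E × ℂ) := D ∩ (fun q : E × ℂ => G q.1 - (c - q.2 • c)) ⁻¹' {0}
  have hKcl : IsClosed K :=
    ContinuousOn.preimage_isClosed_of_isClosed (hfst.sub (by fun_prop)) hDc.isClosed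
      isClosed_singleton
  have hK : IsCompact K := hDc.of_isClosed_subset hKcl Set.inter_subset_left
  have memK : ∀ z ζ, (z, ζ) ∈ K ↔ ‖z‖ ≤ ρ ∧ ‖ζ‖ ≤ 2 ∧ G z = c - ζ • c := by
    intro z ζ
    simp [K, D, sub_eq_zero, and_assoc]
  have hK1 : ((0 : E), (1 : ℂ)) ∈ K := by
    rw [memK]; simp [h0, hρ.le]
  have hne : ∀ q ∈ K, q.2 ≠ 0 := by
    rintro ⟨z, ζ⟩ hq h
    rw [memK] at hq
    simp only at h
    subst h
    exact hno z (by simpa using hq.1) (by simpa using hq.2.2)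
  obtain ⟨M, hM⟩ := (isCompact_closedBall (0 : E) ρ).exists_bound_of_continuousOn hJc
  have hj : 0 < ‖J 0‖ := norm_pos_iff.2 hJ
  obtain ⟨N, hN⟩ : ∃ N : ℕ, M * (1 / 2 : ℝ) ^ N < ‖J 0‖ := by
    have := (tendsto_pow_atTop_nhds_zero_of_lt_one (r := (1 / 2 : ℝ))
      (by norm_num) (by norm_num)).const_mul M
    rw [mul_zero] at this
    exact (this.eventually_lt_const hj).exists
  let Φ : E × ℂ → ℂ := fun q => J q.1 * (q.2⁻¹) ^ N
  have hΦ : ContinuousOn Φ K := by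
    have h1 : ContinuousOn (fun q : E × ℂ => J q.1) K :=
      hJc.comp continuousOn_fst (fun q hq => hq.1.1)
    exact h1.mul ((continuousOn_snd.inv₀ hne).pow N)
  obtain ⟨q0, hq0, hmax⟩ := hK.exists_isMaxOn ⟨_, hK1⟩ hΦ.norm
  let K' : Set (E × ℂ) := K ∩ (fun q => ‖Φ q‖) ⁻¹' {‖Φ q0‖}
  have hK'c : IsCompact K' := hK.of_isClosed_subset
    (hΦ.norm.preimage_isClosed_of_isClosed hKcl isClosed_singleton) Set.inter_subset_left
  obtain ⟨⟨z, ζ⟩, hq, hqmax⟩ := hK'c.exists_isMaxOn ⟨q0, hq0, rfl⟩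
    (f := fun q : E × ℂ => ‖q.2‖) (by fun_prop)
  have hqK := hq.1
  have hqv : ‖Φ (z, ζ)‖ = ‖Φ q0‖ := hq.2
  have hζ0 : ζ ≠ 0 := hne _ hqK
  obtain ⟨hz, hζ, hGz⟩ := (memK _ _).1 hqK
  have hge : ‖J 0‖ ≤ ‖Φ (z, ζ)‖ := by
    rw [hqv]
    have := hmax hK1
    simpa [Φ] using this
  have hJz : J z ≠ 0 := by
    intro h
    have : ‖Φ (z, ζ)‖ = 0 := by simp [Φ, h]
    linarith
  have hzlt : ‖z‖ < ρ := by
    refine lt_of_le_of_ne hz (fun h => ?_)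
    have h1 := hm z h
    have h2 : ‖c - ζ • c‖ ≤ ‖c‖ + ‖ζ‖ * ‖c‖ := by
      rw [← norm_smul]; exact norm_sub_le _ _
    rw [hGz] at h1
    nlinarith [norm_nonneg c]
  rcases lt_or_eq_of_le hζ with hlt | heq
  · -- interior maximum
    have hAn : AnalyticAt ℂ G z := hG z (by simpa using hz)
    let f' := (fderiv ℂ G z).toContinuousLinearEquivOfDetNeZero hJz
    have hf' : HasStrictFDerivAt G (f' : E →L[ℂ] E) z := by
      simpa [f'] using hAn.hasStrictFDerivAt
    have hC : ContDiffAt ℂ 1 G z := hAn.contDiffAt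
    let σ := hC.localInverse hf'.hasFDerivAt one_ne_zero
    have hσ1 : σ (G z) = z := hC.localInverse_apply_image hf'.hasFDerivAt one_ne_zero
    have hσ2 : ∀ᶠ y in 𝓝 (G z), G (σ y) = y := hf'.eventually_right_inverse
    have hσ3 : ContDiffAt ℂ 1 σ (G z) := hC.to_localInverse hf'.hasFDerivAt one_ne_zero
    let l : ℂ → E := fun ξ => c - ξ • c
    have hl : Continuous l := by fun_prop
    have hlz : l ζ = G z := hGz.symm
    have hlt' : Tendsto l (𝓝 ζ) (𝓝 (G z)) := by
      rw [← hlz]; exact hl.tendsto ζ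
    let g : ℂ → E := fun ξ => σ (l ξ)
    have hgz : g ζ = z := by simp only [g, hlz, hσ1]
    have hgt : Tendsto g (𝓝 ζ) (𝓝 z) := by
      have := hσ3.continuousAt.tendsto.comp hlt'
      rwa [hσ1] at this
    have e1 : ∀ᶠ ξ in 𝓝 ζ, ‖g ξ‖ < ρ := hgt.norm.eventually_lt_const hzlt
    have e2 : ∀ᶠ ξ in 𝓝 ζ, ‖ξ‖ < 2 := (continuous_norm.tendsto ζ).eventually_lt_const hlt
    have e3 : ∀ᶠ ξ in 𝓝 ζ, G (g ξ) = l ξ := hlt'.eventually hσ2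
    have e4 : ∀ᶠ ξ in 𝓝 ζ, DifferentiableAt ℂ σ (l ξ) :=
      hlt'.eventually ((hσ3.eventually (by simp)).mono fun y hy => hy.differentiableAt one_ne_zero)
    have e5 : ∀ᶠ ξ in 𝓝 ζ, ξ ≠ 0 := eventually_ne_nhds hζ0
    have eK : ∀ᶠ ξ in 𝓝 ζ, (g ξ, ξ) ∈ K := by
      filter_upwards [e1, e2, e3] with ξ h1 h2 h3
      exact (memK _ _).2 ⟨h1.le, h2.le, h3⟩
    have eD : ∀ᶠ ξ in 𝓝 ζ, DifferentiableAt ℂ (fun ξ => Φ (g ξ, ξ)) ξ := by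
      filter_upwards [e1, e4, e5] with ξ h1 h4 h5
      have hg : DifferentiableAt ℂ g ξ :=
        DifferentiableAt.comp ξ h4 (by fun_prop)
      have hd : DifferentiableAt ℂ (fun ξ => fderiv ℂ G (g ξ)) ξ :=
        DifferentiableAt.comp ξ (hG (g ξ) (by simpa using h1.le)).fderiv.differentiableAt hg
      exact (diffAt_det hd).mul ((differentiableAt_id.inv h5).pow N)
    have hloc : IsLocalMax (norm ∘ fun ξ => Φ (g ξ, ξ)) ζ := by
      filter_upwards [eK] with ξ h
      have := hmax h
      simp only [Function.comp, hgz, hqv]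
      exact this
    have hconst := Complex.eventually_eq_of_isLocalMax_norm eD hloc
    have hfin : ∀ᶠ ξ in 𝓝 ζ, ‖ξ‖ ≤ ‖ζ‖ := by
      filter_upwards [eK, hconst] with ξ h1 h2
      have : (g ξ, ξ) ∈ K' := by
        refine ⟨h1, ?_⟩
        simp only [Set.mem_preimage, Set.mem_singleton_iff, h2, hgz, hqv]
      exact hqmax this
    have ht : Tendsto (fun t : ℝ => ((1 + t : ℝ) : ℂ) * ζ) (𝓝[>] 0) (𝓝 ζ) := by
      have : Continuous (fun t : ℝ => ((1 + t : ℝ) : ℂ) * ζ) := by fun_prop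
      have h := this.tendsto 0
      simp only [add_zero, Complex.ofReal_one, one_mul] at h
      exact h.mono_left nhdsWithin_le_nhds
    obtain ⟨t, ht1, ht2⟩ := ((ht.eventually hfin).and self_mem_nhdsWithin).exists
    have ht2 : 0 < t := ht2
    rw [norm_mul, Complex.norm_real, Real.norm_eq_abs, abs_of_pos (by linarith)] at ht1
    have : 0 < ‖ζ‖ := norm_pos_iff.2 hζ0
    nlinarith
  · have h1 : ‖Φ (z, ζ)‖ = ‖J z‖ * (1 / 2) ^ N := by
      simp [Φ, heq]
    have h2 := hM z (by simpa using hz)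
    have h3 : ‖J z‖ * (1 / 2 : ℝ) ^ N ≤ M * (1 / 2) ^ N := by gcongr
    linarith

open Filter Topology in
theorem core_general {E : Type*} [NormedAddCommGroup E] [NormedSpace ℂ E] [FiniteDimensional ℂ E]
    (G : E → E) (ρ m : ℝ) (hρ : 0 < ρ) (hm0 : 0 < m)
    (hG : AnalyticOnNhd ℂ G (closedBall 0 ρ)) (h0 : G 0 = 0)
    (hm : ∀ z, ‖z‖ = ρ → m ≤ ‖G z‖)
    (c : E) (hc : 6 * ‖c‖ < m) : ∃ z ∈ closedBall (0 : E) ρ, G z = c := by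
  by_contra hno
  push Not at hno
  haveI : ProperSpace E := FiniteDimensional.proper ℂ E
  have hcl : IsClosed (G '' closedBall 0 ρ) :=
    ((isCompact_closedBall _ _).image_of_continuousOn hG.continuousOn).isClosed
  have hcn : c ∈ (G '' closedBall 0 ρ)ᶜ := by
    rintro ⟨z, hz, h⟩; exact hno z hz h
  obtain ⟨d, hd, hball⟩ := Metric.isOpen_iff.1 hcl.isOpen_compl c hcn
  -- choose the perturbation parameter
  have hfs := Module.End.finite_spectrum ((fderiv ℂ G 0 : E →L[ℂ] E) : E →ₗ[ℂ] E)
  have e1 : ∀ᶠ t in 𝓝[≠] (0 : ℂ),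
      t ∉ (spectrum ℂ ((fderiv ℂ G 0 : E →L[ℂ] E) : E →ₗ[ℂ] E) \ {0}) := by
    have : IsClosed (spectrum ℂ ((fderiv ℂ G 0 : E →L[ℂ] E) : E →ₗ[ℂ] E) \ {0}) :=
      (hfs.subset Set.sdiff_subset).isClosed
    have h := this.isOpen_compl.mem_nhds (x := (0 : ℂ)) (by simp)
    exact nhdsWithin_le_nhds h
  have ht0 : Tendsto (fun t : ℂ => ‖t‖ * ρ) (𝓝[≠] (0 : ℂ)) (𝓝 0) := by
    have : Continuous (fun t : ℂ => ‖t‖ * ρ) := by fun_prop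
    have h := this.tendsto 0
    simp only [norm_zero, zero_mul] at h
    exact h.mono_left nhdsWithin_le_nhds
  have e2 := ht0.eventually_lt_const hd
  have e3 := ht0.eventually_lt_const (half_pos hm0)
  obtain ⟨t, ⟨⟨h1, h2⟩, h3⟩, h4⟩ := (((e1.and e2).and e3).and self_mem_nhdsWithin).exists
  have h4 : t ≠ 0 := h4
  let G' : E → E := fun z => G z - t • z
  have hG' : AnalyticOnNhd ℂ G' (closedBall 0 ρ) := by
    intro z hz
    exact (hG z hz).sub (analyticAt_const.smul analyticAt_id)
  have hfd : fderiv ℂ G' 0 = fderiv ℂ G 0 - t • ContinuousLinearMap.id ℂ E := by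
    have ha := (hG 0 (by simp [hρ.le])).differentiableAt.hasFDerivAt
    exact (ha.sub ((hasFDerivAt_id (0 : E)).const_smul t)).fderiv
  have hdet : (fderiv ℂ G' 0).det ≠ 0 := by
    intro h
    apply h1
    refine ⟨?_, h4⟩
    rw [spectrum.mem_iff]
    intro hu
    have hu' := hu.neg
    rw [neg_sub] at hu'
    have := (LinearMap.isUnit_iff_isUnit_det _).1 hu'
    apply this.ne_zero
    rw [hfd] at h
    rw [← h, ContinuousLinearMap.det]
    congr 1
  obtain ⟨z, hz, hzc⟩ := core_nondeg G' ρ (m / 2) hρ hG' (by simp [G', h0]) (by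
    intro z hz
    have a := hm z hz
    have b : ‖G z‖ - ‖t • z‖ ≤ ‖G z - t • z‖ := norm_sub_norm_le _ _
    rw [norm_smul, hz] at b
    change m / 2 ≤ ‖G z - t • z‖
    linarith) hdet c (by linarith)
  have hmem : G z ∈ ball c d := by
    rw [mem_ball, dist_eq_norm]
    have : G z - c = t • z := by rw [← hzc]; simp [G']
    rw [this, norm_smul]
    have hz' : ‖z‖ ≤ ρ := by simpa using hz
    have : ‖t‖ * ‖z‖ ≤ ‖t‖ * ρ := by gcongr
    linarith
  exact hball hmem ⟨z, hz, rfl⟩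

/-- If the fibre `F⁻¹(0)` of a holomorphic map germ `F : (ℂⁿ,0) → (ℂᵖ,0)` has
dimension `n - p` (encoded: some complex `p`-dimensional linear subspace `Z` meets
`F⁻¹(0)` only at `0` near the origin), then `(Im F, 0) = (ℂᵖ, 0)`; if moreover
`Sing F ∩ F⁻¹(0) = {0}` (an ICIS), then `F(Sing F)` is well-defined as a set germ. -/
theorem stmt_3 (n p : ℕ) (hp : 1 ≤ p) (hnp : p ≤ n)
    (U : Set (EuclideanSpace ℂ (Fin n))) (hU : IsOpen U)
    (h0U : (0 : EuclideanSpace ℂ (Fin n)) ∈ U)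
    (F : EuclideanSpace ℂ (Fin n) → EuclideanSpace ℂ (Fin p))
    (hF : AnalyticOnNhd ℂ F U) (hF0 : F 0 = 0)
    (Z : Submodule ℂ (EuclideanSpace ℂ (Fin n))) (hZdim : Module.finrank ℂ Z = p)
    (hiso : ∃ r > 0, ∀ x, x ∈ (Z : Set (EuclideanSpace ℂ (Fin n))) → x ∈ U →
      F x = 0 → ‖x‖ < r → x = 0) :
    (∃ ε₀ > 0, ∀ ε, 0 < ε → ε < ε₀ → ∃ δ > 0,
      ball (0 : EuclideanSpace ℂ (Fin p)) δ ⊆ F '' (U ∩ ball 0 ε)) ∧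
    ({x ∈ U | ¬ Function.Surjective (fderiv ℂ F x)} ∩ {x | F x = 0} ∩ U = {0} →
      ∃ ε₀ > 0, ∀ ε ε', 0 < ε → ε < ε₀ → 0 < ε' → ε' < ε₀ → ∃ δ > 0,
        F '' ({x ∈ U | ¬ Function.Surjective (fderiv ℂ F x)} ∩ ball 0 ε) ∩ ball 0 δ =
        F '' ({x ∈ U | ¬ Function.Surjective (fderiv ℂ F x)} ∩ ball 0 ε') ∩ ball 0 δ) := by
  constructor
  · refine ⟨1, one_pos, fun ε hε _ => ?_⟩
    obtain ⟨r, hr, hiso⟩ := hiso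
    obtain ⟨s, hs, hsU⟩ := Metric.isOpen_iff.1 hU 0 h0U
    have hfr : Module.finrank ℂ (EuclideanSpace ℂ (Fin p)) = Module.finrank ℂ Z := by
      rw [hZdim]; simp
    let e : EuclideanSpace ℂ (Fin p) ≃L[ℂ] Z := ContinuousLinearEquiv.ofFinrankEq hfr
    let L : EuclideanSpace ℂ (Fin p) →L[ℂ] EuclideanSpace ℂ (Fin n) :=
      Z.subtypeL.comp (e : EuclideanSpace ℂ (Fin p) →L[ℂ] Z)
    have hLZ : ∀ z, L z ∈ Z := fun z => (e z).2
    have hLinj : ∀ z, L z = 0 → z = 0 := by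
      intro z hz
      have : e z = 0 := Subtype.ext hz
      simpa using this
    have hη : 0 < min r (min s ε) := lt_min hr (lt_min hs hε)
    obtain ⟨ρ', hρ', hball⟩ := Metric.continuousAt_iff.1 (L.continuous.continuousAt (x := 0)) _ hη
    let ρ := ρ' / 2
    have hρ : 0 < ρ := half_pos hρ'
    have hsmall : ∀ z ∈ closedBall (0 : EuclideanSpace ℂ (Fin p)) ρ,
        ‖L z‖ < r ∧ ‖L z‖ < s ∧ ‖L z‖ < ε := by
      intro z hz
      have hz' : ‖z‖ ≤ ρ' / 2 := by simpa using hz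
      have := hball (x := z) (by rw [dist_zero_right]; linarith)
      rw [map_zero, dist_zero_right] at this
      simpa using this
    have hLU : ∀ z ∈ closedBall (0 : EuclideanSpace ℂ (Fin p)) ρ, L z ∈ U := by
      intro z hz
      exact hsU (by simpa using (hsmall z hz).2.1)
    have hG : AnalyticOnNhd ℂ (fun z => F (L z)) (closedBall 0 ρ) := by
      intro z hz
      exact AnalyticAt.comp (hF (L z) (hLU z hz)) (L.analyticAt z)
    haveI : Nonempty (Fin p) := ⟨⟨0, hp⟩⟩
    have hcomp : IsCompact (sphere (0 : EuclideanSpace ℂ (Fin p)) ρ) := isCompact_sphere _ _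
    have hmn : ∃ m > 0, ∀ z : EuclideanSpace ℂ (Fin p), ‖z‖ = ρ → m ≤ ‖F (L z)‖ := by
      by_cases hS : (sphere (0 : EuclideanSpace ℂ (Fin p)) ρ).Nonempty
      · obtain ⟨z0, hz0, hmin⟩ := hcomp.exists_isMinOn hS
          (hG.continuousOn.norm.mono sphere_subset_closedBall)
        refine ⟨‖F (L z0)‖, ?_, fun z hz => hmin (by simpa using hz)⟩
        rw [gt_iff_lt, norm_pos_iff]
        intro h
        have hz0' := sphere_subset_closedBall hz0
        have := hLinj _ (hiso _ (hLZ z0) (hLU z0 hz0') h (hsmall z0 hz0').1)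
        rw [this] at hz0
        simp at hz0
        linarith
      · exact ⟨1, one_pos, fun z hz => (hS ⟨z, by simpa using hz⟩).elim⟩
    obtain ⟨m, hm0, hm⟩ := hmn
    refine ⟨m / 6, by positivity, fun c hc => ?_⟩
    have hc' : ‖c‖ < m / 6 := by simpa using hc
    obtain ⟨z, hz, hzc⟩ := core_general (fun z => F (L z)) ρ m hρ hm0 hG (by simp [hF0]) hm c
      (by linarith)
    exact ⟨L z, ⟨hLU z hz, by simpa using (hsmall z hz).2.2⟩, hzc⟩
  · intro hsing
    obtain ⟨s, hs, hsU⟩ := Metric.isOpen_iff.1 hU 0 h0U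
    -- the singular set
    have key : ∀ ε ε', 0 < ε' → ε < s → ∃ δ > 0,
        ∀ x, x ∈ U → ¬ Function.Surjective (fderiv ℂ F x) → ‖x‖ < ε → ‖F x‖ < δ → ‖x‖ < ε' := by
      intro ε ε' hε' hεs
      have hsub : closedBall (0 : EuclideanSpace ℂ (Fin n)) ε ⊆ U :=
        (closedBall_subset_ball hεs).trans hsU
      let C : Set (EuclideanSpace ℂ (Fin n)) :=
        (closedBall 0 ε ∩ (fderiv ℂ F) ⁻¹' {A | Function.Surjective A}ᶜ) ∩ (ball 0 ε')ᶜ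
      have hCc : IsCompact C := by
        refine (isCompact_closedBall (0 : EuclideanSpace ℂ (Fin n)) ε).of_isClosed_subset ?_
          (fun x hx => hx.1.1)
        refine IsClosed.inter ?_ isOpen_ball.isClosed_compl
        exact (hF.fderiv.continuousOn.mono hsub).preimage_isClosed_of_isClosed
          isClosed_closedBall isOpen_surj.isClosed_compl
      have hpos : ∃ δ > 0, ∀ x ∈ C, δ ≤ ‖F x‖ := by
        by_cases hne : C.Nonempty
        · obtain ⟨x0, hx0, hmin⟩ := hCc.exists_isMinOn hne
            (hF.continuousOn.norm.mono fun x hx => hsub hx.1.1)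
          refine ⟨‖F x0‖, ?_, fun x hx => hmin hx⟩
          rw [gt_iff_lt, norm_pos_iff]
          intro h
          have hxU := hsub hx0.1.1
          have : x0 ∈ ({0} : Set (EuclideanSpace ℂ (Fin n))) := by
            rw [← hsing]; exact ⟨⟨⟨hxU, hx0.1.2⟩, h⟩, hxU⟩
          rw [Set.mem_singleton_iff] at this
          exact hx0.2 (by rw [this]; simpa using hε')
        · exact ⟨1, one_pos, fun x hx => (hne ⟨x, hx⟩).elim⟩
      obtain ⟨δ, hδ, hδC⟩ := hpos
      refine ⟨δ, hδ, fun x _ hxs hx hFx => ?_⟩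
      by_contra hcon
      have : x ∈ C := ⟨⟨by simpa using hx.le, hxs⟩, by simpa using hcon⟩
      linarith [hδC x this]
    refine ⟨s, hs, fun ε ε' hε hεs hε' hε's => ?_⟩
    obtain ⟨δ₁, hδ₁, h₁⟩ := key ε ε' hε' hεs
    obtain ⟨δ₂, hδ₂, h₂⟩ := key ε' ε hε hε's
    refine ⟨min δ₁ δ₂, lt_min hδ₁ hδ₂, ?_⟩
    ext y
    constructor
    · rintro ⟨⟨x, ⟨⟨hxU, hxs⟩, hx⟩, rfl⟩, hy⟩
      have hy' : ‖F x‖ < min δ₁ δ₂ := by simpa using hy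
      exact ⟨⟨x, ⟨⟨hxU, hxs⟩, by
        simpa using h₁ x hxU hxs (by simpa using hx) (hy'.trans_le (min_le_left _ _))⟩, rfl⟩, hy⟩
    · rintro ⟨⟨x, ⟨⟨hxU, hxs⟩, hx⟩, rfl⟩, hy⟩
      have hy' : ‖F x‖ < min δ₁ δ₂ := by simpa using hy
      exact ⟨⟨x, ⟨⟨hxU, hxs⟩, by
        simpa using h₂ x hxU hxs (by simpa using hx) (hy'.trans_le (min_le_right _ _))⟩, rfl⟩, hy⟩
end

section
/- Let n ≥ 2, let U be an open neighborhood of 0 in ℂ^n, and let f, g : U → ℂ be holomorphic with f(0) = g(0) = 0. Write F = (f, g) : U → ℂ². Then the image F(Sing F) of the singular locus is well-defined as a set germ at 0: there exists ε₀ > 0 such that for all ε, ε' ∈ (0, ε₀) there exists δ > 0 with F(Sing F ∩ B_ε) ∩ B_δ = F(Sing F ∩ B_ε') ∩ B_δ. -/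
open Metric Function Filter Topology

theorem contDiffAt_circleIntegral {E : Type*} [NormedAddCommGroup E] [NormedSpace ℂ E]
    (Ψ : E → ℂ → ℂ) (x₀ : E) (ρ : ℝ) (hρ : 0 ≤ ρ)
    (h : ∀ ζ ∈ sphere (0 : ℂ) ρ, ContDiffAt ℂ 1 (fun p : E × ℂ => Ψ p.1 p.2) (x₀, ζ)) :
    ContDiffAt ℂ 1 (fun x => ∮ ζ in C(0, ρ), Ψ x ζ) x₀ := by
  set G : E × ℂ → ℂ := fun p => Ψ p.1 p.2 with hG
  set D : E × ℂ → (E →L[ℂ] ℂ) :=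
    fun p => (fderiv ℂ G p).comp (ContinuousLinearMap.inl ℂ E ℂ) with hD
  have hS : IsCompact (sphere (0 : ℂ) ρ) := isCompact_sphere 0 ρ
  have hev : ∀ ζ ∈ sphere (0 : ℂ) ρ, ∀ᶠ p : E × ℂ in 𝓝 (x₀, ζ), ContDiffAt ℂ 1 G p := by
    intro ζ hζ
    exact (h ζ hζ).eventually (by simp)
  have hDc : ∀ p, ContDiffAt ℂ 1 G p → ContinuousAt D p := by
    intro p hp
    have h1 : ContinuousAt (fderiv ℂ G) p := hp.continuousAt_fderiv (by simp)
    exact h1.clm_comp continuousAt_const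
  obtain ⟨M, hM⟩ := hS.exists_bound_of_continuousOn (f := fun ζ => D (x₀, ζ)) (by
    intro ζ hζ
    have h1 := hDc (x₀, ζ) (h ζ hζ)
    have : ContinuousAt (fun ζ : ℂ => D (x₀, ζ)) ζ :=
      ContinuousAt.comp (f := fun ζ : ℂ => ((x₀, ζ) : E × ℂ)) h1 (by fun_prop)
    exact this.continuousWithinAt)
  have hev2 : ∀ ζ ∈ sphere (0 : ℂ) ρ, ∀ᶠ p : E × ℂ in 𝓝 (x₀, ζ),
      ContDiffAt ℂ 1 G (p.1, p.2) ∧ ‖D (p.1, p.2)‖ < M + 1 := by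
    intro ζ hζ
    have h1 := (hDc (x₀, ζ) (h ζ hζ)).norm
    have h2 : ∀ᶠ p in 𝓝 (x₀, ζ), ‖D p‖ < M + 1 :=
      h1.eventually_lt continuousAt_const (by have := hM ζ hζ; linarith)
    filter_upwards [hev ζ hζ, h2] with p a b using ⟨a, b⟩
  have hV := hS.eventually_forall_of_forall_eventually
    (P := fun x ζ => ContDiffAt ℂ 1 G (x, ζ) ∧ ‖D (x, ζ)‖ < M + 1) hev2
  obtain ⟨V, hVsub, hVo, hV0⟩ := _root_.eventually_nhds_iff.1 hV
  have hmem : ∀ θ, circleMap 0 ρ θ ∈ sphere (0 : ℂ) ρ := fun θ => circleMap_mem_sphere 0 hρ θ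
  set F' : E → ℝ → (E →L[ℂ] ℂ) := fun x θ => deriv (circleMap 0 ρ) θ • D (x, circleMap 0 ρ θ)
    with hF'
  have hdc : Continuous (fun θ => deriv (circleMap 0 ρ) θ) := by
    simp only [deriv_circleMap]
    fun_prop
  have hGc : ∀ x ∈ V, Continuous (fun θ => deriv (circleMap 0 ρ) θ • Ψ x (circleMap 0 ρ θ)) := by
    intro x hx
    refine hdc.smul ?_
    rw [continuous_iff_continuousAt]
    intro θ
    have h1 : ContinuousAt G (x, circleMap 0 ρ θ) := (hVsub x hx _ (hmem θ)).1.continuousAt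
    exact ContinuousAt.comp (f := fun θ : ℝ => ((x, circleMap 0 ρ θ) : E × ℂ)) h1
      (by fun_prop)
  have hF'c : ∀ x ∈ V, Continuous (F' x) := by
    intro x hx
    refine hdc.smul ?_
    rw [continuous_iff_continuousAt]
    intro θ
    have h1 : ContinuousAt D (x, circleMap 0 ρ θ) := hDc _ (hVsub x hx _ (hmem θ)).1
    exact ContinuousAt.comp (f := fun θ : ℝ => ((x, circleMap 0 ρ θ) : E × ℂ)) h1
      (by fun_prop)
  have hbound : ∀ x ∈ V, ∀ θ, ‖F' x θ‖ ≤ ρ * (M + 1) := by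
    intro x hx θ
    rw [hF', norm_smul]
    have h1 : ‖deriv (circleMap 0 ρ) θ‖ = ρ := by
      simp [deriv_circleMap, abs_of_nonneg hρ]
    rw [h1]
    exact mul_le_mul_of_nonneg_left (hVsub x hx _ (hmem θ)).2.le hρ
  rw [contDiffAt_one_iff]
  refine ⟨fun x => ∫ θ in (0 : ℝ)..2 * Real.pi, F' x θ, V, hVo.mem_nhds hV0, ?_, ?_⟩
  · intro x hx
    apply ContinuousAt.continuousWithinAt
    refine intervalIntegral.continuousAt_of_dominated_interval (bound := fun _ => ρ * (M + 1))
      ?_ ?_ ?_ ?_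
    · filter_upwards [hVo.mem_nhds hx] with y hy using (hF'c y hy).aestronglyMeasurable
    · filter_upwards [hVo.mem_nhds hx] with y hy
      exact Eventually.of_forall fun θ _ => hbound y hy θ
    · exact continuous_const.intervalIntegrable _ _
    · refine Eventually.of_forall fun θ _ => ?_
      have h1 : ContinuousAt D (x, circleMap 0 ρ θ) := hDc _ (hVsub x hx _ (hmem θ)).1
      have h2 : ContinuousAt (fun y : E => D (y, circleMap 0 ρ θ)) x :=
        ContinuousAt.comp (f := fun y : E => ((y, circleMap 0 ρ θ) : E × ℂ)) h1 (by fun_prop)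
      exact h2.const_smul (deriv (circleMap 0 ρ) θ)
  · intro x hx
    simp only [circleIntegral]
    refine intervalIntegral.hasFDerivAt_integral_of_dominated_of_fderiv_le (s := V)
      (F' := F') (bound := fun _ => ρ * (M + 1)) (hVo.mem_nhds hx) ?_ ?_ ?_ ?_ ?_ ?_
    · filter_upwards [hVo.mem_nhds hx] with y hy using (hGc y hy).aestronglyMeasurable
    · exact (hGc x hx).intervalIntegrable _ _
    · exact (hF'c x hx).aestronglyMeasurable
    · exact Eventually.of_forall fun θ _ y hy => hbound y hy θ
    · exact continuous_const.intervalIntegrable _ _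
    · refine Eventually.of_forall fun θ _ y hy => ?_
      have h1 : HasFDerivAt G (fderiv ℂ G (y, circleMap 0 ρ θ)) (y, circleMap 0 ρ θ) :=
        ((hVsub y hy _ (hmem θ)).1.differentiableAt (by simp)).hasFDerivAt
      have h2 := HasFDerivAt.comp (𝕜 := ℂ) (f := fun e : E => ((e, circleMap 0 ρ θ) : E × ℂ)) y h1
        (hasFDerivAt_prodMk_left y (circleMap 0 ρ θ))
      exact h2.fun_const_smul (deriv (circleMap 0 ρ) θ)


section
variable {E : Type*} [NormedAddCommGroup E] [NormedSpace ℂ E]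

theorem hol_ball {φ : E → ℂ} {x₀ : E} (h : ContDiffAt ℂ 1 φ x₀) :
    ∃ r > 0, ∀ x ∈ ball x₀ r, ContDiffAt ℂ 1 φ x := by
  have := h.eventually (by simp)
  exact Metric.eventually_nhds_iff_ball.1 this

theorem hol_analyticAt {k : ℂ → ℂ} {t : ℂ} (h : ContDiffAt ℂ 1 k t) : AnalyticAt ℂ k t := by
  rw [Complex.analyticAt_iff_eventually_differentiableAt]
  filter_upwards [h.eventually (by simp)] with s hs using hs.differentiableAt (by simp)

theorem hol_line {φ : E → ℂ} (h : ContDiffAt ℂ 1 φ 0) (v : E) :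
    ContDiffAt ℂ 1 (fun t : ℂ => φ (t • v)) 0 := by
  have : ContDiffAt ℂ 1 φ ((0 : ℂ) • v) := by simpa using h
  exact ContDiffAt.comp (f := fun t : ℂ => t • v) (0 : ℂ) this (by fun_prop)

theorem hol_dir {φ : E → ℂ} (h : ContDiffAt ℂ 1 φ 0) (hn : ¬ ∀ᶠ z in 𝓝 0, φ z = 0) :
    ∃ v, ¬ ∀ᶠ t in 𝓝 (0 : ℂ), φ (t • v) = 0 := by
  by_contra! hc
  obtain ⟨r, hr, hb⟩ := hol_ball h
  apply hn
  filter_upwards [ball_mem_nhds (0 : E) hr] with z hz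
  set L : ℂ →ₗ[ℝ] E := (LinearMap.toSpanSingleton ℂ E z).restrictScalars ℝ
  set T : Set ℂ := L ⁻¹' ball 0 r with hT
  have hconv : Convex ℝ T := (convex_ball (0 : E) r).linear_preimage L
  have hLc : Continuous L := by
    change Continuous (fun t : ℂ => t • z)
    fun_prop
  have hTo : IsOpen T := isOpen_ball.preimage hLc
  have hd : DifferentiableOn ℂ (fun t : ℂ => φ (t • z)) T := by
    intro t ht
    have h1 : DifferentiableAt ℂ φ (t • z) := (hb _ ht).differentiableAt (by simp)
    exact (DifferentiableAt.comp (f := fun t : ℂ => t • z) t h1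
      (by fun_prop)).differentiableWithinAt
  have ha := hd.analyticOnNhd hTo
  have h0 : (0 : ℂ) ∈ T := by
    change (0 : ℂ) • z ∈ ball 0 r
    simpa using hr
  have h1 : (1 : ℂ) ∈ T := by
    change (1 : ℂ) • z ∈ ball 0 r
    simpa using hz
  have := ha.eqOn_zero_of_preconnected_of_eventuallyEq_zero hconv.isPreconnected h0 (hc z) h1
  simpa using this

theorem hol_fderiv {φ : E → ℂ} {x₀ : E} (h : ContDiffAt ℂ 1 φ x₀) (v : E) :
    ContDiffAt ℂ 1 (fun x => fderiv ℂ φ x v) x₀ := by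
  obtain ⟨r, hr, hb⟩ := hol_ball h
  obtain ⟨ρ, hρ, hρv⟩ : ∃ ρ > 0, ρ * ‖v‖ < r / 2 := by
    refine ⟨r / 2 / (‖v‖ + 1), by positivity, ?_⟩
    rw [div_mul_eq_mul_div, div_lt_iff₀ (by positivity)]
    nlinarith [norm_nonneg v]
  have key : ∀ x ∈ ball x₀ (r / 2), ∀ ζ : ℂ, ‖ζ‖ ≤ ρ → ContDiffAt ℂ 1 φ (x + ζ • v) := by
    intro x hx ζ hζ
    apply hb
    rw [mem_ball, dist_eq_norm] at hx ⊢
    have h1 : ‖x + ζ • v - x₀‖ ≤ ‖x - x₀‖ + ‖ζ • v‖ := by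
      have : x + ζ • v - x₀ = (x - x₀) + ζ • v := by abel
      rw [this]; exact norm_add_le _ _
    rw [norm_smul] at h1
    nlinarith [norm_nonneg v]
  have hInt : ContDiffAt ℂ 1
      (fun x => (2 * Real.pi * Complex.I : ℂ)⁻¹ *
        ∮ ζ in C(0, ρ), φ (x + ζ • v) * (ζ ^ 2)⁻¹) x₀ := by
    refine contDiffAt_const.mul ?_
    refine contDiffAt_circleIntegral _ _ _ hρ.le ?_
    intro ζ hζ
    have hζ' : ‖ζ‖ = ρ := by simpa using hζ
    have hζ0 : ζ ≠ 0 := by rintro rfl; simp at hζ'; linarith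
    have h1 := key x₀ (mem_ball_self (by positivity)) ζ hζ'.le
    refine ContDiffAt.mul ?_ ?_
    · exact ContDiffAt.comp (f := fun p : E × ℂ => p.1 + p.2 • v) (x₀, ζ) h1 (by fun_prop)
    · exact ContDiffAt.inv (by fun_prop) (pow_ne_zero 2 hζ0)
  refine hInt.congr_of_eventuallyEq ?_
  filter_upwards [ball_mem_nhds x₀ (show 0 < r / 2 by positivity)] with x hx
  set T : Set ℂ := {ζ | ContDiffAt ℂ 1 φ (x + ζ • v)} with hT
  have hTo : IsOpen T := by
    rw [isOpen_iff_mem_nhds]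
    intro ζ hζ
    have hζ' : ContDiffAt ℂ 1 φ (x + ζ • v) := hζ
    have h1 := hζ'.eventually (by simp)
    have h2 : ContinuousAt (fun ζ : ℂ => x + ζ • v) ζ := by fun_prop
    exact h2.eventually h1
  have hTs : closedBall (0 : ℂ) ρ ⊆ T := fun ζ hζ => key x hx ζ (by simpa using hζ)
  have hd : DifferentiableOn ℂ (fun ζ : ℂ => φ (x + ζ • v)) T := by
    intro t ht
    have ht' : ContDiffAt ℂ 1 φ (x + t • v) := ht
    have h1 : DifferentiableAt ℂ φ (x + t • v) := ht'.differentiableAt (by simp)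
    exact (DifferentiableAt.comp (f := fun t : ℂ => x + t • v) t h1
      (by fun_prop)).differentiableWithinAt
  have hC := Complex.two_pi_I_inv_smul_circleIntegral_sub_sq_inv_smul_of_differentiable
    hTo hTs hd (w₀ := 0) (by simpa using hρ)
  have hder : deriv (fun ζ : ℂ => φ (x + ζ • v)) 0 = fderiv ℂ φ x v := by
    have h1 : HasFDerivAt φ (fderiv ℂ φ x) (x + (0 : ℂ) • v) := by
      have h2 := key x hx 0 (by simpa using hρ.le)
      simp only [zero_smul, add_zero] at h2 ⊢
      exact (h2.differentiableAt (by simp)).hasFDerivAt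
    have h3 : HasDerivAt (fun ζ : ℂ => x + ζ • v) v 0 := by
      simpa using ((hasDerivAt_id (0 : ℂ)).smul_const v).const_add x
    exact (h1.comp_hasDerivAt (0 : ℂ) h3).deriv
  rw [← hder, ← hC]
  simp only [sub_zero, smul_eq_mul]
  congr 2
  ext ζ
  rw [mul_comm]

theorem hol_divide {φ : E → ℂ} (h : ContDiffAt ℂ 1 φ 0) (u : E →L[ℂ] ℂ) (e : E)
    (hz : ∀ᶠ y in 𝓝 (0 : E), φ (y - u y • e) = 0) :
    ∃ φ₁ : E → ℂ, ContDiffAt ℂ 1 φ₁ 0 ∧ ∀ᶠ x in 𝓝 (0 : E), φ x = u x * φ₁ x := by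
  obtain ⟨r, hr, hb⟩ := hol_ball h
  obtain ⟨ρ, hρ, hρv⟩ : ∃ ρ > 0, ρ * ‖e‖ < r / 2 := by
    refine ⟨r / 2 / (‖e‖ + 1), by positivity, ?_⟩
    rw [div_mul_eq_mul_div, div_lt_iff₀ (by positivity)]
    nlinarith [norm_nonneg e]
  have key : ∀ x : E, ‖x - u x • e‖ < r / 2 → ∀ ζ : ℂ, ‖ζ‖ ≤ ρ →
      ContDiffAt ℂ 1 φ (x - u x • e + ζ • e) := by
    intro x hx ζ hζ
    apply hb
    rw [mem_ball_zero_iff]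
    have h1 := norm_add_le (x - u x • e) (ζ • e)
    rw [norm_smul] at h1
    nlinarith [norm_nonneg e]
  refine ⟨fun x => (2 * Real.pi * Complex.I : ℂ)⁻¹ *
        ∮ ζ in C(0, ρ), φ (x - u x • e + ζ • e) * (ζ * (ζ - u x))⁻¹, ?_, ?_⟩
  · refine contDiffAt_const.mul ?_
    refine contDiffAt_circleIntegral
      (fun x ζ => φ (x - u x • e + ζ • e) * (ζ * (ζ - u x))⁻¹) _ _ hρ.le ?_
    intro ζ hζ
    have hζ' : ‖ζ‖ = ρ := by simpa using hζ
    have hζ0 : ζ ≠ 0 := by rintro rfl; simp at hζ'; linarith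
    have h1 := key 0 (by simpa using hr) ζ hζ'.le
    refine ContDiffAt.mul ?_ ?_
    · exact ContDiffAt.comp (f := fun p : E × ℂ => p.1 - u p.1 • e + p.2 • e) (0, ζ) h1
        (by fun_prop)
    · exact ContDiffAt.inv (by fun_prop) (by simpa using hζ0)
  · have hc1 : ∀ᶠ x in 𝓝 (0 : E), ‖x - u x • e‖ < r / 2 := by
      have : ContinuousAt (fun x : E => ‖x - u x • e‖) 0 := by fun_prop
      exact this.eventually_lt continuousAt_const (by simpa using hr)
    have hc2 : ∀ᶠ x in 𝓝 (0 : E), ‖u x‖ < ρ := by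
      have : ContinuousAt (fun x : E => ‖u x‖) 0 := by fun_prop
      exact this.eventually_lt continuousAt_const (by simpa using hρ)
    filter_upwards [hz, hc1, hc2] with x hzx hx1 hx2
    have hdc : DiffContOnCl ℂ (fun ζ : ℂ => φ (x - u x • e + ζ • e)) (ball 0 ρ) := by
      apply DifferentiableOn.diffContOnCl
      rw [closure_ball _ hρ.ne']
      intro t ht
      have h1 : DifferentiableAt ℂ φ (x - u x • e + t • e) :=
        (key x hx1 t (by simpa using ht)).differentiableAt (by simp)
      exact (DifferentiableAt.comp (f := fun t : ℂ => x - u x • e + t • e) t h1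
        (by fun_prop)).differentiableWithinAt
    have hw : u x ∈ ball (0 : ℂ) ρ := by simpa using hx2
    have hI1 := hdc.circleIntegral_sub_inv_smul hw
    have hI0 := hdc.circleIntegral_sub_inv_smul (mem_ball_self hρ)
    have hcont : ContinuousOn (fun ζ : ℂ => φ (x - u x • e + ζ • e)) (sphere 0 ρ) := by
      have := hdc.continuousOn
      rw [closure_ball _ hρ.ne'] at this
      exact this.mono sphere_subset_closedBall
    have hne : ∀ c ∈ ball (0 : ℂ) ρ, ∀ ζ ∈ sphere (0 : ℂ) ρ, ζ - c ≠ 0 := by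
      intro c hc ζ hζ h0
      rw [sub_eq_zero] at h0
      subst h0
      simp at hc hζ
      linarith
    have hInt : ∀ c ∈ ball (0 : ℂ) ρ, CircleIntegrable
        (fun ζ : ℂ => (ζ - c)⁻¹ • φ (x - u x • e + ζ • e)) 0 ρ := by
      intro c hc
      apply ContinuousOn.circleIntegrable hρ.le
      exact ContinuousOn.smul (ContinuousOn.inv₀ (by fun_prop) (hne c hc)) hcont
    have hsub := circleIntegral.integral_sub (hInt _ hw) (hInt _ (mem_ball_self hρ))
    rw [hI1, hI0] at hsub
    simp only [zero_smul, add_zero, hzx, smul_zero, sub_zero, sub_add_cancel] at hsub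
    have h2 : (∮ ζ in C(0, ρ), ((ζ - u x)⁻¹ • φ (x - u x • e + ζ • e) -
        (ζ)⁻¹ • φ (x - u x • e + ζ • e))) =
        ∮ ζ in C(0, ρ), u x • (φ (x - u x • e + ζ • e) * (ζ * (ζ - u x))⁻¹) := by
      apply circleIntegral.integral_congr hρ.le
      intro ζ hζ
      have a := hne _ hw ζ hζ
      have b := hne 0 (mem_ball_self hρ) ζ hζ
      simp only [sub_zero] at b
      simp only [smul_eq_mul]
      field_simp
      ring
    rw [h2, circleIntegral.integral_smul] at hsub
    have hpi : (2 * Real.pi * Complex.I : ℂ) ≠ 0 := Complex.two_pi_I_ne_zero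
    simp only [smul_eq_mul] at hsub
    rw [mul_left_comm, hsub]
    field_simp

/-- If `φ` vanishes along `χ`, it can be replaced by a function vanishing along `χ` and not
vanishing identically on `ker u`. -/
theorem hol_reg {X : Type*} (𝓕 : Filter X) (u : E →L[ℂ] ℂ) (χ : X → E)
    (hχ : Tendsto χ 𝓕 (𝓝 0)) (hu0 : u ≠ 0) (hu : ∀ᶠ x in 𝓕, u (χ x) ≠ 0) (φ : E → ℂ)
    (h : ContDiffAt ℂ 1 φ 0) (hφ : ∀ᶠ x in 𝓕, φ (χ x) = 0) (hn : ¬ ∀ᶠ z in 𝓝 0, φ z = 0) :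
    ∃ φ' : E → ℂ, ContDiffAt ℂ 1 φ' 0 ∧ (∀ᶠ x in 𝓕, φ' (χ x) = 0) ∧
      ∃ w, u w = 0 ∧ ¬ ∀ᶠ t in 𝓝 (0 : ℂ), φ' (t • w) = 0 := by
  obtain ⟨e, he⟩ : ∃ e, u e = 1 := by
    obtain ⟨a, ha⟩ : ∃ a, u a ≠ 0 := by
      by_contra! hc
      exact hu0 (ContinuousLinearMap.ext hc)
    exact ⟨(u a)⁻¹ • a, by simp [ha]⟩
  obtain ⟨v, hv⟩ := hol_dir h hn
  have main : ∀ m : ℕ, ∀ φ : E → ℂ, ContDiffAt ℂ 1 φ 0 → (∀ᶠ x in 𝓕, φ (χ x) = 0) →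
      analyticOrderAt (fun t : ℂ => φ (t • v)) 0 = m → ∃ φ' : E → ℂ, ContDiffAt ℂ 1 φ' 0 ∧
      (∀ᶠ x in 𝓕, φ' (χ x) = 0) ∧
      ∃ w, u w = 0 ∧ ¬ ∀ᶠ t in 𝓝 (0 : ℂ), φ' (t • w) = 0 := by
    intro m
    induction m with
    | zero =>
      intro φ h hφ hm
      refine ⟨φ, h, hφ, 0, by simp, ?_⟩
      intro hev
      have h1 := (analyticOrderAt_eq_zero (f := fun t : ℂ => φ (t • v))).1 (by simpa using hm)
      rcases h1 with h1 | h1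
      · exact h1 (hol_analyticAt (hol_line h v))
      · have := hev.self_of_nhds
        simp at this h1
        exact h1 this
    | succ m ih =>
      intro φ h hφ hm
      by_cases hz : ∀ᶠ y in 𝓝 (0 : E), φ (y - u y • e) = 0
      · obtain ⟨φ₁, h₁, heq⟩ := hol_divide h u e hz
        refine ih φ₁ h₁ ?_ ?_
        · filter_upwards [hu, hφ, hχ.eventually heq] with x a b c
          rw [b] at c
          exact (mul_eq_zero.1 c.symm).resolve_left a
        · have hlin : Tendsto (fun t : ℂ => t • v) (𝓝 0) (𝓝 0) := by
            have : ContinuousAt (fun t : ℂ => t • v) 0 := by fun_prop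
            simpa [ContinuousAt] using this
          have hev : (fun t : ℂ => φ (t • v)) =ᶠ[𝓝 0]
              ((fun t : ℂ => t * u v) * (fun t : ℂ => φ₁ (t • v))) := by
            filter_upwards [hlin.eventually heq] with t ht
            simp [ht]
          have huv : u v ≠ 0 := by
            intro h0
            have : analyticOrderAt (fun t : ℂ => φ (t • v)) 0 = ⊤ := by
              rw [analyticOrderAt_eq_top]
              filter_upwards [hev] with t ht
              rw [ht]; simp [h0]
            rw [this] at hm
            exact ENat.natCast_ne_top _ hm.symm
          rw [analyticOrderAt_congr hev, analyticOrderAt_mul (by fun_prop)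
            (hol_analyticAt (hol_line h₁ v))] at hm
          have h1 : analyticOrderAt (fun t : ℂ => t * u v) 0 = (1 : ℕ) := by
            rw [AnalyticAt.analyticOrderAt_eq_natCast (by fun_prop)]
            exact ⟨fun _ => u v, by fun_prop, huv, by simp⟩
          rw [h1] at hm
          have h2 : ((m + 1 : ℕ) : ℕ∞) = ((1 : ℕ) : ℕ∞) + (m : ℕ∞) := by push_cast; ring
          rw [h2] at hm
          exact ENat.add_right_injective_of_ne_top (ENat.natCast_ne_top 1) hm
      · have hlin : ContDiffAt ℂ 1 (fun y => φ (y - u y • e)) 0 := by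
          have : ContDiffAt ℂ 1 φ ((0 : E) - u 0 • e) := by simpa using h
          exact ContDiffAt.comp (f := fun y : E => y - u y • e) (0 : E) this (by fun_prop)
        obtain ⟨w, hw⟩ := hol_dir hlin hz
        refine ⟨φ, h, hφ, w - u w • e, by simp [he], ?_⟩
        intro hc
        apply hw
        filter_upwards [hc] with t ht
        simpa [smul_sub, mul_smul] using ht
  have hne : analyticOrderAt (fun t : ℂ => φ (t • v)) 0 ≠ ⊤ := by
    rw [Ne, analyticOrderAt_eq_top]; exact hv
  obtain ⟨m, hm⟩ := ENat.ne_top_iff_exists.1 hne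
  exact main m φ h hφ hm.symm
end


theorem ov_fact_aux {V : Set ℂ} (hV : IsOpen V) {ρ : ℝ} (hVs : closedBall 0 ρ ⊆ V) (S : Finset ℂ) :
    ∀ f : ℂ → ℂ, DifferentiableOn ℂ f V → (∀ z ∈ sphere (0:ℂ) ρ, f z ≠ 0) →
      (∀ z ∈ closedBall (0:ℂ) ρ, ¬ ∀ᶠ w in 𝓝 z, f w = 0) →
      (∀ z ∈ closedBall (0:ℂ) ρ, f z = 0 → z ∈ S) →
      ∃ (m : ℕ) (α : Fin m → ℂ) (U : ℂ → ℂ), (∀ i, α i ∈ ball (0:ℂ) ρ) ∧ DifferentiableOn ℂ U V ∧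
        (∀ z ∈ closedBall (0:ℂ) ρ, U z ≠ 0) ∧ ∀ z, f z = (∏ i, (z - α i)) * U z := by
  induction S using Finset.induction_on with
  | empty =>
    intro f hf hs hnz hS
    exact ⟨0, fun i => 0, f, fun i => i.elim0, hf, fun z hz h => by simpa using hS z hz h, by simp⟩
  | insert a S ha ih =>
    intro f hf hs hnz hS
    by_cases hab : a ∈ closedBall (0:ℂ) ρ ∧ f a = 0
    swap
    · apply ih f hf hs hnz
      intro z hz h
      rcases Finset.mem_insert.1 (hS z hz h) with h1 | h1
      · subst h1; exact absurd ⟨hz, h⟩ hab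
      · exact h1
    obtain ⟨hab, hfa⟩ := hab
    have hfan : AnalyticAt ℂ f a := hf.analyticAt (hV.mem_nhds (hVs hab))
    have hord : analyticOrderAt f a ≠ ⊤ := by
      rw [Ne, analyticOrderAt_eq_top]; exact hnz a hab
    obtain ⟨N, hN⟩ := ENat.ne_top_iff_exists.1 hord
    obtain ⟨g₀, hg₀, hg₀a, hfg⟩ := hfan.analyticOrderAt_eq_natCast.1 hN.symm
    have hN0 : N ≠ 0 := by
      rintro rfl
      apply hg₀a
      have := hfg.self_of_nhds
      simpa [hfa] using this.symm
    set g : ℂ → ℂ := fun z => if z = a then g₀ a else f z / (z - a) ^ N with hg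
    have hfg' : ∀ z, f z = (z - a) ^ N * g z := by
      intro z
      by_cases hz : z = a
      · subst hz; simp [hfa, hN0]
      · have : (z - a) ^ N ≠ 0 := pow_ne_zero _ (sub_ne_zero.2 hz)
        simp only [hg, hz, if_false]; field_simp
    have hgg₀ : g =ᶠ[𝓝 a] g₀ := by
      filter_upwards [hfg] with z hz
      by_cases hza : z = a
      · subst hza; simp [hg]
      · have : (z - a) ^ N ≠ 0 := pow_ne_zero _ (sub_ne_zero.2 hza)
        simp only [hg, hza, if_false, hz, smul_eq_mul]; field_simp
    have hga : g a ≠ 0 := by simpa [hg] using hg₀a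
    have hgd : DifferentiableOn ℂ g V := by
      intro z hz
      by_cases hza : z = a
      · subst hza
        exact (hg₀.differentiableAt.congr_of_eventuallyEq hgg₀).differentiableWithinAt
      · have h1 : DifferentiableAt ℂ (fun z => f z / (z - a) ^ N) z :=
          (hf.differentiableAt (hV.mem_nhds hz)).div (by fun_prop) (pow_ne_zero _ (sub_ne_zero.2 hza))
        refine (h1.congr_of_eventuallyEq ?_).differentiableWithinAt
        filter_upwards [isOpen_ne.mem_nhds hza] with w hw
        simp [hg, show w ≠ a from hw]
    obtain ⟨m, α, U, hα, hU, hU0, hgU⟩ := ih g hgd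
      (fun z hz h => hs z hz (by rw [hfg', h, mul_zero]))
      (fun z hz h => hnz z hz (h.mono fun w hw => by rw [hfg', hw, mul_zero]))
      (fun z hz h => by
        rcases Finset.mem_insert.1 (hS z hz (by rw [hfg', h, mul_zero])) with h1 | h1
        · subst h1; exact absurd h hga
        · exact h1)
    have ha' : a ∈ ball (0:ℂ) ρ := by
      rcases (mem_closedBall.1 hab).lt_or_eq with h | h
      · exact h
      · exact absurd hfa (hs a h)
    refine ⟨N + m, Fin.append (fun _ => a) α, U, ?_, hU, hU0, ?_⟩
    · intro i
      refine Fin.addCases (fun j => ?_) (fun j => ?_) i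
      · simpa using ha'
      · simpa using hα j
    · intro z
      rw [hfg', hgU, Fin.prod_univ_add]
      simp [mul_assoc]

theorem ov_fact {V : Set ℂ} (hV : IsOpen V) {ρ : ℝ} (hρ : 0 < ρ) (hVs : closedBall 0 ρ ⊆ V)
    (f : ℂ → ℂ) (hf : DifferentiableOn ℂ f V) (hs : ∀ z ∈ sphere (0:ℂ) ρ, f z ≠ 0) :
      ∃ (m : ℕ) (α : Fin m → ℂ) (U : ℂ → ℂ), (∀ i, α i ∈ ball (0:ℂ) ρ) ∧ DifferentiableOn ℂ U V ∧
        (∀ z ∈ closedBall (0:ℂ) ρ, U z ≠ 0) ∧ ∀ z, f z = (∏ i, (z - α i)) * U z := by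
  have han : AnalyticOnNhd ℂ f (closedBall 0 ρ) := fun z hz =>
    hf.analyticAt (hV.mem_nhds (hVs hz))
  have hpre : IsPreconnected (closedBall (0:ℂ) ρ) := (convex_closedBall _ _).isPreconnected
  have hsp : ∀ z ∈ closedBall (0:ℂ) ρ, ¬ ∃ᶠ w in 𝓝[≠] z, f w = 0 := by
    intro z hz h
    have := han.eqOn_zero_of_preconnected_of_frequently_eq_zero hpre hz h
    have h1 : (ρ : ℂ) ∈ sphere (0:ℂ) ρ := by simp [abs_of_pos hρ]
    exact hs _ h1 (this (sphere_subset_closedBall h1))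
  have hfin : {z | z ∈ closedBall (0:ℂ) ρ ∧ f z = 0}.Finite := by
    by_contra hinf
    obtain ⟨z, hz, hacc⟩ := Set.Infinite.exists_accPt_of_subset_isCompact hinf
      (isCompact_closedBall (0:ℂ) ρ) (fun z hz => hz.1)
    apply hsp z hz
    rw [accPt_iff_frequently_nhdsNE] at hacc
    exact hacc.mono fun w hw => hw.2
  refine ov_fact_aux hV hVs hfin.toFinset f hf hs ?_ ?_
  · intro z hz h
    exact hsp z hz (h.filter_mono nhdsWithin_le_nhds).frequently
  · intro z hz h
    simp only [Set.Finite.mem_toFinset]; exact ⟨hz, h⟩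

theorem ov_moment {V : Set ℂ} (hV : IsOpen V) {ρ : ℝ} (hρ : 0 < ρ) (hVs : closedBall 0 ρ ⊆ V)
    {m : ℕ} {α : Fin m → ℂ} {f U : ℂ → ℂ} (hα : ∀ i, α i ∈ ball (0:ℂ) ρ)
    (hU : DifferentiableOn ℂ U V) (hU0 : ∀ z ∈ closedBall (0:ℂ) ρ, U z ≠ 0)
    (hfU : ∀ z, f z = (∏ i, (z - α i)) * U z) (k : ℕ) :
    ∮ z in C(0, ρ), z ^ k * (deriv f z / f z) = 2 * Real.pi * Complex.I * ∑ i, α i ^ k := by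
  have hne : ∀ z ∈ sphere (0:ℂ) ρ, ∀ i, z - α i ≠ 0 := by
    intro z hz i h
    have h1 := hα i
    rw [← sub_eq_zero.1 h] at h1
    exact (ne_of_lt (mem_ball.1 h1)) hz
  have hU1 : ContinuousOn (fun z => z ^ k * (deriv U z / U z)) (closedBall (0:ℂ) ρ) := by
    refine (continuousOn_id.pow k).mul (ContinuousOn.div ?_ (hU.continuousOn.mono hVs) hU0)
    exact ((hU.deriv hV).continuousOn.mono hVs)
  have hI : ∀ i, CircleIntegrable (fun z => (z - α i)⁻¹ * z ^ k) 0 ρ := by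
    intro i
    refine ContinuousOn.circleIntegrable hρ.le ?_
    refine ContinuousOn.mul (ContinuousOn.inv₀ (by fun_prop) fun z hz => hne z hz i) (by fun_prop)
  have h1 : ∀ z ∈ sphere (0:ℂ) ρ, z ^ k * (deriv f z / f z) =
      (∑ i, (z - α i)⁻¹ * z ^ k) + z ^ k * (deriv U z / U z) := by
    intro z hz
    have hz' := sphere_subset_closedBall hz
    have e1 : f = fun z => (∏ i, (z - α i)) * U z := funext hfU
    have e2 : deriv f z / f z = logDeriv f z := rfl
    have e3 : logDeriv f z = logDeriv (fun z => ∏ i, (z - α i)) z + logDeriv U z := by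
      rw [e1]
      exact logDeriv_mul z (Finset.prod_ne_zero_iff.2 fun i _ => hne z hz i) (hU0 z hz')
        (by fun_prop) (hU.differentiableAt (hV.mem_nhds (hVs hz')))
    have e4 : logDeriv (fun z => ∏ i, (z - α i)) z = ∑ i, (z - α i)⁻¹ := by
      have := logDeriv_prod (s := Finset.univ) (f := fun (i : Fin m) (z : ℂ) => z - α i) (x := z)
        (fun i _ => hne z hz i) (fun i _ => by fun_prop)
      rw [this]
      refine Finset.sum_congr rfl fun i _ => ?_
      simp [logDeriv_apply]
    rw [e2, e3, e4, mul_add, Finset.mul_sum]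
    congr 1
    exact Finset.sum_congr rfl fun i _ => mul_comm _ _
  rw [circleIntegral.integral_congr hρ.le h1, circleIntegral.integral_add,
    circleIntegral.integral_fun_sum]
  · rw [Complex.circleIntegral_eq_zero_of_differentiable_on_off_countable hρ.le Set.countable_empty hU1,
      add_zero, Finset.mul_sum]
    · refine Finset.sum_congr rfl fun i _ => ?_
      have := DifferentiableOn.circleIntegral_sub_inv_smul (f := fun z : ℂ => z ^ k) (R := ρ) (c := 0)
        (w := α i) (by fun_prop) (hα i)
      simpa using this
    · intro z hz
      have hzV : z ∈ V := hVs (ball_subset_closedBall hz.1)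
      exact (by fun_prop : DifferentiableAt ℂ (fun z : ℂ => z ^ k) z).mul
        (((hU.deriv hV).differentiableAt (hV.mem_nhds hzV)).div (hU.differentiableAt (hV.mem_nhds hzV))
        (hU0 z (ball_subset_closedBall hz.1)))
  · exact fun i _ => hI i
  · exact CircleIntegrable.fun_sum _ fun i _ => hI i
  · exact (hU1.mono sphere_subset_closedBall).circleIntegrable hρ.le


/-- The ring of functions that are holomorphic near the origin. -/
def HolRing (E : Type*) [NormedAddCommGroup E] [NormedSpace ℂ E] : Subring (E → ℂ) where
  carrier := {φ | ContDiffAt ℂ 1 φ 0}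
  mul_mem' := fun {a b} (ha : ContDiffAt ℂ 1 a 0) (hb : ContDiffAt ℂ 1 b 0) => ha.mul hb
  one_mem' := (contDiffAt_const : ContDiffAt ℂ 1 (fun _ : E => (1:ℂ)) 0)
  add_mem' := fun {a b} (ha : ContDiffAt ℂ 1 a 0) (hb : ContDiffAt ℂ 1 b 0) => ha.add hb
  zero_mem' := (contDiffAt_const : ContDiffAt ℂ 1 (fun _ : E => (0:ℂ)) 0)
  neg_mem' := fun {a} (ha : ContDiffAt ℂ 1 a 0) => ha.neg

/-- Evaluation at a point. -/
def evx {E : Type*} [NormedAddCommGroup E] [NormedSpace ℂ E] (x : E) : HolRing E →+* ℂ :=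
  (Pi.evalRingHom (fun _ => ℂ) x).comp (HolRing E).subtype

section
variable {E : Type*} [NormedAddCommGroup E] [NormedSpace ℂ E]

@[simp] theorem evx_apply (x : E) (a : HolRing E) : evx x a = a.1 x := rfl

theorem esymm_hol {e : ℕ} (α : E → Fin e → ℂ)
    (hP : ∀ k, ContDiffAt ℂ 1 (fun x => ∑ i, α x i ^ k) 0) (k : ℕ) :
    ContDiffAt ℂ 1 (fun x => MvPolynomial.aeval (α x) (MvPolynomial.esymm (Fin e) ℂ k)) 0 := by
  induction k using Nat.strong_induction_on with
  | _ k ih =>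
  rcases Nat.eq_zero_or_pos k with rfl | hk
  · simpa using contDiffAt_const
  have key : (fun x => MvPolynomial.aeval (α x) (MvPolynomial.esymm (Fin e) ℂ k)) =
      fun x => (k : ℂ)⁻¹ * ((-1) ^ (k + 1) *
      ∑ a ∈ Finset.HasAntidiagonal.antidiagonal k with a.1 < k, (-1) ^ a.1 *
        MvPolynomial.aeval (α x) (MvPolynomial.esymm (Fin e) ℂ a.1) * ∑ i, α x i ^ a.2) := by
    funext x
    have := congrArg (MvPolynomial.aeval (α x)) (MvPolynomial.mul_esymm_eq_sum (Fin e) ℂ k)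
    simp only [map_mul, map_natCast, map_sum, map_pow, map_neg, map_one, MvPolynomial.psum,
      MvPolynomial.aeval_X] at this
    rw [← this]
    have : (k : ℂ) ≠ 0 := by exact_mod_cast hk.ne'
    field_simp
  rw [key]
  refine contDiffAt_const.mul (contDiffAt_const.mul (ContDiffAt.sum fun a ha => ?_))
  exact (contDiffAt_const.mul (ih _ (Finset.mem_filter.1 ha).2)).mul (hP _)

open Polynomial in
theorem exists_poly_hol {e : ℕ} (α : E → Fin e → ℂ)
    (hP : ∀ k, ContDiffAt ℂ 1 (fun x => ∑ i, α x i ^ k) 0) :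
    ∃ W : (HolRing E)[X], W.Monic ∧ W.natDegree = e ∧
      ∀ x, W.map (evx x) = ∏ i, (X - C (α x i)) := by
  set Q : E → ℂ[X] := fun x => ∏ i, (X - C (α x i)) with hQ
  have hQm : ∀ x, (Q x).Monic := fun x => monic_prod_of_monic _ _ fun i _ => monic_X_sub_C _
  have hQd : ∀ x, (Q x).natDegree = e := by
    intro x
    rw [hQ]; simp only; rw [natDegree_prod_of_monic _ _ fun i _ => monic_X_sub_C _]; simp
  have hQc : ∀ j, ContDiffAt ℂ 1 (fun x => (Q x).coeff j) 0 := by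
    intro j
    have : (fun x => (Q x).coeff j) = fun x => ∑ i ∈ Finset.range (e+1), 
        (if j = e - i then (-1) ^ i * MvPolynomial.aeval (α x) (MvPolynomial.esymm (Fin e) ℂ i) else 0) := by
      funext x
      have h1 := Multiset.prod_X_sub_X_eq_sum_esymm (Finset.univ.val.map (α x))
      have h2 : Q x = ((Finset.univ.val.map (α x)).map fun t => X - C t).prod := by
        rw [Multiset.map_map]; rfl
      rw [h2, h1, finsetSum_coeff]
      simp only [Multiset.card_map, Finset.card_val, Finset.card_univ, Fintype.card_fin]
      refine Finset.sum_congr rfl fun i _ => ?_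
      rw [show ((-1 : ℂ[X])) ^ i = C ((-1) ^ i) by simp, ← mul_assoc, ← C_mul, coeff_C_mul_X_pow,
        MvPolynomial.aeval_esymm_eq_multiset_esymm]
    rw [this]
    refine ContDiffAt.sum fun i _ => ?_
    split_ifs
    · exact contDiffAt_const.mul (esymm_hol α hP i)
    · exact contDiffAt_const
  set W : (HolRing E)[X] := X ^ e + ∑ j ∈ Finset.range e, C ⟨_, hQc j⟩ * X ^ j with hW
  have hdeg : (∑ j ∈ Finset.range e, C (⟨_, hQc j⟩ : HolRing E) * X ^ j).degree < (e : WithBot ℕ) := by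
    refine lt_of_le_of_lt (degree_sum_le _ _) ?_
    rw [Finset.sup_lt_iff (by exact WithBot.bot_lt_coe _)]
    intro j hj
    exact lt_of_le_of_lt (degree_C_mul_X_pow_le _ _) (by exact_mod_cast Finset.mem_range.1 hj)
  have hM : W.Monic := monic_X_pow_add hdeg
  have hmap : ∀ x, W.map (evx x) = Q x := by
    intro x
    rw [(hQm x).as_sum, hQd]
    simp [hW, Polynomial.map_sum]
  refine ⟨W, hM, ?_, hmap⟩
  rw [← hM.natDegree_map (evx 0), hmap, hQd]

open Polynomial in
theorem weier_poly (φ : E × ℂ → ℂ) (h : ContDiffAt ℂ 1 φ 0)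
    (hn : ¬ ∀ᶠ t in 𝓝 (0:ℂ), φ (0, t) = 0) :
    ∃ W : (HolRing E)[X], W.Monic ∧ (W.natDegree : ℕ∞) = analyticOrderAt (fun t => φ (0, t)) 0 ∧
      W.map (evx 0) = X ^ W.natDegree ∧
      ∀ᶠ p in 𝓝 (0 : E × ℂ), φ p = 0 → W.eval₂ (evx p.1) p.2 = 0 := by
  obtain ⟨R, hR, hb⟩ := hol_ball h
  have hb' : ∀ x : E, ∀ z : ℂ, ‖x‖ < R → ‖z‖ < R → ContDiffAt ℂ 1 φ (x, z) := by
    intro x z hx hz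
    apply hb
    rw [mem_ball_zero_iff, Prod.norm_def]; exact max_lt hx hz
  have hslice : ∀ x : E, ∀ z : ℂ, ‖x‖ < R → ‖z‖ < R →
      HasDerivAt (fun t => φ (x, t)) (fderiv ℂ φ (x, z) (0, 1)) z := by
    intro x z hx hz
    have h1 := ((hb' x z hx hz).differentiableAt (by simp)).hasFDerivAt
    have h2 : HasDerivAt (fun t : ℂ => (x, t)) ((0 : E), (1:ℂ)) z :=
      (hasDerivAt_const z x).prodMk (hasDerivAt_id z)
    exact h1.comp_hasDerivAt z h2
  have hA0 : AnalyticAt ℂ (fun t => φ (0, t)) 0 := by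
    refine hol_analyticAt ?_
    exact ContDiffAt.comp (f := fun t : ℂ => ((0:E), t)) (0:ℂ) (g := φ) h (by fun_prop)
  have hne0 := hA0.eventually_eq_zero_or_eventually_ne_zero.resolve_left hn
  rw [eventually_nhdsWithin_iff, Metric.eventually_nhds_iff] at hne0
  obtain ⟨r₁, hr₁, hne0⟩ := hne0
  obtain ⟨ρ, hρ, hρR⟩ : ∃ ρ, 0 < ρ ∧ ρ < min R r₁ := exists_between (lt_min hR hr₁)
  obtain ⟨hρR, hρr⟩ := lt_min_iff.1 hρR
  have hne0' : ∀ t : ℂ, ‖t‖ ≤ ρ → φ (0, t) = 0 → t = 0 := by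
    intro t ht h0
    by_contra htne
    exact hne0 (y := t) (by rw [dist_zero_right]; linarith) htne h0
  have hVs : closedBall (0:ℂ) ρ ⊆ ball 0 R := closedBall_subset_ball hρR
  have hdiff : ∀ x : E, ‖x‖ < R → DifferentiableOn ℂ (fun t => φ (x, t)) (ball 0 R) :=
    fun x hx z hz => (hslice x z hx (by simpa using hz)).differentiableAt.differentiableWithinAt
  have hsph : ∀ᶠ x in 𝓝 (0:E), ∀ ζ ∈ sphere (0:ℂ) ρ, φ (x, ζ) ≠ 0 := by
    refine (isCompact_sphere (0:ℂ) ρ).eventually_forall_of_forall_eventually fun ζ hζ => ?_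
    have hζ' : ‖ζ‖ = ρ := by simpa using hζ
    have h1 : ContinuousAt φ (0, ζ) := (hb' 0 ζ (by simpa) (by linarith)).continuousAt
    refine h1.eventually_ne fun h0 => ?_
    have := hne0' ζ hζ'.le h0
    rw [this] at hζ'; simp at hζ'; linarith
  have hxR : ∀ᶠ x in 𝓝 (0:E), ‖x‖ < R := by
    filter_upwards [ball_mem_nhds (0:E) hR] with x hx using by simpa using hx
  -- moments
  set M : ℕ → E → ℂ := fun k x => (2 * Real.pi * Complex.I)⁻¹ *
    ∮ z in C(0, ρ), z ^ k * (fderiv ℂ φ (x, z) (0, 1) / φ (x, z)) with hM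
  have hMhol : ∀ k, ContDiffAt ℂ 1 (M k) 0 := by
    intro k
    refine contDiffAt_const.mul (contDiffAt_circleIntegral
      (fun x z => z ^ k * (fderiv ℂ φ (x, z) (0, 1) / φ (x, z))) 0 ρ hρ.le fun ζ hζ => ?_)
    have hζ' : ‖ζ‖ = ρ := by simpa using hζ
    have h1 := hb' 0 ζ (by simpa) (by linarith)
    refine ContDiffAt.mul (by fun_prop) (ContDiffAt.div (hol_fderiv h1 _) h1 ?_)
    exact hsph.self_of_nhds ζ hζ
  have hpi : (2 * Real.pi * Complex.I : ℂ) ≠ 0 := Complex.two_pi_I_ne_zero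
  have hfac : ∀ᶠ x in 𝓝 (0:E), ∃ (m : ℕ) (α : Fin m → ℂ) (U : ℂ → ℂ), (∀ i, α i ∈ ball (0:ℂ) ρ) ∧
      DifferentiableOn ℂ U (ball 0 R) ∧
        (∀ z ∈ closedBall (0:ℂ) ρ, U z ≠ 0) ∧ (∀ z, φ (x, z) = (∏ i, (z - α i)) * U z) ∧
        ∀ k, M k x = ∑ i, α i ^ k := by
    filter_upwards [hsph, hxR] with x hx hxR
    obtain ⟨m, α, U, h1, h2, h3, h4⟩ := ov_fact isOpen_ball hρ hVs _ (hdiff x hxR) hx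
    refine ⟨m, α, U, h1, h2, h3, h4, fun k => ?_⟩
    have := ov_moment isOpen_ball hρ hVs h1 h2 h3 h4 k
    rw [hM]
    rw [inv_mul_eq_iff_eq_mul₀ hpi, ← this]
    refine circleIntegral.integral_congr hρ.le fun z hz => ?_
    have hz' : ‖z‖ = ρ := by simpa using hz
    rw [(hslice x z hxR (by linarith)).deriv]
  obtain ⟨e, α₀, U₀, hα₀, hU₀, hU₀n, hfU₀, hM₀⟩ := hfac.self_of_nhds
  have hconst : ∀ᶠ x in 𝓝 (0:E), dist (M 0 x) (M 0 0) < 1 :=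
    (hMhol 0).continuousAt.eventually (ball_mem_nhds _ one_pos)
  have hfac2 : ∀ᶠ x in 𝓝 (0:E), ∃ (α : Fin e → ℂ), ((∀ i, α i ∈ ball (0:ℂ) ρ) ∧ ∃ U : ℂ → ℂ,
      (∀ z ∈ closedBall (0:ℂ) ρ, U z ≠ 0) ∧ (∀ z, φ (x, z) = (∏ i, (z - α i)) * U z)) ∧
        ∀ k, M k x = ∑ i, α i ^ k := by
    filter_upwards [hfac, hconst] with x ⟨m, α, U, h1, h2, h3, h4, h5⟩ hx
    have : m = e := by
      rw [h5 0, hM₀ 0] at hx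
      simp only [pow_zero, Finset.sum_const, Finset.card_univ, Fintype.card_fin, nsmul_eq_mul,
        mul_one] at hx
      rw [← Int.cast_natCast m, ← Int.cast_natCast e, dist_eq_norm, ← Int.cast_sub, Complex.norm_intCast] at hx
      have : |(m : ℤ) - e| < 1 := by exact_mod_cast hx
      rw [Int.abs_lt_one_iff] at this
      omega
    subst this
    exact ⟨α, ⟨h1, U, h3, h4⟩, h5⟩
  have hα₀' : ∀ i, α₀ i = 0 := by
    intro i
    refine hne0' _ (by simpa using (mem_ball.1 (hα₀ i)).le) ?_
    rw [hfU₀, Finset.prod_eq_zero (Finset.mem_univ i) (by simp), zero_mul]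
  obtain ⟨α, hα⟩ : ∃ α : E → Fin e → ℂ, ∀ᶠ x in 𝓝 (0:E), ((∀ i, α x i ∈ ball (0:ℂ) ρ) ∧
      ∃ U : ℂ → ℂ,
      (∀ z ∈ closedBall (0:ℂ) ρ, U z ≠ 0) ∧ (∀ z, φ (x, z) = (∏ i, (z - α x i)) * U z)) ∧
        ∀ k, M k x = ∑ i, α x i ^ k := hfac2.choice
  obtain ⟨W, hWm, hWd, hWmap⟩ := exists_poly_hol α (fun k =>
    (hMhol k).congr_of_eventuallyEq (hα.mono fun x hx => (hx.2 k).symm))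
  refine ⟨W, hWm, ?_, ?_, ?_⟩
  · rw [hWd, eq_comm, hA0.analyticOrderAt_eq_natCast]
    refine ⟨U₀, hU₀.analyticAt (isOpen_ball.mem_nhds (by simpa)), hU₀n 0 (by simpa using hρ.le), ?_⟩
    filter_upwards with z
    rw [hfU₀]; simp [hα₀']
  · rw [hWmap, hWd]
    obtain ⟨⟨h1, U, h2, h3⟩, -⟩ := hα.self_of_nhds
    have : ∀ i, α 0 i = 0 := by
      intro i
      refine hne0' _ (by simpa using (mem_ball.1 (h1 i)).le) ?_
      rw [h3, Finset.prod_eq_zero (Finset.mem_univ i) (by simp), zero_mul]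
    simp [this]
  · have h1 : ∀ᶠ p in 𝓝 (0 : E × ℂ), ‖p.2‖ < ρ := by
      have : ContinuousAt (fun p : E × ℂ => ‖p.2‖) 0 := by fun_prop
      exact this.eventually (gt_mem_nhds (by simpa using hρ))
    have h2 := (continuous_fst.continuousAt (x := (0 : E × ℂ))).eventually hα
    filter_upwards [h1, h2] with p hp1 hp2 hp
    obtain ⟨⟨-, U, h2, h3⟩, -⟩ := hp2
    rw [← eval_map, hWmap, eval_prod]
    simp only [eval_sub, eval_X, eval_C]
    have := h3 p.2
    rw [show (p.1, p.2) = p from rfl, hp] at this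
    exact (mul_eq_zero.1 this.symm).resolve_right (h2 _ (by simpa using hp1.le))
end


section
variable {E : Type*} [NormedAddCommGroup E] [NormedSpace ℂ E]
open Polynomial

/-- The function on `E × ℂ` defined by a polynomial. -/
noncomputable def pev (W : (HolRing E)[X]) (p : E × ℂ) : ℂ := W.eval₂ (evx p.1) p.2

theorem pev_add (A B : (HolRing E)[X]) (p) : pev (A + B) p = pev A p + pev B p := eval₂_add _ _
theorem pev_mul (A B : (HolRing E)[X]) (p) : pev (A * B) p = pev A p * pev B p := eval₂_mul _ _
theorem pev_sum_range (W : (HolRing E)[X]) (p : E × ℂ) :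
    pev W p = ∑ k ∈ Finset.range (W.natDegree + 1), (W.coeff k).1 p.1 * p.2 ^ k := by
  rw [pev, eval₂_eq_sum_range]; rfl

theorem pev_cd (W : (HolRing E)[X]) (z : ℂ) : ContDiffAt ℂ 1 (pev W) (0, z) := by
  rw [show pev W = fun p => _ from funext (pev_sum_range W)]
  refine ContDiffAt.sum fun k _ => ?_
  have h1 : ContDiffAt ℂ 1 (W.coeff k).1 ((0 : E), z).1 := (W.coeff k).2
  exact (h1.comp ((0:E), z) contDiffAt_fst).mul (by fun_prop)

theorem weier_div (W : (HolRing E)[X]) (hm : W.Monic) (hW0 : W.map (evx 0) = X ^ W.natDegree)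
    (ψ : E × ℂ → ℂ) (hψ : ContDiffAt ℂ 1 ψ 0) :
    ∃ (q : E × ℂ → ℂ) (r : (HolRing E)[X]), ContDiffAt ℂ 1 q 0 ∧
      ∀ᶠ p in 𝓝 (0 : E × ℂ), ψ p = q p * pev W p + pev r p := by
  obtain ⟨R, hR, hb⟩ := hol_ball hψ
  have hb' : ∀ x : E, ∀ z : ℂ, ‖x‖ < R → ‖z‖ < R → ContDiffAt ℂ 1 ψ (x, z) := by
    intro x z hx hz
    apply hb
    rw [mem_ball_zero_iff, Prod.norm_def]; exact max_lt hx hz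
  obtain ⟨ρ, hρ, hρR⟩ := exists_between hR
  have hw0 : ∀ z : ℂ, pev W (0, z) = z ^ W.natDegree := by
    intro z; rw [pev, ← eval_map, hW0]; simp
  have hsz : ∀ ζ ∈ sphere (0:ℂ) ρ, ζ ≠ 0 := by
    rintro ζ hζ rfl
    simp at hζ; linarith
  have hpi : (2 * Real.pi * Complex.I : ℂ) ≠ 0 := Complex.two_pi_I_ne_zero
  have hquot : ∀ ζ ∈ sphere (0:ℂ) ρ, ContDiffAt ℂ 1 (fun p : E × ℂ => ψ p / pev W p) (0, ζ) := by
    intro ζ hζ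
    have hζ' : ‖ζ‖ = ρ := by simpa using hζ
    refine (hb' 0 ζ (by simpa) (by linarith)).div (pev_cd W ζ) ?_
    rw [hw0]; exact pow_ne_zero _ (hsz ζ hζ)
  set J : ℕ → E → ℂ := fun j x => (2 * Real.pi * Complex.I)⁻¹ *
    ∮ ζ in C(0, ρ), ψ (x, ζ) / pev W (x, ζ) * ζ ^ j with hJ
  have hJh : ∀ j, ContDiffAt ℂ 1 (J j) 0 := by
    intro j
    refine contDiffAt_const.mul (contDiffAt_circleIntegral
      (fun x ζ => ψ (x, ζ) / pev W (x, ζ) * ζ ^ j) 0 ρ hρ.le fun ζ hζ => ?_)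
    exact (hquot ζ hζ).mul (by fun_prop)
  set q : E × ℂ → ℂ := fun p => (2 * Real.pi * Complex.I)⁻¹ *
    ∮ ζ in C(0, ρ), ψ (p.1, ζ) / pev W (p.1, ζ) * (ζ - p.2)⁻¹ with hq
  have hqh : ContDiffAt ℂ 1 q 0 := by
    refine contDiffAt_const.mul (contDiffAt_circleIntegral
      (fun (p : E × ℂ) ζ => ψ (p.1, ζ) / pev W (p.1, ζ) * (ζ - p.2)⁻¹) 0 ρ hρ.le fun ζ hζ => ?_)
    refine ContDiffAt.mul ?_ (ContDiffAt.inv (by fun_prop) ?_)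
    · exact ContDiffAt.comp (f := fun p : (E × ℂ) × ℂ => (p.1.1, p.2)) ((0 : E × ℂ), ζ)
        (hquot ζ hζ) (by fun_prop)
    · simpa using hsz ζ hζ
  set r : (HolRing E)[X] := ∑ k ∈ Finset.range (W.natDegree + 1), ∑ i ∈ Finset.range k,
    C ((⟨J (k - 1 - i), hJh _⟩ : HolRing E) * W.coeff k) * X ^ i with hr
  have hrev : ∀ p : E × ℂ, pev r p = ∑ k ∈ Finset.range (W.natDegree + 1), ∑ i ∈ Finset.range k,
      (J (k - 1 - i) p.1 * (W.coeff k).1 p.1) * p.2 ^ i := by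
    intro p
    simp only [pev, hr, eval₂_finsetSum, eval₂_mul, eval₂_C, eval₂_pow, eval₂_X]
    rfl
  refine ⟨q, r, hqh, ?_⟩
  have hwn : ∀ᶠ x in 𝓝 (0:E), ∀ ζ ∈ sphere (0:ℂ) ρ, pev W (x, ζ) ≠ 0 ∧
      ContinuousAt (fun p => ψ p / pev W p) (x, ζ) := by
    refine (isCompact_sphere (0:ℂ) ρ).eventually_forall_of_forall_eventually fun ζ hζ => ?_
    have h1 : ∀ᶠ p : E × ℂ in 𝓝 (0, ζ), pev W p ≠ 0 := by
      refine (pev_cd W ζ).continuousAt.eventually_ne ?_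
      rw [hw0]; exact pow_ne_zero _ (hsz ζ hζ)
    have h2 := (hquot ζ hζ).eventually (by simp)
    filter_upwards [h1, h2] with p h1 h2 using ⟨h1, h2.continuousAt⟩
  have hxR : ∀ᶠ p in 𝓝 (0:E × ℂ), ‖p.1‖ < R := by
    have : ContinuousAt (fun p : E × ℂ => ‖p.1‖) 0 := by fun_prop
    exact this.eventually (gt_mem_nhds (by simpa using hR))
  have hzρ : ∀ᶠ p in 𝓝 (0:E × ℂ), ‖p.2‖ < ρ := by
    have : ContinuousAt (fun p : E × ℂ => ‖p.2‖) 0 := by fun_prop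
    exact this.eventually (gt_mem_nhds (by simpa using hρ))
  have hwn' := (continuous_fst.continuousAt (x := (0 : E × ℂ))).eventually hwn
  filter_upwards [hxR, hzρ, hwn'] with p hxR hzρ hwn
  obtain ⟨x, z⟩ := p
  simp only at hxR hzρ hwn
  have hzb : z ∈ ball (0:ℂ) ρ := by simpa using hzρ
  have hzs : ∀ ζ ∈ sphere (0:ℂ) ρ, ζ - z ≠ 0 := by
    intro ζ hζ h
    rw [sub_eq_zero.1 h] at hζ
    exact (ne_of_lt (mem_ball.1 hzb)) hζ
  have hd : DifferentiableOn ℂ (fun t => ψ (x, t)) (closedBall 0 ρ) := by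
    intro t ht
    have ht' : ‖t‖ ≤ ρ := by simpa using ht
    have h1 := (hb' x t hxR (by linarith)).differentiableAt (by simp)
    exact (DifferentiableAt.comp (f := fun t : ℂ => (x, t)) t h1 (by fun_prop)).differentiableWithinAt
  have hcauchy := hd.circleIntegral_sub_inv_smul hzb
  have hc : ContinuousOn (fun ζ => ψ (x, ζ) / pev W (x, ζ)) (sphere (0:ℂ) ρ) := by
    intro ζ hζ
    exact (ContinuousAt.comp (f := fun t : ℂ => (x, t)) (hwn ζ hζ).2
      (by fun_prop)).continuousWithinAt
  have hcJ : ∀ j, CircleIntegrable (fun ζ => ψ (x, ζ) / pev W (x, ζ) * ζ ^ j) 0 ρ := fun j =>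
    (hc.mul (by fun_prop)).circleIntegrable hρ.le
  have hcq : CircleIntegrable (fun ζ => ψ (x, ζ) / pev W (x, ζ) * (ζ - z)⁻¹) 0 ρ :=
    (hc.mul (ContinuousOn.inv₀ (by fun_prop) hzs)).circleIntegrable hρ.le
  have hcJ' : ∀ k i, CircleIntegrable (fun ζ => ((W.coeff k).1 x * z ^ i) *
      (ψ (x, ζ) / pev W (x, ζ) * ζ ^ (k - 1 - i))) 0 ρ :=
    fun k i => (ContinuousOn.mul continuousOn_const (hc.mul (by fun_prop))).circleIntegrable hρ.le
  have hid : ∀ ζ ∈ sphere (0:ℂ) ρ, (ζ - z)⁻¹ • ψ (x, ζ) =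
      pev W (x, z) * (ψ (x, ζ) / pev W (x, ζ) * (ζ - z)⁻¹) +
      ∑ k ∈ Finset.range (W.natDegree + 1), ∑ i ∈ Finset.range k, ((W.coeff k).1 x * z ^ i) *
        (ψ (x, ζ) / pev W (x, ζ) * ζ ^ (k - 1 - i)) := by
    intro ζ hζ
    have h1 := (hwn ζ hζ).1
    have h2 := hzs ζ hζ
    have h3 : ∑ k ∈ Finset.range (W.natDegree + 1), ∑ i ∈ Finset.range k, ((W.coeff k).1 x * z ^ i) *
        (ψ (x, ζ) / pev W (x, ζ) * ζ ^ (k - 1 - i)) = ψ (x, ζ) / pev W (x, ζ) *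
        ((pev W (x, ζ) - pev W (x, z)) / (ζ - z)) := by
      generalize ψ (x, ζ) / pev W (x, ζ) = A
      rw [pev_sum_range W (x, z), pev_sum_range W (x, ζ), ← Finset.sum_sub_distrib, Finset.sum_div, Finset.mul_sum]
      refine Finset.sum_congr rfl fun k _ => ?_
      have h4 := geom_sum₂_mul z ζ k
      have h5 : ((W.coeff k).1 x * ζ ^ k - (W.coeff k).1 x * z ^ k) / (ζ - z) =
          (W.coeff k).1 x * ∑ i ∈ Finset.range k, z ^ i * ζ ^ (k - 1 - i) := by
        rw [div_eq_iff h2, mul_assoc, ← mul_sub]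
        congr 1
        linear_combination h4
      rw [h5, Finset.mul_sum, Finset.mul_sum]
      refine Finset.sum_congr rfl fun i _ => ?_
      ring
    rw [h3, smul_eq_mul]
    field_simp
    ring
  rw [circleIntegral.integral_congr hρ.le hid, circleIntegral.integral_add,
    circleIntegral.integral_const_mul, circleIntegral.integral_fun_sum] at hcauchy
  · rw [hrev, hq]
    simp only
    rw [smul_eq_mul] at hcauchy
    have h6 : ψ (x, z) = (2 * Real.pi * Complex.I : ℂ)⁻¹ * ((2 * Real.pi * Complex.I : ℂ) * ψ (x, z)) := by
      field_simp
    rw [h6, ← hcauchy, mul_add]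
    congr 1
    · ring
    · rw [Finset.mul_sum]
      refine Finset.sum_congr rfl fun k _ => ?_
      rw [circleIntegral.integral_fun_sum, Finset.mul_sum]
      · refine Finset.sum_congr rfl fun i _ => ?_
        rw [circleIntegral.integral_const_mul]
        simp only [hJ]; ring
      · exact fun i _ => hcJ' k i
  · exact fun k _ => CircleIntegrable.fun_sum _ fun i _ => hcJ' k i
  · exact (ContinuousOn.mul continuousOn_const
      (hc.mul (ContinuousOn.inv₀ (by fun_prop) hzs))).circleIntegrable hρ.le
  · exact CircleIntegrable.fun_sum _ fun k _ => CircleIntegrable.fun_sum _ fun i _ => hcJ' k i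
end


section
open Polynomial
variable {R L : Type*} [CommRing R] [Field L]

theorem alg_iff (ι : R →+* L) (z : L) :
    IsAlgebraic ι.range z ↔ ∃ W : R[X], W.map ι ≠ 0 ∧ W.eval₂ ι z = 0 := by
  have hinj : Injective (algebraMap ι.range L) := Subtype.val_injective
  have key : ∀ W : R[X], (W.map ι.rangeRestrict).map (algebraMap ι.range L) = W.map ι := by
    intro W; rw [Polynomial.map_map]; rfl
  constructor
  · rintro ⟨W, hW, hz⟩
    obtain ⟨V, rfl⟩ := Polynomial.map_surjective ι.rangeRestrict ι.rangeRestrict_surjective W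
    refine ⟨V, ?_, ?_⟩
    · rw [← key]
      rwa [Ne, Polynomial.map_eq_zero_iff hinj]
    · rw [← eval_map, ← key, eval_map]; exact hz
  · rintro ⟨W, hW, hz⟩
    refine ⟨W.map ι.rangeRestrict, ?_, ?_⟩
    · rw [← key] at hW
      rintro h; rw [h] at hW; simp at hW
    · rw [aeval_def, ← eval_map, key, eval_map, hz]

theorem alg_min (ι : R →+* L) (z : L) (h : IsAlgebraic ι.range z) :
    ∃ p : R[X], p.eval₂ ι z = 0 ∧ ι p.leadingCoeff ≠ 0 ∧ 1 ≤ p.natDegree ∧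
      ∀ r : R[X], r.eval₂ ι z = 0 → r.natDegree < p.natDegree → r.map ι = 0 := by
  rw [alg_iff] at h
  have h' : ∃ n, ∃ W : R[X], W.natDegree = n ∧ W.map ι ≠ 0 ∧ W.eval₂ ι z = 0 := by
    obtain ⟨W, h1, h2⟩ := h; exact ⟨_, W, rfl, h1, h2⟩
  classical
  obtain ⟨p, hp1, hp2, hp3⟩ := Nat.find_spec h'
  have hmin : ∀ r : R[X], r.eval₂ ι z = 0 → r.natDegree < p.natDegree → r.map ι = 0 := by
    intro r hr hlt
    by_contra hne
    rw [hp1] at hlt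
    exact Nat.find_min h' hlt ⟨r, rfl, hne, hr⟩
  have hlc : ι p.leadingCoeff ≠ 0 := by
    intro h0
    obtain ⟨q, hq1, hq2⟩ := exists_degree_eq_of_mem_lifts (p := p.map ι) (f := ι)
      ((mem_lifts _).2 ⟨p, rfl⟩)
    have hd : q.natDegree = (p.map ι).natDegree := natDegree_eq_of_degree_eq hq2
    have hlt : (p.map ι).natDegree < p.natDegree := by
      refine lt_of_le_of_ne natDegree_map_le fun he => hp2 ?_
      rw [← leadingCoeff_eq_zero, leadingCoeff, he, coeff_map]; exact h0
    have := hmin q (by rw [← eval_map, hq1, eval_map, hp3]) (by omega)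
    rw [hq1] at this; exact hp2 this
  refine ⟨p, hp3, hlc, ?_, hmin⟩
  by_contra hlt
  have h0 : p.natDegree = 0 := by omega
  rw [eq_C_of_natDegree_eq_zero h0] at hp3
  rw [leadingCoeff, h0] at hlc
  simp at hp3; exact hlc hp3

theorem alg_pdiv (p : R[X]) (hp : 1 ≤ p.natDegree) (m : ℕ) : ∀ r : R[X], r.natDegree ≤ m →
    ∃ (N : ℕ) (q s : R[X]), C p.leadingCoeff ^ N * r = q * p + s ∧ s.natDegree < p.natDegree := by
  induction m with
  | zero => intro r hr; exact ⟨0, 0, r, by simp, by omega⟩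
  | succ m ih =>
    intro r hr
    by_cases hlt : r.natDegree < p.natDegree
    · exact ⟨0, 0, r, by simp, hlt⟩
    set r1 := C p.leadingCoeff * r - C (r.coeff (m+1)) * X ^ (m + 1 - p.natDegree) * p with hr1
    have hle : r1.natDegree ≤ m := by
      rw [natDegree_le_iff_coeff_eq_zero]
      intro k hk
      rw [hr1, coeff_sub, coeff_C_mul, mul_assoc, coeff_C_mul, coeff_X_pow_mul']
      rcases Nat.lt_or_ge (m+1) k with h | h
      · rw [coeff_eq_zero_of_natDegree_lt (lt_of_le_of_lt hr h), 
          coeff_eq_zero_of_natDegree_lt (p := p) (by omega)]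
        simp
      · have : k = m + 1 := by omega
        subst this
        rw [if_pos (by omega), show m + 1 - (m + 1 - p.natDegree) = p.natDegree by omega,
          coeff_natDegree]; ring
    obtain ⟨N, q, s, h1, h2⟩ := ih r1 hle
    refine ⟨N + 1, q + C p.leadingCoeff ^ N * (C (r.coeff (m+1)) * X ^ (m + 1 - p.natDegree)), s, ?_, h2⟩
    rw [hr1] at h1
    linear_combination h1

theorem alg_zero (ι : R →+* L) (z : L) (p : R[X]) (hp : p.eval₂ ι z = 0) (hp1 : 1 ≤ p.natDegree)
    (hmin : ∀ r : R[X], r.eval₂ ι z = 0 → r.natDegree < p.natDegree → r.map ι = 0)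
    (r : R[X]) (hr : r.eval₂ ι z = 0) :
    ∃ (N : ℕ) (q s : R[X]), C p.leadingCoeff ^ N * r = q * p + s ∧ s.map ι = 0 := by
  obtain ⟨N, q, s, h1, h2⟩ := alg_pdiv p hp1 r.natDegree r le_rfl
  refine ⟨N, q, s, h1, hmin s ?_ h2⟩
  have := congrArg (eval₂ ι z) h1
  simpa [eval₂_mul, hr, hp] using this.symm

theorem alg_eval (ι : R →+* L) (z : L) (h : IsAlgebraic ι.range z) (r : R[X]) :
    IsAlgebraic ι.range (r.eval₂ ι z) := by
  have h1 : r.eval₂ ι z = aeval z (r.map ι.rangeRestrict) := by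
    rw [aeval_def, eval₂_map]; rfl
  rw [h1]
  have h2 := Subalgebra.aeval_coe (Subalgebra.algebraicClosure ι.range L) ⟨z, h⟩
    (r.map ι.rangeRestrict)
  simp only at h2
  rw [h2]
  exact (aeval (⟨z, h⟩ : Subalgebra.algebraicClosure ι.range L) (r.map ι.rangeRestrict)).2

theorem alg_nonzero (ι : R →+* L) (z : L) (h : IsAlgebraic ι.range z)
    (p : R[X]) (hp : p.eval₂ ι z = 0) (hp1 : 1 ≤ p.natDegree)
    (hmin : ∀ r : R[X], r.eval₂ ι z = 0 → r.natDegree < p.natDegree → r.map ι = 0)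
    (r : R[X]) (hr : r.eval₂ ι z ≠ 0) :
    ∃ (N : ℕ) (b : R) (y q s : R[X]), ι b ≠ 0 ∧
      C p.leadingCoeff ^ N * C b = y * r + q * p + s ∧ s.map ι = 0 := by
  obtain ⟨Q₀, hQ0, hQz⟩ := (alg_eval ι z h r).exists_nonzero_coeff_and_aeval_eq_zero
    (mem_nonZeroDivisors_of_ne_zero hr)
  obtain ⟨Q, rfl⟩ := Polynomial.map_surjective ι.rangeRestrict ι.rangeRestrict_surjective Q₀
  have hb : ι (Q.coeff 0) ≠ 0 := by
    intro h0; apply hQ0; rw [coeff_map]; exact Subtype.ext h0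
  have hQ : (Q.comp r).eval₂ ι z = 0 := by
    rw [eval₂_comp, ← hQz, aeval_def, eval₂_map]; rfl
  obtain ⟨N, q, s, h1, h2⟩ := alg_zero ι z p hp hp1 hmin _ hQ
  refine ⟨N, Q.coeff 0, -(C p.leadingCoeff ^ N * Q.divX.comp r), q, s, hb, ?_, h2⟩
  have h3 : Q.comp r = Q.divX.comp r * r + C (Q.coeff 0) := by
    conv_lhs => rw [← Q.divX_mul_X_add]
    simp
  rw [h3] at h1
  linear_combination h1

theorem alg_deriv [CharZero L] (ι : R →+* L) (z : L) (p : R[X]) (hp1 : 1 ≤ p.natDegree)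
    (hlc : ι p.leadingCoeff ≠ 0)
    (hmin : ∀ r : R[X], r.eval₂ ι z = 0 → r.natDegree < p.natDegree → r.map ι = 0) :
    (derivative p).eval₂ ι z ≠ 0 := by
  intro h
  have := hmin _ h (natDegree_derivative_lt (by omega))
  have h1 := congrArg (fun P => coeff P (p.natDegree - 1)) this
  simp only [coeff_map, coeff_derivative, coeff_zero] at h1
  rw [show p.natDegree - 1 + 1 = p.natDegree by omega, map_mul] at h1
  rcases mul_eq_zero.1 h1 with h2 | h2
  · exact hlc h2
  · have : ι ((p.natDegree - 1 : ℕ) + 1) = ((p.natDegree - 1 + 1 : ℕ) : L) := by simp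
    rw [this] at h2
    exact absurd h2 (Nat.cast_ne_zero.2 (by omega))

theorem alg_tower {R' : Type*} [CommRing R'] (ι : R →+* L) (ι' : R' →+* L) 
    (h : ∀ a, IsAlgebraic ι.range (ι' a)) (z : L) (hz : IsAlgebraic ι'.range z) :
    IsAlgebraic ι.range z := by
  have h1 : IsAlgebraic (Subalgebra.algebraicClosure ι.range L) z := by
    obtain ⟨W, hW, hWz⟩ := (alg_iff ι' z).1 hz
    have hl : W.map ι' ∈ lifts (algebraMap (Subalgebra.algebraicClosure ι.range L) L) := by
      rw [lifts_iff_coeff_lifts]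
      intro n
      exact ⟨⟨ι' (W.coeff n), h _⟩, by rw [coeff_map]; rfl⟩
    obtain ⟨V, hV⟩ := (mem_lifts _).1 hl
    refine ⟨V, ?_, ?_⟩
    · rintro rfl; simp at hV; exact hW hV.symm
    · rw [aeval_def, ← eval_map, hV, eval_map, hWz]
  exact h1.restrictScalars _
end


section
open Polynomial
universe v
variable {E : Type*} [NormedAddCommGroup E] [NormedSpace ℂ E] {Ω : Type v}

/-- Pull back along `χ` to germs along the ultrafilter. -/
noncomputable def iota (𝓕 : Ultrafilter Ω) (χ : Ω → E) : HolRing E →+* Germ (𝓕 : Filter Ω) ℂ :=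
  (Germ.coeRingHom (𝓕 : Filter Ω)).comp (RingHom.pi fun x => evx (χ x))

theorem iota_apply (𝓕 : Ultrafilter Ω) (χ : Ω → E) (φ : HolRing E) :
    iota 𝓕 χ φ = ((fun x => φ.1 (χ x) : Ω → ℂ) : Germ (𝓕 : Filter Ω) ℂ) := rfl

theorem germ_eq_zero (𝓕 : Ultrafilter Ω) (k : Ω → ℂ) :
    (k : Germ (𝓕 : Filter Ω) ℂ) = 0 ↔ ∀ᶠ x in (𝓕 : Filter Ω), k x = 0 := by
  rw [← Germ.coe_zero, Germ.coe_eq]; rfl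

theorem iota_eq_zero (𝓕 : Ultrafilter Ω) (χ : Ω → E) (φ : HolRing E) :
    iota 𝓕 χ φ = 0 ↔ ∀ᶠ x in (𝓕 : Filter Ω), φ.1 (χ x) = 0 := by
  rw [iota_apply, germ_eq_zero]

theorem iota_ne_zero (𝓕 : Ultrafilter Ω) (χ : Ω → E) (φ : HolRing E) :
    iota 𝓕 χ φ ≠ 0 ↔ ∀ᶠ x in (𝓕 : Filter Ω), φ.1 (χ x) ≠ 0 := by
  rw [Ne, iota_eq_zero, ← Ultrafilter.eventually_not]

theorem eval₂_iota (𝓕 : Ultrafilter Ω) (χ : Ω → E) (z : Ω → ℂ) (r : (HolRing E)[X]) :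
    r.eval₂ (iota 𝓕 χ) (z : Germ (𝓕 : Filter Ω) ℂ) =
      ((fun x => pev r (χ x, z x) : Ω → ℂ) : Germ (𝓕 : Filter Ω) ℂ) := by
  have h1 : r.eval₂ (iota 𝓕 χ) (z : Germ (𝓕 : Filter Ω) ℂ) =
      Germ.coeRingHom (𝓕 : Filter Ω) (r.eval₂ (RingHom.pi fun x => evx (χ x)) z) := by
    rw [hom_eval₂]; rfl
  rw [h1]
  change ((r.eval₂ (RingHom.pi fun x => evx (χ x)) z : Ω → ℂ) : Germ (𝓕 : Filter Ω) ℂ) = _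
  congr 1
  funext x
  have := hom_eval₂ r (RingHom.pi fun x => evx (χ x)) (Pi.evalRingHom (fun _ : Ω => ℂ) x) z
  exact this

theorem eval₂_iota_zero (𝓕 : Ultrafilter Ω) (χ : Ω → E) (z : Ω → ℂ) (r : (HolRing E)[X]) :
    r.eval₂ (iota 𝓕 χ) (z : Germ (𝓕 : Filter Ω) ℂ) = 0 ↔
      ∀ᶠ x in (𝓕 : Filter Ω), pev r (χ x, z x) = 0 := by
  rw [eval₂_iota, germ_eq_zero]

instance germ_charZero (𝓕 : Ultrafilter Ω) : CharZero (Germ (𝓕 : Filter Ω) ℂ) := by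
  refine charZero_of_inj_zero fun n hn => ?_
  have h1 : ((n : Germ (𝓕 : Filter Ω) ℂ)) = ((fun _ => (n : ℂ) : Ω → ℂ) : Germ (𝓕 : Filter Ω) ℂ) := rfl
  rw [h1, germ_eq_zero] at hn
  obtain ⟨x, hx⟩ := hn.exists
  exact_mod_cast hx

theorem map_iota_zero (𝓕 : Ultrafilter Ω) (χ : Ω → E) (r : (HolRing E)[X]) :
    r.map (iota 𝓕 χ) = 0 ↔ ∀ j, iota 𝓕 χ (r.coeff j) = 0 := by
  rw [Polynomial.ext_iff]; simp

theorem hol_core (𝓕 : Ultrafilter Ω) (χ : Ω → E) (z : Ω → ℂ) (hχ : Tendsto χ 𝓕 (𝓝 0))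
    (hz : Tendsto z 𝓕 (𝓝 0)) (φ : E × ℂ → ℂ) (hφ : ContDiffAt ℂ 1 φ 0)
    (hφ0 : ∀ᶠ x in (𝓕 : Filter Ω), φ (χ x, z x) = 0) (hn : ¬ ∀ᶠ t in 𝓝 (0:ℂ), φ (0, t) = 0) :
    ∃ W p : (HolRing E)[X], W.Monic ∧ W.map (evx 0) = X ^ W.natDegree ∧
      W.eval₂ (iota 𝓕 χ) (z : Germ (𝓕 : Filter Ω) ℂ) = 0 ∧
      IsAlgebraic (iota 𝓕 χ).range (z : Germ (𝓕 : Filter Ω) ℂ) ∧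
      p.eval₂ (iota 𝓕 χ) (z : Germ (𝓕 : Filter Ω) ℂ) = 0 ∧ iota 𝓕 χ p.leadingCoeff ≠ 0 ∧
      1 ≤ p.natDegree ∧
      ∀ r : (HolRing E)[X], r.eval₂ (iota 𝓕 χ) (z : Germ (𝓕 : Filter Ω) ℂ) = 0 →
        r.natDegree < p.natDegree → r.map (iota 𝓕 χ) = 0 := by
  obtain ⟨W, hW1, -, hW2, hW3⟩ := weier_poly φ hφ hn
  have ht : Tendsto (fun x => (χ x, z x)) 𝓕 (𝓝 (0 : E × ℂ)) := hχ.prodMk_nhds hz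
  have h0 : W.eval₂ (iota 𝓕 χ) (z : Germ (𝓕 : Filter Ω) ℂ) = 0 := by
    rw [eval₂_iota_zero]
    filter_upwards [ht.eventually hW3, hφ0] with x h1 h2 using h1 h2
  have halg : IsAlgebraic (iota 𝓕 χ).range (z : Germ (𝓕 : Filter Ω) ℂ) :=
    (alg_iff _ _).2 ⟨W, (hW1.map _).ne_zero, h0⟩
  obtain ⟨p, h1, h2, h3, h4⟩ := alg_min _ _ halg
  exact ⟨W, p, hW1, hW2, h0, halg, h1, h2, h3, h4⟩

theorem root_small (W : (HolRing E)[X]) (hm : W.Monic) (h0 : W.map (evx 0) = X ^ W.natDegree)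
    {η : ℝ} (hη : 0 < η) : ∀ᶠ x in 𝓝 (0:E), ∀ z : ℂ, pev W (x, z) = 0 → ‖z‖ < η := by
  wlog hη1 : η ≤ 1 generalizing η
  · filter_upwards [this one_pos le_rfl] with x hx z hz
    linarith [hx z hz]
  set d := W.natDegree with hd
  have hc : ∀ j ∈ Finset.range d, ∀ᶠ x in 𝓝 (0:E), ‖(W.coeff j).1 x‖ < η ^ d / (d + 1) := by
    intro j hj
    have h1 : (W.coeff j).1 0 = 0 := by
      have := congrArg (fun P => coeff P j) h0
      simp only [coeff_map, coeff_X_pow, (Finset.mem_range.1 hj).ne, if_false] at this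
      exact this
    have h2 : ContinuousAt (fun x => ‖(W.coeff j).1 x‖) 0 :=
      (show ContDiffAt ℂ 1 (W.coeff j).1 0 from (W.coeff j).2).continuousAt.norm
    exact h2.eventually (gt_mem_nhds (by simp only [h1, norm_zero]; positivity))
  filter_upwards [(Filter.eventually_all_finset (Finset.range d)).2 hc] with x hx z hz
  by_contra! hzη
  have hz0 : 0 < ‖z‖ := lt_of_lt_of_le hη hzη
  rw [pev_sum_range, ← hd, Finset.sum_range_succ, hd, hm.coeff_natDegree, ← hd] at hz
  have hz' : z ^ d = - ∑ k ∈ Finset.range d, (W.coeff k).1 x * z ^ k := by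
    have : ((1 : HolRing E).1 x) = 1 := rfl
    simp only [this] at hz
    linear_combination hz
  have h1 : ‖z‖ ^ d ≤ ∑ k ∈ Finset.range d, ‖z‖ ^ d / (d + 1) := by
    have h0 : ‖z‖ ^ d = ‖∑ k ∈ Finset.range d, (W.coeff k).1 x * z ^ k‖ := by
      rw [← norm_pow, hz', norm_neg]
    refine (h0.le.trans (norm_sum_le _ _)).trans ?_
    refine Finset.sum_le_sum fun k hk => ?_
    rw [norm_mul, norm_pow]
    have hk' := Finset.mem_range.1 hk
    have h3 : η ^ d * ‖z‖ ^ k ≤ ‖z‖ ^ d := by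
      calc η ^ d * ‖z‖ ^ k ≤ η ^ (d - k) * ‖z‖ ^ k := by
            gcongr ?_ * _
            exact pow_le_pow_of_le_one hη.le hη1 (by omega)
        _ ≤ ‖z‖ ^ (d - k) * ‖z‖ ^ k := by gcongr
        _ = ‖z‖ ^ d := by rw [← pow_add]; congr 1; omega
    calc ‖(W.coeff k).1 x‖ * ‖z‖ ^ k ≤ (η ^ d / (d + 1)) * ‖z‖ ^ k := by
          gcongr; exact (hx k hk).le
      _ = (η ^ d * ‖z‖ ^ k) / (d + 1) := by ring
      _ ≤ ‖z‖ ^ d / (d + 1) := by gcongr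
  rw [Finset.sum_const, Finset.card_range, nsmul_eq_mul] at h1
  have hp : 0 < ‖z‖ ^ d := by positivity
  have h2 : (d : ℝ) * (‖z‖ ^ d / (d + 1)) < ‖z‖ ^ d := by
    rw [mul_div_assoc', div_lt_iff₀ (by positivity)]
    nlinarith
  linarith

theorem hol_split (u : E →L[ℂ] ℂ) (w : E) (hw : w ≠ 0) (huw : u w = 0) [FiniteDimensional ℂ E] :
    ∃ (E' : Submodule ℂ E) (A : E' × ℂ →L[ℂ] E) (π : E →L[ℂ] E') (ℓ : E →L[ℂ] ℂ),
      Module.finrank ℂ E' < Module.finrank ℂ E ∧ (∀ x, A (π x, ℓ x) = x) ∧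
      (∀ p, π (A p) = p.1) ∧ (∀ p, ℓ (A p) = p.2) ∧ (∀ p, u (A p) = u p.1) ∧
      ∀ t, A (0, t) = t • w := by
  obtain ⟨ℓ, hℓ⟩ := SeparatingDual.exists_eq_one (R := ℂ) hw
  set E' : Submodule ℂ E := LinearMap.ker ℓ.toLinearMap with hE'
  have hmem : ∀ x, ((ContinuousLinearMap.id ℂ E) - ℓ.smulRight w) x ∈ E' := by
    intro x
    rw [hE', LinearMap.mem_ker]
    simp [hℓ]
  refine ⟨E', (E'.subtypeL.comp (ContinuousLinearMap.fst ℂ E' ℂ)) +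
    (ContinuousLinearMap.snd ℂ E' ℂ).smulRight w,
    ((ContinuousLinearMap.id ℂ E) - ℓ.smulRight w).codRestrict E' hmem, ℓ, ?_, ?_, ?_, ?_, ?_, ?_⟩
  · apply Submodule.finrank_lt
    intro h
    have : w ∈ E' := by rw [h]; trivial
    rw [hE', LinearMap.mem_ker] at this
    have h2 : ℓ w = 0 := this
    rw [hℓ] at h2; exact one_ne_zero h2
  · intro x; simp
  · rintro ⟨⟨x, hx⟩, t⟩
    have hx' : ℓ x = 0 := hx
    apply Subtype.ext
    simp [hℓ, hx']
  · rintro ⟨⟨x, hx⟩, t⟩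
    have hx' : ℓ x = 0 := hx
    simp [hℓ, hx']
  · rintro ⟨⟨x, hx⟩, t⟩
    simp [huw]
  · intro t; simp
end


section
open Polynomial
universe u v
variable {E : Type u} [NormedAddCommGroup E] [NormedSpace ℂ E] {Ω : Type v}

theorem pev_C_pow (a : HolRing E) (N : ℕ) (p : E × ℂ) : pev (C a ^ N) p = a.1 p.1 ^ N := by
  simp [pev, eval₂_pow]

theorem pev_C (a : HolRing E) (p : E × ℂ) : pev (C a) p = a.1 p.1 := by
  simp [pev]

theorem pev_zero_of (s : (HolRing E)[X]) (x : E) (z : ℂ) (h : ∀ j, (s.coeff j).1 x = 0) :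
    pev s (x, z) = 0 := by
  rw [pev_sum_range]
  exact Finset.sum_eq_zero fun k _ => by simp [h]

theorem hol_step [FiniteDimensional ℂ E] (𝓕 : Ultrafilter Ω) (u : E →L[ℂ] ℂ) (χ : Ω → E)
    (hχ : Tendsto χ 𝓕 (𝓝 0)) (hu : ∀ᶠ x in (𝓕 : Filter Ω), u (χ x) ≠ 0)
    (φ : HolRing E) (hφ : iota 𝓕 χ φ = 0) (hn : ¬ ∀ᶠ z in 𝓝 0, φ.1 z = 0) :
    ∃ (E' : Submodule ℂ E) (A : E' × ℂ →L[ℂ] E) (π : E →L[ℂ] E') (ℓ : E →L[ℂ] ℂ)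
      (W p : (HolRing E')[X]),
      (Module.finrank ℂ E' < Module.finrank ℂ E ∧ (∀ x, A (π x, ℓ x) = x) ∧
      (∀ p, π (A p) = p.1) ∧ (∀ p, ℓ (A p) = p.2) ∧ (∀ p, u (A p) = u p.1)) ∧
      (W.Monic ∧ W.map (evx 0) = X ^ W.natDegree) ∧
      W.eval₂ (iota 𝓕 (π ∘ χ)) ((ℓ ∘ χ : Ω → ℂ) : Germ (𝓕 : Filter Ω) ℂ) = 0 ∧
      IsAlgebraic (iota 𝓕 (π ∘ χ)).range ((ℓ ∘ χ : Ω → ℂ) : Germ (𝓕 : Filter Ω) ℂ) ∧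
      p.eval₂ (iota 𝓕 (π ∘ χ)) ((ℓ ∘ χ : Ω → ℂ) : Germ (𝓕 : Filter Ω) ℂ) = 0 ∧
      iota 𝓕 (π ∘ χ) p.leadingCoeff ≠ 0 ∧ 1 ≤ p.natDegree ∧
      ∀ r : (HolRing E')[X],
        r.eval₂ (iota 𝓕 (π ∘ χ)) ((ℓ ∘ χ : Ω → ℂ) : Germ (𝓕 : Filter Ω) ℂ) = 0 →
        r.natDegree < p.natDegree → r.map (iota 𝓕 (π ∘ χ)) = 0 := by
  rw [iota_eq_zero] at hφ
  have hu0 : u ≠ 0 := by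
    obtain ⟨x, hx⟩ := hu.exists
    rintro rfl; simp at hx
  obtain ⟨φ', h1, h2, w, huw, h3⟩ := hol_reg (𝓕 : Filter Ω) u χ hχ hu0 hu φ.1 φ.2 hφ hn
  have hφ'0 : φ' 0 = 0 := by
    have ht : Tendsto (fun x => φ' (χ x)) 𝓕 (𝓝 (φ' 0)) := h1.continuousAt.tendsto.comp hχ
    have ht2 : Tendsto (fun x => φ' (χ x)) 𝓕 (𝓝 0) :=
      (tendsto_congr' h2).2 tendsto_const_nhds
    exact tendsto_nhds_unique ht ht2
  have hw : w ≠ 0 := by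
    rintro rfl
    apply h3; simp [hφ'0]
  obtain ⟨E', A, π, ℓ, hd, hA1, hA2, hA3, hA4, hA5⟩ := hol_split u w hw huw
  have hπ : Tendsto (π ∘ χ) 𝓕 (𝓝 0) := by
    have := (π.continuous.tendsto 0).comp hχ
    simpa using this
  have hℓ : Tendsto (ℓ ∘ χ) 𝓕 (𝓝 0) := by
    have := (ℓ.continuous.tendsto 0).comp hχ
    simpa using this
  obtain ⟨W, p, hh⟩ := hol_core 𝓕 (π ∘ χ) (ℓ ∘ χ) hπ hℓ (fun q => φ' (A q))
    (by
      have : ContDiffAt ℂ 1 φ' (A 0) := by simpa using h1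
      exact this.comp 0 A.contDiff.contDiffAt)
    (by
      filter_upwards [h2] with x hx
      simpa [hA1] using hx)
    (by simpa [hA5] using h3)
  exact ⟨E', A, π, ℓ, W, p, ⟨hd, hA1, hA2, hA3, hA4⟩, ⟨hh.1, hh.2.1⟩, hh.2.2.1, hh.2.2.2⟩

theorem hol_base (𝓕 : Ultrafilter Ω) (u : E →L[ℂ] ℂ) (χ : Ω → E)
    (hχ : Tendsto χ 𝓕 (𝓝 0)) (hu : ∀ᶠ x in (𝓕 : Filter Ω), u (χ x) ≠ 0) (ψ : HolRing E)
    (hψ : iota 𝓕 χ ψ ≠ 0) :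
    ∃ v : E, u v = 1 ∧ ∀ᶠ c in 𝓝[≠] (0:ℂ), ψ.1 (c • v) ≠ 0 := by
  have hψ' : ContDiffAt ℂ 1 ψ.1 0 := ψ.2
  have hmul : ContDiffAt ℂ 1 (fun x => ψ.1 x * u x) 0 := hψ'.mul u.contDiff.contDiffAt
  obtain ⟨v, hv⟩ := hol_dir hmul (by
    intro h
    rw [iota_ne_zero] at hψ
    obtain ⟨x, h1, h2, h3⟩ := ((hχ.eventually h).and (hψ.and hu)).exists
    exact (mul_ne_zero h2 h3) h1)
  have huv : u v ≠ 0 := by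
    intro h; apply hv; simp [h]
  have hk := hol_analyticAt (hol_line hψ' ((u v)⁻¹ • v))
  refine ⟨(u v)⁻¹ • v, by simp [huv], hk.eventually_eq_zero_or_eventually_ne_zero.resolve_left ?_⟩
  intro h
  apply hv
  have ht : Tendsto (fun t : ℂ => t * u v) (𝓝 0) (𝓝 0) := by
    have : ContinuousAt (fun t : ℂ => t * u v) 0 := by fun_prop
    simpa [ContinuousAt] using this
  filter_upwards [ht.eventually h] with t ht
  rw [smul_smul, mul_assoc, mul_inv_cancel₀ huv, mul_one] at ht
  rw [ht, zero_mul]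

theorem thmN (𝓕 : Ultrafilter Ω) (n : ℕ) : ∀ (E : Type u) [NormedAddCommGroup E] [NormedSpace ℂ E]
    [FiniteDimensional ℂ E], Module.finrank ℂ E < n → ∀ (u : E →L[ℂ] ℂ) (χ : Ω → E),
    Tendsto χ 𝓕 (𝓝 0) → (∀ᶠ x in (𝓕 : Filter Ω), u (χ x) ≠ 0) → ∀ Φ : Set (HolRing E), Φ.Finite →
    (∀ φ ∈ Φ, iota 𝓕 χ φ = 0) → ∀ ψ : HolRing E, iota 𝓕 χ ψ ≠ 0 → ∀ ε > 0,
    ∀ᶠ c in 𝓝[≠] (0:ℂ), ∃ x : E, ‖x‖ < ε ∧ u x = c ∧ (∀ φ ∈ Φ, φ.1 x = 0) ∧ ψ.1 x ≠ 0 := by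
  induction n with
  | zero => intro E _ _ _ h; omega
  | succ n ih =>
  intro E _ _ _ hfr u χ hχ hu Φ hΦf hΦ ψ hψ ε hε
  by_cases hall : ∀ φ ∈ Φ, ∀ᶠ z in 𝓝 0, φ.1 z = 0
  · obtain ⟨v, huv, hv⟩ := hol_base 𝓕 u χ hχ hu ψ hψ
    have h1 : ∀ᶠ z in 𝓝 (0:E), ∀ φ ∈ Φ, φ.1 z = 0 := (Filter.eventually_all_finite hΦf).2 hall
    have h2 : ∀ᶠ z in 𝓝 (0:E), ‖z‖ < ε := by
      filter_upwards [ball_mem_nhds (0:E) hε] with x hx using by simpa using hx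
    have ht : Tendsto (fun t : ℂ => t • v) (𝓝[≠] 0) (𝓝 (0:E)) := by
      have : ContinuousAt (fun t : ℂ => t • v) 0 := by fun_prop
      simpa [ContinuousAt] using this.tendsto.mono_left nhdsWithin_le_nhds
    filter_upwards [ht.eventually h1, ht.eventually h2, hv] with c hc1 hc2 hc3
    exact ⟨c • v, hc2, by simp [huv], hc1, hc3⟩
  simp only [not_forall] at hall
  obtain ⟨φ₀, hφ₀, hn⟩ := hall
  obtain ⟨E', A, π, ℓ, W, p, ⟨hd, hA1, hA2, hA3, hA4⟩, ⟨hWm, hW0⟩, hWz, halg, hpz, hplc, hp1, hpmin⟩ :=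
    hol_step 𝓕 u χ hχ hu φ₀ (hΦ _ hφ₀) hn
  have hπ : Tendsto (π ∘ χ) 𝓕 (𝓝 0) := by
    have := (π.continuous.tendsto 0).comp hχ
    simpa using this
  have hℓ : Tendsto (ℓ ∘ χ) 𝓕 (𝓝 0) := by
    have := (ℓ.continuous.tendsto 0).comp hχ
    simpa using this
  have hpair : Tendsto (fun x => ((π ∘ χ) x, (ℓ ∘ χ) x)) 𝓕 (𝓝 (0 : E' × ℂ)) := hπ.prodMk_nhds hℓ
  -- division of a function
  have hdiv : ∀ φ : HolRing E, ∃ (q : E' × ℂ → ℂ) (r : (HolRing E')[X]), 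
      (∀ᶠ y in 𝓝 (0 : E' × ℂ), φ.1 (A y) = q y * pev W y + pev r y) ∧ 
      (r.eval₂ (iota 𝓕 (π ∘ χ)) ((ℓ ∘ χ : Ω → ℂ) : Germ (𝓕 : Filter Ω) ℂ) = iota 𝓕 χ φ) := by
    intro φ
    have hφ : ContDiffAt ℂ 1 φ.1 (A 0) := by rw [map_zero]; exact φ.2
    obtain ⟨q, r, -, h⟩ := weier_div W hWm hW0 (fun y => φ.1 (A y))
      (hφ.comp 0 A.contDiff.contDiffAt)
    refine ⟨q, r, h, ?_⟩
    rw [eval₂_iota, iota_apply, Germ.coe_eq]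
    filter_upwards [hpair.eventually h, (eval₂_iota_zero _ _ _ _).1 hWz] with x h1 h2
    rw [h2, mul_zero, zero_add] at h1
    rw [← h1]
    simp [hA1]
  obtain ⟨NW, qW, sW, hW1, hW2⟩ := alg_zero _ _ p hpz hp1 hpmin W hWz
  choose q r hq hr using hdiv
  have hz : ∀ φ : HolRing E, ∃ (N : ℕ) (q' s : (HolRing E')[X]), φ ∈ Φ →
      C p.leadingCoeff ^ N * r φ = q' * p + s ∧ s.map (iota 𝓕 (π ∘ χ)) = 0 := by
    intro φ
    by_cases hφ : φ ∈ Φ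
    · obtain ⟨N, q', s, h⟩ := alg_zero _ _ p hpz hp1 hpmin (r φ) ((hr φ).trans (hΦ φ hφ))
      exact ⟨N, q', s, fun _ => h⟩
    · exact ⟨0, 0, 0, fun h => absurd h hφ⟩
  choose N q' s hs using hz
  obtain ⟨Nψ, b, y, qψ, sψ, hb, hψ1, hψ2⟩ := alg_nonzero _ _ halg p hpz hp1 hpmin (r ψ)
    (by rw [hr]; exact hψ)
  set Φ' : Set (HolRing E') := (↑sW.coeffs ∪ ↑sψ.coeffs) ∪ ⋃ φ ∈ Φ, ↑(s φ).coeffs with hΦ'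
  have hcoef : ∀ t : (HolRing E')[X], t.map (iota 𝓕 (π ∘ χ)) = 0 → ∀ c ∈ t.coeffs,
      iota 𝓕 (π ∘ χ) c = 0 := by
    intro t ht c hc
    obtain ⟨j, -, rfl⟩ := mem_coeffs_iff.1 hc
    exact (map_iota_zero _ _ _).1 ht j
  have hΦ'f : Φ'.Finite := by
    refine ((Finset.finite_toSet _).union (Finset.finite_toSet _)).union ?_
    exact hΦf.biUnion fun φ _ => Finset.finite_toSet _
  have hΦ'0 : ∀ φ ∈ Φ', iota 𝓕 (π ∘ χ) φ = 0 := by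
    rintro c ((hc | hc) | hc)
    · exact hcoef _ hW2 c hc
    · exact hcoef _ hψ2 c hc
    · simp only [Set.mem_iUnion] at hc
      obtain ⟨φ, hφ, hc⟩ := hc
      exact hcoef _ (hs φ hφ).2 c hc
  have hpv : ∀ t : (HolRing E')[X], (↑t.coeffs : Set (HolRing E')) ⊆ Φ' → ∀ x : E', (∀ φ ∈ Φ', φ.1 x = 0) →
      ∀ z, pev t (x, z) = 0 := by
    intro t ht x hx z
    refine pev_zero_of t x z fun j => ?_
    by_cases h0 : t.coeff j = 0
    · rw [h0]; rfl
    · exact hx _ (ht (coeff_mem_coeffs h0))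
  -- neighbourhood
  have hnb : ∀ᶠ y in 𝓝 (0 : E' × ℂ), ‖A y‖ < ε ∧ (∀ φ ∈ Φ, φ.1 (A y) = q φ y * pev W y + pev (r φ) y) ∧
      ψ.1 (A y) = q ψ y * pev W y + pev (r ψ) y := by
    refine Filter.Eventually.and ?_ (((Filter.eventually_all_finite hΦf).2 fun φ _ => hq φ).and (hq ψ))
    have : ContinuousAt (fun y => ‖A y‖) 0 := by fun_prop
    exact this.eventually (gt_mem_nhds (by simpa using hε))
  obtain ⟨η, hη, hnb⟩ := Metric.eventually_nhds_iff_ball.1 hnb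
  obtain ⟨ε', hε', hroot⟩ := Metric.eventually_nhds_iff_ball.1 (root_small W hWm hW0 hη)
  have hu' : ∀ᶠ x in (𝓕 : Filter Ω), (u.comp E'.subtypeL) ((π ∘ χ) x) ≠ 0 := by
    filter_upwards [hu] with x hx
    have := hA4 (π (χ x), ℓ (χ x))
    rw [hA1] at this
    simpa [← this] using hx
  have := ih E' (by omega) (u.comp E'.subtypeL) (π ∘ χ) hπ hu' Φ' hΦ'f hΦ'0
    (p.leadingCoeff * b) (by rw [map_mul]; exact mul_ne_zero hplc hb) (min η ε') (lt_min hη hε')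
  filter_upwards [this] with c hc
  obtain ⟨x, hx1, hx2, hx3, hx4⟩ := hc
  have hax : p.leadingCoeff.1 x ≠ 0 := fun h => hx4 (by
    change p.leadingCoeff.1 x * b.1 x = 0
    rw [h, zero_mul])
  have hbx : b.1 x ≠ 0 := fun h => hx4 (by
    change p.leadingCoeff.1 x * b.1 x = 0
    rw [h, mul_zero])
  obtain ⟨hx1, hx1'⟩ := lt_min_iff.1 hx1
  -- root
  have hdeg : (p.map (evx x)).natDegree = p.natDegree := natDegree_map_of_leadingCoeff_ne_zero _ hax
  obtain ⟨z, hz⟩ := IsAlgClosed.exists_root (p.map (evx x)) (by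
    intro h
    have := natDegree_eq_zero_iff_degree_le_zero.2 h.le
    omega)
  have hpz' : pev p (x, z) = 0 := by
    rw [IsRoot, eval_map] at hz; exact hz
  have hWz' : pev W (x, z) = 0 := by
    have h1 := congrArg (fun P => pev P (x, z)) hW1
    simp only [pev_add, pev_mul, pev_C_pow, hpz', mul_zero, zero_add] at h1
    rw [hpv sW (fun c hc => Or.inl (Or.inl hc)) x hx3] at h1
    exact (mul_eq_zero.1 h1).resolve_left (pow_ne_zero _ hax)
  have hzη := hroot x (by simpa using hx1') z hWz'
  have hball : (x, z) ∈ ball (0 : E' × ℂ) η := by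
    rw [mem_ball_zero_iff, Prod.norm_def]; exact max_lt hx1 hzη
  obtain ⟨hn1, hn2, hn3⟩ := hnb _ hball
  refine ⟨A (x, z), hn1, ?_, ?_, ?_⟩
  · rw [hA4]; exact hx2
  · intro φ hφ
    rw [hn2 φ hφ, hWz', mul_zero, zero_add]
    have h1 := congrArg (fun P => pev P (x, z)) (hs φ hφ).1
    simp only [pev_add, pev_mul, pev_C_pow, hpz', mul_zero, zero_add] at h1
    rw [hpv (s φ) (fun c hc => Or.inr (Set.mem_biUnion hφ hc)) x hx3] at h1
    exact (mul_eq_zero.1 h1).resolve_left (pow_ne_zero _ hax)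
  · rw [hn3, hWz', mul_zero, zero_add]
    intro h0
    have h1 := congrArg (fun P => pev P (x, z)) hψ1
    simp only [pev_add, pev_mul, pev_C_pow, pev_C, hpz', mul_zero, zero_add, add_zero, h0] at h1
    rw [hpv sψ (fun c hc => Or.inl (Or.inr hc)) x hx3] at h1
    exact (mul_ne_zero (pow_ne_zero _ hax) hbx) h1
end


section
open Polynomial
universe u v
variable {E : Type u} [NormedAddCommGroup E] [NormedSpace ℂ E] {Ω : Type v}

theorem hol_ev_diff {φ : E → ℂ} (h : ContDiffAt ℂ 1 φ 0) : ∀ᶠ x in 𝓝 0, DifferentiableAt ℂ φ x := by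
  filter_upwards [h.eventually (by simp)] with s hs using hs.differentiableAt (by simp)

theorem pev_ev_diff (W : (HolRing E)[X]) : ∀ᶠ x in 𝓝 (0:E), ∀ z, DifferentiableAt ℂ (pev W) (x, z) := by
  have h1 : ∀ᶠ x in 𝓝 (0:E), ∀ k ∈ Finset.range (W.natDegree + 1), DifferentiableAt ℂ (W.coeff k).1 x :=
    (Filter.eventually_all_finset _).2 fun k _ => hol_ev_diff (W.coeff k).2
  filter_upwards [h1] with x hx z
  have : pev W = fun p => ∑ k ∈ Finset.range (W.natDegree + 1), (W.coeff k).1 p.1 * p.2 ^ k := by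
    funext p; exact pev_sum_range W p
  rw [this]
  refine DifferentiableAt.fun_sum fun k hk => ?_
  refine DifferentiableAt.mul ?_ (by fun_prop)
  exact DifferentiableAt.comp (x, z) (g := (W.coeff k).1) (f := Prod.fst) (hx k hk) differentiableAt_fst

theorem pev_fderiv_snd (W : (HolRing E)[X]) (x : E) (z ζ : ℂ) (h : DifferentiableAt ℂ (pev W) (x, z)) :
    fderiv ℂ (pev W) (x, z) (0, ζ) = pev (derivative W) (x, z) * ζ := by
  have h1 : HasDerivAt (fun t : ℂ => (x, t)) ((0 : E), (1 : ℂ)) z :=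
    (hasDerivAt_const z x).prodMk (hasDerivAt_id z)
  have h2 := h.hasFDerivAt.comp_hasDerivAt z h1
  have h3 : HasDerivAt (fun t => (W.map (evx x)).eval t) ((derivative (W.map (evx x))).eval z) z :=
    (W.map (evx x)).hasDerivAt z
  have h4 : (pev W ∘ fun t : ℂ => (x, t)) = fun t => (W.map (evx x)).eval t := by
    funext t; simp [pev, eval_map]
  rw [h4] at h2
  have h5 := h2.unique h3
  have h6 : ((0 : E), ζ) = ζ • ((0 : E), (1 : ℂ)) := by simp
  rw [h6, map_smul, h5, derivative_map, eval_map, smul_eq_mul, mul_comm]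
  rfl

theorem pev_fderiv_fst (W : (HolRing E)[X]) (x ξ : E) (z : ℂ) (h : DifferentiableAt ℂ (pev W) (x, z))
    (h' : ∀ k ∈ Finset.range (W.natDegree + 1), DifferentiableAt ℂ (W.coeff k).1 x) :
    fderiv ℂ (pev W) (x, z) (ξ, 0) = 
      ∑ k ∈ Finset.range (W.natDegree + 1), fderiv ℂ (W.coeff k).1 x ξ * z ^ k := by
  have h1 : HasFDerivAt (fun t : E => (t, z)) (ContinuousLinearMap.inl ℂ E ℂ) x :=
    hasFDerivAt_prodMk_left x z
  have h2 := h.hasFDerivAt.comp x h1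
  have h3 : HasFDerivAt (fun t => ∑ k ∈ Finset.range (W.natDegree + 1), (W.coeff k).1 t * z ^ k)
     (∑ k ∈ Finset.range (W.natDegree + 1), (z ^ k) • fderiv ℂ (W.coeff k).1 x) x :=
    HasFDerivAt.fun_sum fun k hk => (h' k hk).hasFDerivAt.mul_const (z ^ k)
  have h4 : (pev W ∘ fun t : E => (t, z)) = 
      fun t => ∑ k ∈ Finset.range (W.natDegree + 1), (W.coeff k).1 t * z ^ k := by
    funext t; simp [pev_sum_range]
  rw [h4] at h2
  have h5 := congrArg (fun M : E →L[ℂ] ℂ => M ξ) (h2.unique h3)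
  simp only [ContinuousLinearMap.comp_apply, ContinuousLinearMap.inl_apply] at h5
  rw [h5]
  simp [ContinuousLinearMap.sum_apply, mul_comm]


theorem tang_zero (𝓕 : Ultrafilter Ω) (χ : Ω → E) (hχ : Tendsto χ 𝓕 (𝓝 0)) (z ζ : Ω → ℂ) (ξ : Ω → E)
  (hξ : ∀ φ : HolRing E, iota 𝓕 χ φ = 0 → ∀ᶠ x in (𝓕 : Filter Ω), fderiv ℂ φ.1 (χ x) (ξ x) = 0)
    (s : (HolRing E)[X]) (hs : s.map (iota 𝓕 χ) = 0) :
    ∀ᶠ x in (𝓕 : Filter Ω), fderiv ℂ (pev s) (χ x, z x) (ξ x, ζ x) = 0 := by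
  have h1 : ∀ᶠ x in 𝓝 (0:E), ∀ k ∈ Finset.range (s.natDegree + 1), DifferentiableAt ℂ (s.coeff k).1 x :=
    (Filter.eventually_all_finset _).2 fun k _ => hol_ev_diff (s.coeff k).2
  rw [map_iota_zero] at hs
  have h2 : ∀ᶠ x in (𝓕 : Filter Ω), ∀ k ∈ Finset.range (s.natDegree + 1), 
      fderiv ℂ (s.coeff k).1 (χ x) (ξ x) = 0 :=
    (Filter.eventually_all_finset _).2 fun k _ => hξ _ (hs k)
  have h3 : (derivative s).eval₂ (iota 𝓕 χ) (z : Germ (𝓕 : Filter Ω) ℂ) = 0 := by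
    rw [← eval_map, ← derivative_map, (map_iota_zero _ _ _).2 hs]; simp
  rw [eval₂_iota_zero] at h3
  filter_upwards [hχ.eventually h1, hχ.eventually (pev_ev_diff s), h2, h3] with x a1 a2 a3 a4
  have : (ξ x, ζ x) = (ξ x, 0) + (0, ζ x) := by simp
  rw [this, map_add, pev_fderiv_fst s _ _ _ (a2 _) a1, pev_fderiv_snd s _ _ _ (a2 _), a4,
    Finset.sum_eq_zero (fun k hk => by rw [a3 k hk, zero_mul])]
  simp

theorem tang_of_div (𝓕 : Ultrafilter Ω) (χ : Ω → E) (hχ : Tendsto χ 𝓕 (𝓝 0)) (z ζ : Ω → ℂ) (ξ : Ω → E)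
  (hξ : ∀ φ : HolRing E, iota 𝓕 χ φ = 0 → ∀ᶠ x in (𝓕 : Filter Ω), fderiv ℂ φ.1 (χ x) (ξ x) = 0)
    (p : (HolRing E)[X]) (a : HolRing E) (ha : iota 𝓕 χ a ≠ 0)
    (hp : p.eval₂ (iota 𝓕 χ) (z : Germ (𝓕 : Filter Ω) ℂ) = 0)
    (hpd : ∀ᶠ x in (𝓕 : Filter Ω), fderiv ℂ (pev p) (χ x, z x) (ξ x, ζ x) = 0)
    (R q s : (HolRing E)[X]) (N : ℕ) (hR : R.eval₂ (iota 𝓕 χ) (z : Germ (𝓕 : Filter Ω) ℂ) = 0)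
    (hs : s.map (iota 𝓕 χ) = 0) (heq : C a ^ N * R = q * p + s) :
    ∀ᶠ x in (𝓕 : Filter Ω), fderiv ℂ (pev R) (χ x, z x) (ξ x, ζ x) = 0 := by
  rw [eval₂_iota_zero] at hp hR
  rw [iota_ne_zero] at ha
  filter_upwards [tang_zero 𝓕 χ hχ z ζ ξ hξ s hs, hp, hpd, hR, ha, hχ.eventually (pev_ev_diff s),
    hχ.eventually (pev_ev_diff p), hχ.eventually (pev_ev_diff q), hχ.eventually (pev_ev_diff R),
    hχ.eventually (pev_ev_diff (C a ^ N))] with x a1 a2 a3 a4 a5 d1 d2 d3 d4 d5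
  have h1 : (fun y => pev (C a ^ N) y * pev R y) = fun y => pev q y * pev p y + pev s y := by
    funext y; rw [← pev_mul, heq, pev_add, pev_mul]
  have h2 := ((d5 (z x)).hasFDerivAt.mul (d4 (z x)).hasFDerivAt)
  have h3 := ((d3 (z x)).hasFDerivAt.mul (d2 (z x)).hasFDerivAt).add (d1 (z x)).hasFDerivAt
  have h4 := congrArg (fun M : (E × ℂ) →L[ℂ] ℂ => M (ξ x, ζ x)) 
    (h2.unique (h3.congr_of_eventuallyEq (Eventually.of_forall fun y => congrFun h1 y)))
  simp only [ContinuousLinearMap.add_apply, ContinuousLinearMap.smul_apply, a1, a2, a3, a4,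
    smul_eq_mul, zero_mul, mul_zero, add_zero, pev_C_pow] at h4
  exact (mul_eq_zero.1 h4).resolve_left (pow_ne_zero _ a5)
end

section
open Polynomial
universe u v
variable {Ω : Type v}

theorem thmS (𝓕 : Ultrafilter Ω) (n : ℕ) : ∀ (E : Type u) [NormedAddCommGroup E] [NormedSpace ℂ E]
    [FiniteDimensional ℂ E], Module.finrank ℂ E < n → ∀ (u : E →L[ℂ] ℂ) (χ : Ω → E),
    Tendsto χ 𝓕 (𝓝 0) → (∀ᶠ x in (𝓕 : Filter Ω), u (χ x) ≠ 0) → 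
    ∃ (B : Type u) (_ : NormedAddCommGroup B) (_ : NormedSpace ℂ B) (_ : FiniteDimensional ℂ B)
      (π : E →L[ℂ] B) (uB : B →L[ℂ] ℂ), (∀ x, uB (π x) = u x) ∧
      (∀ φ : HolRing B, iota 𝓕 (π ∘ χ) φ = 0 → ∀ᶠ z in 𝓝 0, φ.1 z = 0) ∧
      (∀ φ : HolRing E, IsAlgebraic (iota 𝓕 (π ∘ χ)).range (iota 𝓕 χ φ)) ∧
      (∀ η : Ω → B, ∃ ξ : Ω → E, (∀ x, π (ξ x) = η x) ∧ ∀ φ : HolRing E, iota 𝓕 χ φ = 0 → 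
        ∀ᶠ x in (𝓕 : Filter Ω), fderiv ℂ φ.1 (χ x) (ξ x) = 0) := by
  induction n with
  | zero => intro E _ _ _ h; omega
  | succ n ih =>
  intro E _ _ _ hfr u χ hχ hu
  by_cases hall : ∀ φ : HolRing E, iota 𝓕 χ φ = 0 → ∀ᶠ z in 𝓝 0, φ.1 z = 0
  · refine ⟨E, inferInstance, inferInstance, inferInstance, ContinuousLinearMap.id ℂ E, u, 
      fun x => rfl, hall, fun φ => ?_, fun η => ⟨η, fun x => rfl, fun φ hφ => ?_⟩⟩
    · have : iota 𝓕 χ φ = algebraMap (iota 𝓕 (ContinuousLinearMap.id ℂ E ∘ χ)).range 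
        (Germ (𝓕 : Filter Ω) ℂ) ⟨iota 𝓕 χ φ, ⟨φ, rfl⟩⟩ := rfl
      rw [this]; exact isAlgebraic_algebraMap _
    · have h1 : ∀ᶠ y in 𝓝 (0:E), φ.1 =ᶠ[𝓝 y] fun _ => 0 := (hall φ hφ).eventually_nhds
      filter_upwards [hχ.eventually h1] with x hx
      rw [hx.fderiv_eq]; simp
  simp only [not_forall] at hall
  obtain ⟨φ₀, hφ₀, hn⟩ := hall
  obtain ⟨E', A, π, ℓ, W, p, ⟨hd, hA1, hA2, hA3, hA4⟩, ⟨hWm, hW0⟩, hWz, halg, hpz, hplc, hp1, hpmin⟩ :=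
    hol_step 𝓕 u χ hχ hu φ₀ hφ₀ hn
  have hπ : Tendsto (π ∘ χ) 𝓕 (𝓝 0) := by
    have := (π.continuous.tendsto 0).comp hχ
    simpa using this
  have hℓ : Tendsto (ℓ ∘ χ) 𝓕 (𝓝 0) := by
    have := (ℓ.continuous.tendsto 0).comp hχ
    simpa using this
  have hpair : Tendsto (fun x => ((π ∘ χ) x, (ℓ ∘ χ) x)) 𝓕 (𝓝 (0 : E' × ℂ)) := hπ.prodMk_nhds hℓ
  have hu4 : ∀ x, (u.comp E'.subtypeL) (π x) = u x := by
    intro x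
    have := hA4 (π x, ℓ x)
    rw [hA1] at this
    exact this.symm
  have hdiv : ∀ φ : HolRing E, ∃ (q : E' × ℂ → ℂ) (r : (HolRing E')[X]), ContDiffAt ℂ 1 q 0 ∧
      (∀ᶠ y in 𝓝 (0 : E' × ℂ), φ.1 (A y) = q y * pev W y + pev r y) ∧ 
      (r.eval₂ (iota 𝓕 (π ∘ χ)) ((ℓ ∘ χ : Ω → ℂ) : Germ (𝓕 : Filter Ω) ℂ) = iota 𝓕 χ φ) := by
    intro φ
    have hφ : ContDiffAt ℂ 1 φ.1 (A 0) := by rw [map_zero]; exact φ.2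
    obtain ⟨q, r, hq, h⟩ := weier_div W hWm hW0 (fun y => φ.1 (A y))
      (hφ.comp 0 A.contDiff.contDiffAt)
    refine ⟨q, r, hq, h, ?_⟩
    rw [eval₂_iota, iota_apply, Germ.coe_eq]
    filter_upwards [hpair.eventually h, (eval₂_iota_zero _ _ _ _).1 hWz] with x h1 h2
    rw [h2, mul_zero, zero_add] at h1
    rw [← h1]
    simp [hA1]
  obtain ⟨B, i1, i2, i3, πB, uB, hB0, hB1, hB2, hB3⟩ := ih E' (by omega) (u.comp E'.subtypeL) (π ∘ χ) hπ
    (by filter_upwards [hu] with x hx; rw [comp_apply, hu4]; exact hx)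
  refine ⟨B, i1, i2, i3, πB.comp π, uB, fun x => ?_, hB1, fun φ => ?_, fun η => ?_⟩
  · rw [ContinuousLinearMap.comp_apply, hB0, hu4]
  · obtain ⟨q, r, hq, h1, h2⟩ := hdiv φ
    rw [← h2]
    exact alg_tower _ _ hB2 _ (alg_eval _ _ halg r)
  obtain ⟨ξ', hξ1, hξ2⟩ := hB3 η
  set ζ : Ω → ℂ := fun x => - fderiv ℂ (pev p) ((π ∘ χ) x, (ℓ ∘ χ) x) (ξ' x, 0) /
    pev (derivative p) ((π ∘ χ) x, (ℓ ∘ χ) x) with hζ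
  have hpd : ∀ᶠ x in (𝓕 : Filter Ω), 
      fderiv ℂ (pev p) ((π ∘ χ) x, (ℓ ∘ χ) x) (ξ' x, ζ x) = 0 := by
    have h1 := alg_deriv _ _ p hp1 hplc hpmin
    rw [eval₂_iota, Ne, germ_eq_zero, ← Ultrafilter.eventually_not] at h1
    filter_upwards [h1, hπ.eventually (pev_ev_diff p)] with x a1 a2
    have : (ξ' x, ζ x) = (ξ' x, 0) + (0, ζ x) := by simp
    rw [this, map_add, pev_fderiv_snd p _ _ _ (a2 _)]
    simp only [hζ]
    field_simp
    ring
  have htan : ∀ R : (HolRing E')[X], 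
      R.eval₂ (iota 𝓕 (π ∘ χ)) ((ℓ ∘ χ : Ω → ℂ) : Germ (𝓕 : Filter Ω) ℂ) = 0 → 
      ∀ᶠ x in (𝓕 : Filter Ω), fderiv ℂ (pev R) ((π ∘ χ) x, (ℓ ∘ χ) x) (ξ' x, ζ x) = 0 := by
    intro R hR
    obtain ⟨N, q, s, h1, h2⟩ := alg_zero _ _ p hpz hp1 hpmin R hR
    exact tang_of_div 𝓕 (π ∘ χ) hπ (ℓ ∘ χ) ζ ξ' hξ2 p p.leadingCoeff hplc hpz hpd R q s N hR h2 h1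
  refine ⟨fun x => A (ξ' x, ζ x), fun x => ?_, fun φ hφ => ?_⟩
  · rw [ContinuousLinearMap.comp_apply, hA2]; exact hξ1 x
  obtain ⟨q, r, hq, h1, h2⟩ := hdiv φ
  rw [hφ] at h2
  have hφd : ∀ᶠ x in 𝓝 (0:E), DifferentiableAt ℂ φ.1 x := hol_ev_diff φ.2
  filter_upwards [htan r h2, htan W hWz, hpair.eventually h1.eventually_nhds, 
    hχ.eventually hφd, hpair.eventually (hol_ev_diff hq), hπ.eventually (pev_ev_diff W),
    hπ.eventually (pev_ev_diff r), (eval₂_iota_zero _ _ _ _).1 hWz] with x a1 a2 a3 a4 d1 d2 d3 a5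
  have e1 : A ((π ∘ χ) x, (ℓ ∘ χ) x) = χ x := hA1 _
  have e2 : HasFDerivAt (fun y => φ.1 (A y)) ((fderiv ℂ φ.1 (χ x)).comp A) ((π ∘ χ) x, (ℓ ∘ χ) x) := by
    refine HasFDerivAt.comp (g := φ.1) _ ?_ A.hasFDerivAt
    rw [e1]; exact a4.hasFDerivAt
  have h3 := (d1.hasFDerivAt.mul (d2 _).hasFDerivAt).add (d3 _).hasFDerivAt
  have h4 := congrArg (fun M : (E' × ℂ) →L[ℂ] ℂ => M (ξ' x, ζ x)) 
    (e2.unique (h3.congr_of_eventuallyEq a3))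
  simpa only [ContinuousLinearMap.add_apply, ContinuousLinearMap.smul_apply, a1, a2, a5,
    smul_eq_mul, zero_mul, mul_zero, add_zero, ContinuousLinearMap.comp_apply] using h4
end


section
open Polynomial
universe u v
variable {E : Type u} [NormedAddCommGroup E] [NormedSpace ℂ E] {Ω : Type v}

theorem line_conv (x η : E) (r : ℝ) : Convex ℝ {t : ℂ | x + t • η ∈ ball (0:E) r} := by
  intro s hs t ht a b ha hb hab
  have h := convex_ball (0:E) r hs ht ha hb hab
  simp only [Set.mem_ofPred_eq] at *
  convert h using 1
  rw [smul_add, smul_add, add_smul, add_add_add_comm, ← add_smul a b x, hab, one_smul, smul_assoc, smul_assoc]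

theorem line_open (x η : E) (r : ℝ) : IsOpen {t : ℂ | x + t • η ∈ ball (0:E) r} :=
  isOpen_ball.preimage (by fun_prop : Continuous fun t : ℂ => x + t • η)

theorem line_hol {φ : E → ℂ} (x η : E) (t : ℂ) (h : ContDiffAt ℂ 1 φ (x + t • η)) :
    ContDiffAt ℂ 1 (fun t : ℂ => φ (x + t • η)) t :=
  ContDiffAt.comp (f := fun t : ℂ => x + t • η) t h (by fun_prop)

theorem line_deriv {φ : E → ℂ} (x η : E) (t : ℂ) (h : ContDiffAt ℂ 1 φ (x + t • η)) :
    HasDerivAt (fun t : ℂ => φ (x + t • η)) (fderiv ℂ φ (x + t • η) η) t := by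
  have h1 : HasDerivAt (fun t : ℂ => x + t • η) η t := by
    simpa using ((hasDerivAt_id t).smul_const η).const_add x
  exact (h.differentiableAt (by simp)).hasFDerivAt.comp_hasDerivAt t h1

theorem wronsk_line (a b : E → ℂ) (r : ℝ) (ha : ∀ x ∈ ball (0:E) r, ContDiffAt ℂ 1 a x)
    (hb : ∀ x ∈ ball (0:E) r, ContDiffAt ℂ 1 b x) (x η : E)
    (hw : ∀ y ∈ ball (0:E) r, a y * fderiv ℂ b y η = b y * fderiv ℂ a y η)
    (hx : x ∈ ball (0:E) r) (hxη : x + η ∈ ball (0:E) r) (h0 : a x ≠ 0) :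
    a (x + η) * b x = b (x + η) * a x := by
  set T : Set ℂ := {t : ℂ | x + t • η ∈ ball (0:E) r} with hT
  have h0T : (0:ℂ) ∈ T := by simpa [hT] using hx
  have h1T : (1:ℂ) ∈ T := by simpa [hT] using hxη
  set K : ℂ → ℂ := fun t => a (x + t • η) * b x - b (x + t • η) * a x with hK
  have hKd : ∀ t ∈ T, HasDerivAt K (fderiv ℂ a (x + t • η) η * b x - fderiv ℂ b (x + t • η) η * a x) t :=
    fun t ht => ((line_deriv x η t (ha _ ht)).mul_const _).sub ((line_deriv x η t (hb _ ht)).mul_const _)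
  have hKan : AnalyticOnNhd ℂ K T := fun t ht => hol_analyticAt 
    (((line_hol x η t (ha _ ht)).mul contDiffAt_const).sub ((line_hol x η t (hb _ ht)).mul contDiffAt_const))
  have hne : ∀ᶠ t in 𝓝 (0:ℂ), t ∈ T ∧ a (x + t • η) ≠ 0 := by
    refine Filter.Eventually.and ((line_open x η r).mem_nhds h0T) ?_
    have : ContinuousAt (fun t : ℂ => a (x + t • η)) 0 := 
      (line_hol x η 0 (ha _ h0T)).continuousAt
    exact this.eventually_ne (by simpa using h0)
  obtain ⟨ρ, hρ, hne⟩ := Metric.eventually_nhds_iff_ball.1 hne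
  have hq : ∀ t ∈ ball (0:ℂ) ρ, HasDerivAt (fun t => K t / a (x + t • η)) 0 t := by
    intro t ht
    obtain ⟨h1, h2⟩ := hne t ht
    have h3 := (hKd t h1).div (line_deriv x η t (ha _ h1)) h2
    have h4 := hw _ h1
    refine h3.congr_deriv ?_
    rw [div_eq_zero_iff]
    left
    simp only [hK]
    linear_combination (-a x) * h4
  have hzero : ∀ t ∈ ball (0:ℂ) ρ, K t = 0 := by
    intro t ht
    have h1 := isOpen_ball.is_const_of_deriv_eq_zero (convex_ball (0:ℂ) ρ).isPreconnected
      (fun s hs => (hq s hs).differentiableAt.differentiableWithinAt) (fun s hs => (hq s hs).deriv)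
      ht (mem_ball_self hρ)
    have h2 : K 0 = 0 := by simp only [hK]; simp; ring
    simp only [h2, zero_div] at h1
    exact (div_eq_zero_iff.1 h1).resolve_right (hne t ht).2
  have := hKan.eqOn_zero_of_preconnected_of_eventuallyEq_zero (line_conv x η r).isPreconnected h0T
    (by filter_upwards [ball_mem_nhds (0:ℂ) hρ] with t ht using hzero t ht) h1T
  simp only [hK, one_smul, Pi.zero_apply] at this
  exact sub_eq_zero.1 this

theorem pev_sum_C (c : ℕ → HolRing E) (n : ℕ) (p : E × ℂ) :
    pev (∑ j ∈ Finset.range n, C (c j) * X ^ j) p = ∑ j ∈ Finset.range n, (c j).1 p.1 * p.2 ^ j := by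
  simp only [pev, eval₂_finsetSum, eval₂_mul, eval₂_C, eval₂_pow, eval₂_X]
  rfl

theorem coeff_sum_C {R : Type*} [CommRing R] (c : ℕ → R) (n k : ℕ) :
    (∑ j ∈ Finset.range n, C (c j) * X ^ j).coeff k = if k < n then c k else 0 := by
  simp [finsetSum_coeff, coeff_C_mul, coeff_X_pow]

/-- Directional derivative in the ring. -/
noncomputable def dirD (η : E) (b : HolRing E) : HolRing E :=
  ⟨fun x => fderiv ℂ b.1 x η, hol_fderiv (show ContDiffAt ℂ 1 b.1 0 from b.2) η⟩

theorem claimA_wronsk [FiniteDimensional ℂ E] (𝓕 : Ultrafilter Ω) (χ : Ω → E) (hχ : Tendsto χ 𝓕 (𝓝 0)) (G : HolRing E)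
    {B : Type u} [NormedAddCommGroup B] [NormedSpace ℂ B] (π : E →L[ℂ] B)
    (h1 : ∀ φ : HolRing B, iota 𝓕 (π ∘ χ) φ = 0 → ∀ᶠ z in 𝓝 0, φ.1 z = 0)
    (M : (HolRing B)[X]) (hM : M.eval₂ (iota 𝓕 (π ∘ χ)) (iota 𝓕 χ G) = 0)
    (hmin : ∀ r : (HolRing B)[X], r.eval₂ (iota 𝓕 (π ∘ χ)) (iota 𝓕 χ G) = 0 →
        r.natDegree < M.natDegree → r.map (iota 𝓕 (π ∘ χ)) = 0) (hM1 : 1 ≤ M.natDegree)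
    (η : B) (ξ : Ω → E) (hξ : ∀ x, π (ξ x) = η)
    (hξ2 : ∀ φ : HolRing E, iota 𝓕 χ φ = 0 → ∀ᶠ x in (𝓕 : Filter Ω), fderiv ℂ φ.1 (χ x) (ξ x) = 0)
    (hG : ∀ᶠ x in (𝓕 : Filter Ω), fderiv ℂ G.1 (χ x) (ξ x) = 0) (j : ℕ) (hj : j ≤ M.natDegree) :
    ∀ᶠ y in 𝓝 (0:B), M.leadingCoeff.1 y * fderiv ℂ (M.coeff j).1 y η = 
      (M.coeff j).1 y * fderiv ℂ M.leadingCoeff.1 y η := by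
  have hπ : Tendsto (π ∘ χ) 𝓕 (𝓝 0) := by
    have := (π.continuous.tendsto 0).comp hχ
    simpa using this
  set d := M.natDegree with hd
  have hlc : M.leadingCoeff = M.coeff d := rfl
  have hGc : ContDiffAt ℂ 1 G.1 0 := G.2
  -- the composite function
  have hΨ : ContDiffAt ℂ 1 (fun x => pev M (π x, G.1 x)) 0 := by
    refine ContDiffAt.comp (g := pev M) (f := fun x => (π x, G.1 x)) 0 ?_ ?_
    · simpa using pev_cd M (G.1 0)
    · exact π.contDiff.contDiffAt.prodMk hGc
  have e1 := hξ2 ⟨_, hΨ⟩ (by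
    rw [iota_eq_zero]
    rw [iota_apply, eval₂_iota_zero] at hM
    exact hM)
  set DM : (HolRing B)[X] := ∑ k ∈ Finset.range (d + 1), C (dirD η (M.coeff k)) * X ^ k with hDM
  have hDMz : DM.eval₂ (iota 𝓕 (π ∘ χ)) (iota 𝓕 χ G) = 0 := by
    rw [iota_apply, eval₂_iota_zero]
    have hcd : ∀ᶠ x in 𝓝 (0:B), ∀ k ∈ Finset.range (M.natDegree + 1), DifferentiableAt ℂ (M.coeff k).1 x :=
      (Filter.eventually_all_finset _).2 fun k _ => hol_ev_diff (M.coeff k).2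
    filter_upwards [e1, hG, hπ.eventually (pev_ev_diff M), hπ.eventually hcd, 
      hχ.eventually (hol_ev_diff hGc)] with x a1 a2 d1 d2 d3
    have h3 : HasFDerivAt (fun x => pev M (π x, G.1 x)) ((fderiv ℂ (pev M) (π (χ x), G.1 (χ x))).comp 
        (π.prod (fderiv ℂ G.1 (χ x)))) (χ x) := 
      HasFDerivAt.comp (g := pev M) (f := fun x => (π x, G.1 x)) (χ x) (d1 _).hasFDerivAt
        (π.hasFDerivAt.prodMk d3.hasFDerivAt)
    simp only [h3.fderiv] at a1
    simp only [ContinuousLinearMap.comp_apply, ContinuousLinearMap.prod_apply, a2, hξ] at a1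
    have h4 := pev_fderiv_fst M (π (χ x)) η (G.1 (χ x)) (d1 _) d2
    rw [hDM, pev_sum_C]
    rw [a1] at h4
    exact h4.symm
  have hcomb := hmin (C M.leadingCoeff * DM - C (dirD η M.leadingCoeff) * M) (by
      rw [eval₂_sub, eval₂_mul, eval₂_mul, hDMz, hM]; simp) (by
    have hle : (C M.leadingCoeff * DM - C (dirD η M.leadingCoeff) * M).natDegree ≤ d := by
      refine natDegree_le_iff_coeff_eq_zero.2 fun k hk => ?_
      rw [coeff_sub, coeff_C_mul, coeff_C_mul, hDM, coeff_sum_C, 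
        coeff_eq_zero_of_natDegree_lt (p := M) (by omega), if_neg (by omega)]
      simp
    refine lt_of_le_of_ne hle fun h => ?_
    have hz : (C M.leadingCoeff * DM - C (dirD η M.leadingCoeff) * M).coeff d = 0 := by
      rw [coeff_sub, coeff_C_mul, coeff_C_mul, hDM, coeff_sum_C, if_pos (by omega), hlc]
      ring
    rw [← h, coeff_natDegree, leadingCoeff_eq_zero] at hz
    rw [hz] at h; simp at h; omega)
  have h5 := h1 _ ((map_iota_zero _ _ _).1 hcomb j)
  rw [coeff_sub, coeff_C_mul, coeff_C_mul, hDM, coeff_sum_C, if_pos (by omega)] at h5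
  filter_upwards [h5] with y hy
  have : M.leadingCoeff.1 y * fderiv ℂ (M.coeff j).1 y η - 
    fderiv ℂ M.leadingCoeff.1 y η * (M.coeff j).1 y = 0 := hy
  linear_combination this

theorem claimA [FiniteDimensional ℂ E] (𝓕 : Ultrafilter Ω) (u : E →L[ℂ] ℂ) (χ : Ω → E) 
    (hχ : Tendsto χ 𝓕 (𝓝 0)) (hu : ∀ᶠ x in (𝓕 : Filter Ω), u (χ x) ≠ 0) (G : HolRing E)
    (H : ∀ ξ₀ ξ : Ω → E, (∀ x, u (ξ₀ x) = 1) → (∀ x, u (ξ x) = 0) →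
      (∀ φ : HolRing E, iota 𝓕 χ φ = 0 → ∀ᶠ x in (𝓕 : Filter Ω), fderiv ℂ φ.1 (χ x) (ξ₀ x) = 0) →
      (∀ φ : HolRing E, iota 𝓕 χ φ = 0 → ∀ᶠ x in (𝓕 : Filter Ω), fderiv ℂ φ.1 (χ x) (ξ x) = 0) →
      ∀ᶠ x in (𝓕 : Filter Ω), fderiv ℂ G.1 (χ x) (ξ x) = 0) :
    IsAlgebraic (iota 𝓕 (u ∘ χ)).range (iota 𝓕 χ G) := by
  obtain ⟨B, i1, i2, i3, π, uB, hB0, hB1, hB2, hB3⟩ := thmS 𝓕 _ E (Nat.lt_succ_self _) u χ hχ hu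
  have hπ : Tendsto (π ∘ χ) 𝓕 (𝓝 0) := by
    have := (π.continuous.tendsto 0).comp hχ
    simpa using this
  have hut : Tendsto (u ∘ χ) 𝓕 (𝓝 0) := by
    have := (u.continuous.tendsto 0).comp hχ
    simpa using this
  obtain ⟨e, he⟩ : ∃ e, uB e = 1 := by
    obtain ⟨x, hx⟩ := hu.exists
    exact ⟨(u (χ x))⁻¹ • π (χ x), by rw [map_smul, hB0, smul_eq_mul, inv_mul_cancel₀ hx]⟩
  obtain ⟨M, hM, hMlc, hM1, hMmin⟩ := alg_min _ _ (hB2 G)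
  obtain ⟨ξ₀, hξ₀1, hξ₀2⟩ := hB3 fun _ => e
  have hw : ∀ η : B, uB η = 0 → ∀ j ≤ M.natDegree, ∀ᶠ y in 𝓝 (0:B), 
      M.leadingCoeff.1 y * fderiv ℂ (M.coeff j).1 y η = 
      (M.coeff j).1 y * fderiv ℂ M.leadingCoeff.1 y η := by
    intro η hη j hj
    obtain ⟨ξ, hξ1, hξ2⟩ := hB3 fun _ => η
    refine claimA_wronsk 𝓕 χ hχ G π hB1 M hM hMmin hM1 η ξ hξ1 hξ2 ?_ j hj
    refine H ξ₀ ξ (fun x => ?_) (fun x => ?_) hξ₀2 hξ2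
    · rw [← hB0, hξ₀1, he]
    · rw [← hB0, hξ1, hη]
  -- uniform over the kernel
  have hw' : ∀ᶠ y in 𝓝 (0:B), ∀ j ∈ Finset.range (M.natDegree + 1), ContDiffAt ℂ 1 (M.coeff j).1 y ∧ 
      ∀ η : B, uB η = 0 → 
      M.leadingCoeff.1 y * fderiv ℂ (M.coeff j).1 y η = 
      (M.coeff j).1 y * fderiv ℂ M.leadingCoeff.1 y η := by
    refine (Filter.eventually_all_finset _).2 fun j hj => ?_
    refine Filter.Eventually.and
      ((show ContDiffAt ℂ 1 (M.coeff j).1 0 from (M.coeff j).2).eventually (by simp)) ?_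
    set b := Module.finBasis ℂ (LinearMap.ker uB.toLinearMap) with hb
    have h1 : ∀ᶠ y in 𝓝 (0:B), ∀ i, 
      M.leadingCoeff.1 y * fderiv ℂ (M.coeff j).1 y (b i : B) = 
      (M.coeff j).1 y * fderiv ℂ M.leadingCoeff.1 y (b i : B) := by
      rw [Filter.eventually_all]
      intro i
      exact hw _ (b i).2 j (by simpa [Nat.lt_succ_iff] using hj)
    filter_upwards [h1] with y hy η hη
    have hη' : η ∈ LinearMap.ker uB.toLinearMap := hη
    have h2 : η = ∑ i, b.repr ⟨η, hη'⟩ i • (b i : B) := by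
      have := congrArg (LinearMap.ker uB.toLinearMap).subtype (b.sum_repr ⟨η, hη'⟩)
      rw [map_sum] at this
      simp only [map_smul, Submodule.subtype_apply] at this
      exact this.symm
    rw [h2]
    simp only [map_sum, map_smul, Finset.mul_sum, smul_eq_mul]
    refine Finset.sum_congr rfl fun i _ => ?_
    linear_combination (b.repr ⟨η, hη'⟩ i) * hy i
  obtain ⟨r, hr, hball⟩ := Metric.eventually_nhds_iff_ball.1 hw'
  have hlcr : M.natDegree ∈ Finset.range (M.natDegree + 1) := by simp
  have hMlc' := hMlc
  rw [iota_ne_zero] at hMlc'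
  have hsm : ∀ᶠ y in 𝓝 (0:B), y ∈ ball (0:B) r ∧ y - uB y • e ∈ ball (0:B) r := by
    refine Filter.Eventually.and (ball_mem_nhds _ hr) ?_
    have : ContinuousAt (fun y => y - uB y • e) 0 := by fun_prop
    exact this.eventually (isOpen_ball.mem_nhds (by simpa using hr))
  obtain ⟨xs, hxs1, hxs2, hxs3⟩ := (hMlc'.and (hπ.eventually hsm)).exists
  set xx := (π ∘ χ) xs with hxx
  set y₀ := xx - uB xx • e with hy₀
  have huy₀ : uB y₀ = 0 := by simp [hy₀, he]
  have hhol : ∀ j ∈ Finset.range (M.natDegree + 1), ContDiffAt ℂ 1 (fun c : ℂ => (M.coeff j).1 (y₀ + c • e)) 0 := by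
    intro j hj
    exact line_hol y₀ e 0 (by simpa using (hball _ hxs3 j hj).1)
  have hane : ∀ᶠ c in 𝓝[≠] (0:ℂ), M.leadingCoeff.1 (y₀ + c • e) ≠ 0 := by
    refine (hol_analyticAt (hhol _ hlcr)).eventually_eq_zero_or_eventually_ne_zero.resolve_left fun h => ?_
    have han : AnalyticOnNhd ℂ (fun c : ℂ => M.leadingCoeff.1 (y₀ + c • e)) {t : ℂ | y₀ + t • e ∈ ball (0:B) r} :=
      fun t ht => hol_analyticAt (line_hol y₀ e t (hball _ ht _ hlcr).1)
    have h2 := han.eqOn_zero_of_preconnected_of_eventuallyEq_zero (line_conv y₀ e r).isPreconnected 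
      (z₀ := 0) (by simpa using hxs3) h (x := uB xx) (by simpa [hy₀] using hxs2)
    apply hxs1
    simpa [hy₀] using h2
  classical
  set c : ℕ → HolRing ℂ := fun j => if hj : j ∈ Finset.range (M.natDegree + 1) then 
    ⟨fun c : ℂ => (M.coeff j).1 (y₀ + c • e), hhol j hj⟩ else 0 with hc
  have hcj : ∀ j ∈ Finset.range (M.natDegree + 1), ∀ t, (c j).1 t = (M.coeff j).1 (y₀ + t • e) := by
    intro j hj t
    simp only [hc]
    rw [dif_pos hj]
  have hut' : Tendsto (u ∘ χ) 𝓕 (𝓝[≠] 0) := tendsto_nhdsWithin_iff.2 ⟨hut, hu⟩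
  refine (alg_iff _ _).2 ⟨∑ j ∈ Finset.range (M.natDegree + 1), C (c j) * X ^ j, ?_, ?_⟩
  · intro h
    have := (map_iota_zero _ _ _).1 h M.natDegree
    rw [coeff_sum_C, if_pos (by omega), iota_eq_zero] at this
    obtain ⟨x, h1, h2⟩ := ((hut'.eventually hane).and this).exists
    rw [hcj _ hlcr] at h2
    exact h1 h2
  · rw [iota_apply, eval₂_iota_zero]
    rw [iota_apply, eval₂_iota_zero] at hM
    have hyr : ∀ᶠ c in 𝓝 (0:ℂ), y₀ + c • e ∈ ball (0:B) r := 
      (line_open y₀ e r).mem_nhds (by simpa using hxs3)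
    filter_upwards [hM, hMlc', hut'.eventually hane, hπ.eventually (ball_mem_nhds _ hr), 
      hut.eventually hyr] with x a1 a2 a3 a4 a5
    rw [pev_sum_C]
    rw [pev_sum_range] at a1
    have key : ∀ j ∈ Finset.range (M.natDegree + 1), M.leadingCoeff.1 ((π ∘ χ) x) * (c j).1 ((u ∘ χ) x) =
        (M.coeff j).1 ((π ∘ χ) x) * M.leadingCoeff.1 (y₀ + (u ∘ χ) x • e) := by
      intro j hj
      rw [hcj j hj]
      have hker : uB ((π ∘ χ) x - (y₀ + (u ∘ χ) x • e)) = 0 := by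
        simp [huy₀, he, hB0]
      have := wronsk_line M.leadingCoeff.1 (M.coeff j).1 r (fun y hy => (hball y hy _ hlcr).1) 
        (fun y hy => (hball y hy _ hj).1) (y₀ + (u ∘ χ) x • e) ((π ∘ χ) x - (y₀ + (u ∘ χ) x • e))
        (fun y hy => (hball y hy _ hj).2 _ hker) a5 (by simpa using a4) a3
      simpa using this
    refine (mul_eq_zero.1 (?_ : M.leadingCoeff.1 ((π ∘ χ) x) * _ = 0)).resolve_left a2
    have h3 := congrArg (fun t => M.leadingCoeff.1 (y₀ + (u ∘ χ) x • e) * t) a1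
    simp only [mul_zero] at h3
    rw [← h3, Finset.mul_sum, Finset.mul_sum]
    refine Finset.sum_congr rfl fun j hj => ?_
    simp only
    linear_combination (G.1 (χ x)) ^ j * key j hj
end


section
open Polynomial
universe v
variable {Ω : Type v}

theorem pui_slope (c : HolRing ℂ) (hc : ¬ ∀ᶠ z in 𝓝 0, c.1 z = 0) (N l : ℕ) (hN : 0 < N) (hl : l ∣ N) :
    ∃ (m : ℕ) (g : HolRing ℂ), g.1 0 ≠ 0 ∧ ∀ᶠ s in 𝓝 (0:ℂ), c.1 (s ^ N) = s ^ (m * l) * g.1 s := by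
  have han : AnalyticAt ℂ c.1 0 := hol_analyticAt c.2
  obtain ⟨k, g, hg, hg0, h⟩ := han.exists_eventuallyEq_pow_smul_nonzero_iff.2 hc
  obtain ⟨q, rfl⟩ := hl
  have hg' : ContDiffAt ℂ 1 (fun s : ℂ => g (s ^ (l * q))) 0 := by
    refine ContDiffAt.comp (g := g) (f := fun s : ℂ => s ^ (l * q)) 0 ?_ (by fun_prop)
    rw [zero_pow hN.ne']; exact hg.contDiffAt
  refine ⟨q * k, ⟨_, hg'⟩, by simpa [zero_pow hN.ne'] using hg0, ?_⟩
  have ht : Tendsto (fun s : ℂ => s ^ (l * q)) (𝓝 0) (𝓝 0) := by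
    have : ContinuousAt (fun s : ℂ => s ^ (l * q)) 0 := by fun_prop
    simpa [ContinuousAt, zero_pow hN.ne'] using this
  filter_upwards [ht.eventually h] with s hs
  rw [hs, sub_zero, smul_eq_mul, ← pow_mul]
  congr 2; ring

theorem tschirn {R : Type*} [CommRing R] (h : R[X]) (hm : h.Monic) (e : ℕ) (he : h.natDegree = e + 1) (r : R)
    (hr : (e + 1 : ℕ) * r = - h.coeff e) : (taylor r h).coeff e = 0 := by
  rw [taylor_coeff, eval_eq_sum_range' (n := 2)]
  · rw [Finset.sum_range_succ, Finset.sum_range_one]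
    simp only [hasseDeriv_coeff]
    have : h.coeff (1 + e) = 1 := by rw [add_comm, ← he]; exact hm
    rw [this, zero_add, Nat.choose_self, add_comm 1 e, Nat.choose_succ_self_right]
    simp only [Nat.cast_one, one_mul, pow_zero, mul_one, pow_one]
    rw [hr]; ring
  · have := natDegree_hasseDeriv_le h e
    omega

theorem pui_root_mult (H : ℂ[X]) (hm : H.Monic) (e : ℕ) (he : H.natDegree = e + 1) (h0 : H.coeff e = 0)
    (hne : ∃ i ≤ e, H.coeff i ≠ 0) (α : ℂ) : 
    ∃ m ≤ e, analyticOrderAt (fun t => H.eval (α + t)) 0 = m := by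
  obtain ⟨R, hR, hnd⟩ := exists_eq_pow_rootMultiplicity_mul_and_not_dvd H hm.ne_zero α
  set m := rootMultiplicity α H with hmm
  have hR0 : R.eval α ≠ 0 := by
    rwa [dvd_iff_isRoot] at hnd
  have hRne : R ≠ 0 := by rintro rfl; simp at hR0
  have hdeg : H.natDegree = m + R.natDegree := by
    have hx := ((monic_X_sub_C α).pow m).natDegree_mul' hRne
    rw [← hR] at hx
    rw [hx, natDegree_pow, natDegree_X_sub_C, mul_one]
  refine ⟨m, ?_, ?_⟩
  · by_contra! hlt
    have hme : m = e + 1 := by omega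
    have hRm : R.Monic := by
      rw [hR] at hm
      exact ((monic_X_sub_C α).pow m).of_mul_monic_left hm
    have hR1 : R = 1 := by
      apply hRm.natDegree_eq_zero.1; omega
    rw [hR1, mul_one, hme] at hR
    have hnx : H.nextCoeff = 0 := by
      rw [nextCoeff_of_natDegree_pos (by omega), he]; exact h0
    rw [hR, (monic_X_sub_C α).nextCoeff_pow, nextCoeff_X_sub_C] at hnx
    have hα : α = 0 := by
      rw [nsmul_eq_mul] at hnx
      rcases mul_eq_zero.1 hnx with h2 | h2
      · exfalso; push_cast at h2; exact Nat.cast_add_one_ne_zero e h2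
      · simpa using h2
    obtain ⟨i, hi, hi2⟩ := hne
    apply hi2
    rw [hR, hα]
    simp [coeff_X_pow]; omega
  · have han : AnalyticAt ℂ (fun t => H.eval (α + t)) 0 := by
      refine hol_analyticAt ?_
      have : ContDiff ℂ 1 (fun t => H.eval t) := by
        simpa using Polynomial.contDiff_aeval (𝕜 := ℂ) H 1
      exact (this.comp (by fun_prop : ContDiff ℂ 1 (fun t : ℂ => α + t))).contDiffAt
    rw [han.analyticOrderAt_eq_natCast]
    refine ⟨fun t => R.eval (α + t), ?_, by simpa using hR0, ?_⟩
    · refine hol_analyticAt ?_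
      have : ContDiff ℂ 1 (fun t => R.eval t) := by
        simpa using Polynomial.contDiff_aeval (𝕜 := ℂ) R 1
      exact (this.comp (by fun_prop : ContDiff ℂ 1 (fun t : ℂ => α + t))).contDiffAt
    · refine Eventually.of_forall fun t => ?_
      change H.eval (α + t) = _
      conv_lhs => rw [hR]
      simp

theorem pui_limit (𝓖 : Ultrafilter Ω) (s w : Ω → ℂ) (hs : Tendsto s 𝓖 (𝓝 0)) (H : (HolRing ℂ)[X]) (hm : H.Monic)
    (hz : ∀ᶠ x in (𝓖 : Filter Ω), pev H (s x, w x) = 0) : ∃ α, Tendsto w 𝓖 (𝓝 α) := by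
  set d := H.natDegree with hd
  set M : ℝ := ∑ k ∈ Finset.range d, (‖(H.coeff k).1 0‖ + 1) with hM
  have hc : ∀ᶠ z in 𝓝 (0:ℂ), ∀ k ∈ Finset.range d, ‖(H.coeff k).1 z‖ ≤ ‖(H.coeff k).1 0‖ + 1 := by
    refine (Filter.eventually_all_finset _).2 fun k _ => ?_
    have h2 : ContinuousAt (fun x => ‖(H.coeff k).1 x‖) 0 :=
      (show ContDiffAt ℂ 1 (H.coeff k).1 0 from (H.coeff k).2).continuousAt.norm
    filter_upwards [h2.eventually (gt_mem_nhds (lt_add_one _))] with z hz using hz.le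
  have hb : ∀ᶠ x in (𝓖 : Filter Ω), w x ∈ closedBall (0:ℂ) (max 1 M) := by
    filter_upwards [hz, hs.eventually hc] with x h1 h2
    rw [mem_closedBall_zero_iff]
    by_contra! hlt
    obtain ⟨hw1, hwM⟩ := max_lt_iff.1 hlt
    rw [pev_sum_range, ← hd, Finset.sum_range_succ, hd, hm.coeff_natDegree, ← hd] at h1
    have h3 : (w x) ^ d = - ∑ k ∈ Finset.range d, (H.coeff k).1 (s x) * (w x) ^ k := by
      have : ((1 : HolRing ℂ).1 (s x)) = 1 := rfl
      simp only [this] at h1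
      linear_combination h1
    rcases Nat.eq_zero_or_pos d with h0 | h0
    · rw [h0] at h3; simp at h3
    obtain ⟨d', hd'⟩ : ∃ d', d = d' + 1 := ⟨d - 1, by omega⟩
    have h4 : ‖w x‖ ^ d ≤ ∑ k ∈ Finset.range d, (‖(H.coeff k).1 0‖ + 1) * ‖w x‖ ^ d' := by
      rw [← norm_pow, h3, norm_neg]
      refine (norm_sum_le _ _).trans (Finset.sum_le_sum fun k hk => ?_)
      rw [norm_mul, norm_pow]
      have hk' := Finset.mem_range.1 hk
      gcongr
      · exact h2 k hk
      · exact hw1.le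
      · omega
    rw [← Finset.sum_mul, ← hM, hd', pow_succ, mul_comm] at h4
    have := le_of_mul_le_mul_right h4 (by positivity)
    linarith
  obtain ⟨α, -, hα⟩ := (isCompact_closedBall (0:ℂ) (max 1 M)).ultrafilter_le_nhds (𝓖.map w)
    (by rw [le_principal_iff]; exact hb)
  exact ⟨α, hα⟩

theorem puiseux (𝓖 : Ultrafilter Ω) (n : ℕ) : ∀ (u v : Ω → ℂ) (_ : Tendsto u 𝓖 (𝓝 0)) 
    (_ : ∀ᶠ x in (𝓖 : Filter Ω), u x ≠ 0) (h : (HolRing ℂ)[X]) (_ : h.Monic) (_ : h.natDegree < n)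
    (_ : ∀ᶠ x in (𝓖 : Filter Ω), pev h (u x, v x) = 0), 
    ∃ (N : ℕ) (b : HolRing ℂ) (σ : Ω → ℂ), 0 < N ∧ Tendsto σ 𝓖 (𝓝 0) ∧ 
      ∀ᶠ x in (𝓖 : Filter Ω), u x = σ x ^ N ∧ v x = b.1 (σ x) := by
  induction n with
  | zero => intro u v _ _ h _ h0; omega
  | succ n ih =>
  intro u v hu hu0 h₀ hm₀ hdeg₀ hz₀
  rcases Nat.eq_zero_or_pos h₀.natDegree with h0 | hpos
  · rw [hm₀.natDegree_eq_zero.1 h0] at hz₀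
    obtain ⟨x, hx⟩ := hz₀.exists
    simp [pev] at hx
  obtain ⟨e, he₀⟩ : ∃ e, h₀.natDegree = e + 1 := ⟨h₀.natDegree - 1, by omega⟩
  -- Tschirnhaus
  have hrh : ContDiffAt ℂ 1 (fun z => - (h₀.coeff e).1 z / (e + 1 : ℂ)) 0 := 
    (show ContDiffAt ℂ 1 (h₀.coeff e).1 0 from (h₀.coeff e).2).neg.div_const _
  set r : HolRing ℂ := ⟨_, hrh⟩ with hr
  have hrr : ((e + 1 : ℕ) : HolRing ℂ) * r = - h₀.coeff e := by
    apply Subtype.ext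
    funext z
    change (((e + 1 : ℕ) : HolRing ℂ).1 z) * (- (h₀.coeff e).1 z / (e + 1 : ℂ)) = - (h₀.coeff e).1 z
    have h1 : (((e + 1 : ℕ) : HolRing ℂ).1 z) = (e + 1 : ℂ) := by
      have := map_natCast (evx z) (e + 1)
      rw [evx_apply] at this
      rw [this]; push_cast; rfl
    rw [h1]
    have : (e + 1 : ℂ) ≠ 0 := Nat.cast_add_one_ne_zero e
    field_simp
  set h := taylor r h₀ with hh
  have hm : h.Monic := by
    rw [hh, Monic, leadingCoeff_taylor]; exact hm₀
  have he : h.natDegree = e + 1 := by rw [hh, natDegree_taylor, he₀]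
  have hce : h.coeff e = 0 := tschirn h₀ hm₀ e he₀ r hrr
  set v' : Ω → ℂ := fun x => v x - r.1 (u x) with hv'
  have hz : ∀ᶠ x in (𝓖 : Filter Ω), pev h (u x, v' x) = 0 := by
    filter_upwards [hz₀] with x hx
    rw [hh, taylor_apply, pev, eval₂_comp]
    simpa [hv', pev] using hx
  have hexp : ∀ᶠ x in (𝓖 : Filter Ω), v' x ^ (e + 1) + 
      ∑ k ∈ Finset.range (e + 1), (h.coeff k).1 (u x) * v' x ^ k = 0 := by
    filter_upwards [hz] with x hx
    rw [pev_sum_range, he, Finset.sum_range_succ, ← he, hm.coeff_natDegree, he] at hx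
    have : ((1 : HolRing ℂ).1 (u x)) = 1 := rfl
    simp only [this] at hx
    linear_combination hx
  by_cases hall : ∀ k ∈ Finset.range (e + 1), ∀ᶠ z in 𝓝 0, (h.coeff k).1 z = 0
  · refine ⟨1, r, u, one_pos, hu, ?_⟩
    have h1 := (Filter.eventually_all_finset _).2 hall
    filter_upwards [hexp, hu.eventually h1] with x a1 a2
    rw [Finset.sum_eq_zero fun k hk => by rw [a2 k hk, zero_mul], add_zero] at a1
    refine ⟨by simp, ?_⟩
    have := pow_eq_zero_iff (by omega) |>.1 a1
    simp only [hv'] at this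
    linear_combination this
  simp only [not_forall] at hall
  obtain ⟨k₀, hk₀, hk₀'⟩ := hall
  classical
  set N := (e + 1).factorial with hN
  have hNpos : 0 < N := Nat.factorial_pos _
  have hsl : ∀ k : ℕ, ∃ (m : ℕ) (g : HolRing ℂ), k ∈ Finset.range (e + 1) → (¬ ∀ᶠ z in 𝓝 0, (h.coeff k).1 z = 0) → 
      g.1 0 ≠ 0 ∧ ∀ᶠ s in 𝓝 (0:ℂ), (h.coeff k).1 (s ^ N) = s ^ (m * (e + 1 - k)) * g.1 s := by
    intro k
    by_cases hk : k ∈ Finset.range (e + 1) ∧ ¬ ∀ᶠ z in 𝓝 0, (h.coeff k).1 z = 0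
    · obtain ⟨m, g, h1, h2⟩ := pui_slope (h.coeff k) hk.2 N (e + 1 - k) hNpos 
        (Nat.dvd_factorial (by have := Finset.mem_range.1 hk.1; omega) (by omega))
      exact ⟨m, g, fun _ _ => ⟨h1, h2⟩⟩
    · exact ⟨0, 0, fun a b => absurd ⟨a, b⟩ hk⟩
  choose m g hmg using hsl
  obtain ⟨k₁, hk₁, hmin⟩ := Finset.exists_min_image 
    ((Finset.range (e + 1)).filter fun k => ¬ ∀ᶠ z in 𝓝 0, (h.coeff k).1 z = 0) m
    ⟨k₀, Finset.mem_filter.2 ⟨hk₀, hk₀'⟩⟩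
  obtain ⟨hk₁r, hk₁n⟩ := Finset.mem_filter.1 hk₁
  set p := m k₁ with hp
  set D : ℕ → HolRing ℂ := fun k => if k = e + 1 then 1 else 
    if ∀ᶠ z in 𝓝 0, (h.coeff k).1 z = 0 then 0 else 
    ⟨fun s => s ^ ((m k - p) * (e + 1 - k)), by
      change ContDiffAt ℂ 1 _ 0; fun_prop⟩ * g k with hD
  have hDspec : ∀ k ∈ Finset.range (e + 1), ∀ᶠ s in 𝓝 (0:ℂ), 
      (h.coeff k).1 (s ^ N) = s ^ (p * (e + 1 - k)) * (D k).1 s := by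
    intro k hk
    have hke : k ≠ e + 1 := by have := Finset.mem_range.1 hk; omega
    by_cases hkz : ∀ᶠ z in 𝓝 0, (h.coeff k).1 z = 0
    · have ht : Tendsto (fun s : ℂ => s ^ N) (𝓝 0) (𝓝 0) := by
        have : ContinuousAt (fun s : ℂ => s ^ N) 0 := by fun_prop
        simpa [ContinuousAt, zero_pow hNpos.ne'] using this
      filter_upwards [ht.eventually hkz] with s hs
      rw [hs, show D k = 0 by simp only [hD]; rw [if_neg hke, if_pos hkz]]
      change 0 = _ * (0 : ℂ)
      rw [mul_zero]
    · filter_upwards [(hmg k hk hkz).2] with s hs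
      rw [hs]
      have hDk : (D k).1 s = s ^ ((m k - p) * (e + 1 - k)) * (g k).1 s := by
        simp only [hD]; rw [if_neg hke, if_neg hkz]; rfl
      rw [hDk, ← mul_assoc, ← pow_add, ← add_mul, 
        Nat.add_sub_cancel' (hmin k (Finset.mem_filter.2 ⟨hk, hkz⟩))]
  set H : (HolRing ℂ)[X] := ∑ k ∈ Finset.range (e + 2), C (D k) * X ^ k with hH
  have hHc : ∀ k, H.coeff k = if k < e + 2 then D k else 0 := fun k => by rw [hH, coeff_sum_C]
  have hDe : D (e + 1) = 1 := by simp [hD]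
  have hHle : H.natDegree ≤ e + 1 := natDegree_le_iff_coeff_eq_zero.2 fun k hk => by
    rw [hHc, if_neg (by omega)]
  have hHm : H.Monic := monic_of_natDegree_le_of_coeff_eq_one (e + 1) hHle (by
    rw [hHc, if_pos (by omega), hDe])
  have hHd : H.natDegree = e + 1 := by
    refine le_antisymm hHle (le_natDegree_of_ne_zero ?_)
    rw [hHc, if_pos (by omega), hDe]; exact one_ne_zero
  -- the root
  have hroot : ∀ x, ∃ s : ℂ, s ^ N = u x := fun x => IsAlgClosed.exists_pow_nat_eq (u x) hNpos
  choose s hs using hroot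
  have hst : Tendsto s 𝓖 (𝓝 0) := by
    rw [tendsto_zero_iff_norm_tendsto_zero] at hu ⊢
    have h1 : ∀ x, ‖s x‖ = ‖u x‖ ^ ((N : ℝ)⁻¹) := by
      intro x
      rw [← hs x, norm_pow, Real.pow_rpow_inv_natCast (norm_nonneg _) hNpos.ne']
    simp only [h1]
    have h2 : Tendsto (fun y : ℝ => y ^ ((N : ℝ)⁻¹)) (𝓝 0) (𝓝 (0 ^ ((N : ℝ)⁻¹))) := 
      (Real.continuousAt_rpow_const 0 _ (Or.inr (by positivity))).tendsto
    rw [Real.zero_rpow (by positivity)] at h2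
    exact h2.comp hu
  have hs0 : ∀ᶠ x in (𝓖 : Filter Ω), s x ≠ 0 := by
    filter_upwards [hu0] with x hx h0
    rw [← hs x, h0, zero_pow hNpos.ne'] at hx
    exact hx rfl
  set w : Ω → ℂ := fun x => v' x / s x ^ p with hw
  have hHz : ∀ᶠ x in (𝓖 : Filter Ω), pev H (s x, w x) = 0 := by
    have h1 := (Filter.eventually_all_finset _).2 hDspec
    filter_upwards [hexp, hst.eventually h1, hs0] with x a1 a2 a3
    have hv : v' x = s x ^ p * w x := by simp only [hw]; field_simp
    have h2 : s x ^ (p * (e + 1)) * pev H (s x, w x) = 0 := by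
      rw [← a1, hH, pev_sum_C, Finset.sum_range_succ, mul_add, hDe, add_comm, Finset.mul_sum]
      congr 1
      · change _ * ((1:ℂ) * w x ^ (e + 1)) = _
        rw [hv]; ring
      · refine Finset.sum_congr rfl fun k hk => ?_
        have hk' := Finset.mem_range.1 hk
        have h3 := a2 k hk
        rw [hs] at h3
        rw [h3, hv, mul_pow, ← pow_mul]
        have h4 : s x ^ (p * (e + 1)) = s x ^ (p * (e + 1 - k)) * s x ^ (p * k) := by
          rw [← pow_add, ← mul_add]; congr 2; omega
        rw [h4]; ring
    exact (mul_eq_zero.1 h2).resolve_left (pow_ne_zero _ a3)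
  obtain ⟨α, hα⟩ := pui_limit 𝓖 s w hst H hHm hHz
  -- multiplicity
  obtain ⟨mm, hmm, hord⟩ := pui_root_mult (H.map (evx 0)) (hHm.map _) e 
    (by rw [hHm.natDegree_map, hHd])
    (by
      rw [coeff_map, hHc, if_pos (by omega)]
      have : D e = 0 := by
        simp only [hD]; rw [if_neg (by omega), if_pos]
        rw [hce]; exact Eventually.of_forall fun z => rfl
      rw [this, map_zero])
    ⟨k₁, by have := Finset.mem_range.1 hk₁r; omega, by
      have hk' := Finset.mem_range.1 hk₁r
      rw [coeff_map, hHc, if_pos (by omega)]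
      have hDk : (D k₁).1 0 = (0:ℂ) ^ ((m k₁ - p) * (e + 1 - k₁)) * (g k₁).1 0 := by
        simp only [hD]; rw [if_neg (by omega), if_neg hk₁n]; rfl
      rw [evx_apply, hDk, hp, Nat.sub_self, zero_mul, pow_zero, one_mul]
      exact (hmg k₁ hk₁r hk₁n).1⟩ α
  set φ : ℂ × ℂ → ℂ := fun q => pev H (q.1, α + q.2) with hφ
  have hφh : ContDiffAt ℂ 1 φ 0 := by
    refine ContDiffAt.comp (g := pev H) (f := fun q : ℂ × ℂ => (q.1, α + q.2)) 0 ?_ (by fun_prop)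
    simpa using pev_cd H α
  have hφ0 : (fun t => φ (0, t)) = fun t => (H.map (evx 0)).eval (α + t) := by
    funext t; simp [hφ, pev, eval_map]
  obtain ⟨W, hWm, hWd, -, hWz⟩ := weier_poly φ hφh (by
    intro hev
    have : analyticOrderAt (fun t => (H.map (evx 0)).eval (α + t)) 0 = ⊤ := by
      rw [← hφ0, analyticOrderAt_eq_top]; exact hev
    rw [this] at hord
    exact ENat.top_ne_natCast _ hord)
  rw [hφ0, hord] at hWd
  have hWd' : W.natDegree = mm := by exact_mod_cast hWd
  have hw't : Tendsto (fun x => w x - α) 𝓖 (𝓝 0) := by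
    have := hα.sub_const α
    simpa using this
  have hpair : Tendsto (fun x => (s x, w x - α)) 𝓖 (𝓝 (0 : ℂ × ℂ)) := hst.prodMk_nhds hw't
  obtain ⟨N', b, σ, hN', hσ, hfin⟩ := ih s (fun x => w x - α) hst hs0 W hWm (by omega) (by
    filter_upwards [hpair.eventually hWz, hHz] with x a1 a2
    refine a1 ?_
    simpa [hφ] using a2)
  have hbh : ContDiffAt ℂ 1 (fun t : ℂ => t ^ (N' * p) * (α + b.1 t) + r.1 (t ^ (N' * N))) 0 := by
    refine ContDiffAt.add (ContDiffAt.mul (by fun_prop) (contDiffAt_const.add b.2)) ?_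
    refine ContDiffAt.comp (g := r.1) (f := fun t : ℂ => t ^ (N' * N)) 0 ?_ (by fun_prop)
    rw [zero_pow (by positivity)]; exact r.2
  refine ⟨N' * N, ⟨_, hbh⟩, σ, by positivity, hσ, ?_⟩
  filter_upwards [hfin, hs0] with x ⟨a1, a2⟩ a3
  have hu1 : u x = σ x ^ (N' * N) := by rw [← hs x, a1, ← pow_mul]
  refine ⟨hu1, ?_⟩
  change v x = σ x ^ (N' * p) * (α + b.1 (σ x)) + r.1 (σ x ^ (N' * N))
  rw [← hu1, ← a2, pow_mul, ← a1]
  simp only [hw, hv']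
  field_simp
  ring
end


section
open Polynomial
universe u v
variable {Ω : Type v}

theorem param (𝓕 : Ultrafilter Ω) (a b : Ω → ℂ) (ha : Tendsto a 𝓕 (𝓝 0)) (hb : Tendsto b 𝓕 (𝓝 0)) 
    (ha0 : ∀ᶠ x in (𝓕 : Filter Ω), a x ≠ 0)
    (halg : IsAlgebraic (iota 𝓕 a).range (b : Germ (𝓕 : Filter Ω) ℂ)) :
    ∃ (N : ℕ) (β : HolRing ℂ) (σ : Ω → ℂ), 0 < N ∧ Tendsto σ 𝓕 (𝓝 0) ∧ 
      ∀ᶠ x in (𝓕 : Filter Ω), a x = σ x ^ N ∧ b x = β.1 (σ x) := by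
  obtain ⟨W, hW, hWz⟩ := (alg_iff _ _).1 halg
  rw [eval₂_iota_zero] at hWz
  have hpair : Tendsto (fun x => (a x, b x)) 𝓕 (𝓝 (0 : ℂ × ℂ)) := ha.prodMk_nhds hb
  have hn : ¬ ∀ᶠ z in 𝓝 (0 : ℂ × ℂ), pev W z = 0 := by
    intro h
    apply hW
    rw [map_iota_zero]
    intro j
    rw [iota_eq_zero]
    have h' : ∀ᶠ z in 𝓝 (0:ℂ) ×ˢ 𝓝 (0:ℂ), pev W z = 0 := by
      rw [← nhds_prod_eq]; exact h
    filter_upwards [ha.eventually h'.curry] with x hx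
    have : W.map (evx (a x)) = 0 := by
      apply Polynomial.eq_zero_of_infinite_isRoot
      refine (infinite_of_mem_nhds (0:ℂ) hx).mono fun z hz => ?_
      change (W.map (evx (a x))).eval z = 0
      rw [eval_map]; exact hz
    have h2 := congrArg (fun P => coeff P j) this
    simpa using h2
  obtain ⟨φ', h1, h2, w, huw, h3⟩ := hol_reg (𝓕 : Filter Ω) (ContinuousLinearMap.fst ℂ ℂ ℂ) 
    (fun x => (a x, b x)) hpair 
    (fun h => by have := congrArg (fun L : ℂ × ℂ →L[ℂ] ℂ => L (1, 0)) h; simp at this) ha0 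
    (pev W) (pev_cd W 0) hWz hn
  have hφ'0 : φ' 0 = 0 := by
    have ht : Tendsto (fun x => φ' (a x, b x)) 𝓕 (𝓝 (φ' 0)) := h1.continuousAt.tendsto.comp hpair
    have ht2 : Tendsto (fun x => φ' (a x, b x)) 𝓕 (𝓝 0) :=
      (tendsto_congr' h2).2 tendsto_const_nhds
    exact tendsto_nhds_unique ht ht2
  obtain ⟨w1, w2⟩ := w
  have hw1 : w1 = 0 := huw
  subst hw1
  have h4 : ¬ ∀ᶠ t in 𝓝 (0:ℂ), φ' (0, t) = 0 := by
    intro h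
    apply h3
    have ht : Tendsto (fun t : ℂ => t * w2) (𝓝 0) (𝓝 0) := by
      have : ContinuousAt (fun t : ℂ => t * w2) 0 := by fun_prop
      simpa [ContinuousAt] using this
    filter_upwards [ht.eventually h] with t ht
    simpa using ht
  obtain ⟨P, hPm, -, -, hPz⟩ := weier_poly φ' h1 h4
  refine puiseux 𝓕 _ a b ha ha0 P hPm (Nat.lt_succ_self _) ?_
  filter_upwards [hpair.eventually hPz, h2] with x a1 a2 using a1 a2

/-- The differentials of `f` and `g` at `x` are linearly dependent. -/
def RankLE {V : Type*} [NormedAddCommGroup V] [NormedSpace ℂ V] (f g : V → ℂ) (x : V) : Prop :=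
  ∀ v w, fderiv ℂ f x v * fderiv ℂ g x w = fderiv ℂ f x w * fderiv ℂ g x v

variable {V : Type u} [NormedAddCommGroup V] [NormedSpace ℂ V] [FiniteDimensional ℂ V]

theorem rank_basis (f g : V → ℂ) (x : V) {ι : Type*} (b : Module.Basis ι ℂ V)
    (h : ∀ i j, fderiv ℂ f x (b i) * fderiv ℂ g x (b j) - fderiv ℂ f x (b j) * fderiv ℂ g x (b i) = 0) :
    RankLE f g x := by
  have h1 : ∀ j v, fderiv ℂ f x v * fderiv ℂ g x (b j) = fderiv ℂ f x (b j) * fderiv ℂ g x v := by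
    intro j v
    have := b.ext (f₁ := ((fderiv ℂ g x (b j)) • fderiv ℂ f x).toLinearMap) 
      (f₂ := ((fderiv ℂ f x (b j)) • fderiv ℂ g x).toLinearMap) (fun i => by
        have := h i j
        simp
        linear_combination this)
    have := congrArg (fun L : V →ₗ[ℂ] ℂ => L v) this
    simp at this
    linear_combination this
  intro v w
  have := b.ext (f₁ := ((fderiv ℂ f x v) • fderiv ℂ g x).toLinearMap) 
      (f₂ := ((fderiv ℂ g x v) • fderiv ℂ f x).toLinearMap) (fun i => by
        have := h1 i v
        simp
        linear_combination this)
  have := congrArg (fun L : V →ₗ[ℂ] ℂ => L w) this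
  simp at this
  linear_combination this

theorem main_alg (𝓕 : Ultrafilter V) (h𝓕 : (𝓕 : Filter V) ≤ 𝓝 0) (f g : V → ℂ) (hf : ContDiffAt ℂ 1 f 0)
    (hg : ContDiffAt ℂ 1 g 0) (hf0 : f 0 = 0)
    (hr : ∀ᶠ x in (𝓕 : Filter V), RankLE f g x) (hne : ∀ᶠ x in (𝓕 : Filter V), f x ≠ 0) :
    IsAlgebraic (iota 𝓕 f).range (g : Germ (𝓕 : Filter V) ℂ) := by
  have hft : Tendsto f 𝓕 (𝓝 0) := by
    have := hf.continuousAt.tendsto.mono_left h𝓕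
    rwa [hf0] at this
  have hid : Tendsto (fun x : V => x) 𝓕 (𝓝 0) := h𝓕
  have hχ : Tendsto (fun x : V => (f x, x)) 𝓕 (𝓝 (0 : ℂ × V)) := hft.prodMk_nhds hid
  have hG : ContDiffAt ℂ 1 (fun p : ℂ × V => g p.2) 0 := 
    ContDiffAt.comp (g := g) (f := Prod.snd) (0 : ℂ × V) hg contDiffAt_snd
  have hF : ContDiffAt ℂ 1 (fun p : ℂ × V => f p.2) 0 := 
    ContDiffAt.comp (g := f) (f := Prod.snd) (0 : ℂ × V) hf contDiffAt_snd
  have hF' : ContDiffAt ℂ 1 (fun p : ℂ × V => f p.2 - p.1) 0 := hF.sub contDiffAt_fst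
  refine claimA 𝓕 (ContinuousLinearMap.fst ℂ ℂ V) (fun x => (f x, x)) hχ hne ⟨_, hG⟩ ?_
  intro ξ₀ ξ hξ₀ hξ t₀ t
  have e₀ := t₀ ⟨_, hF'⟩ (by rw [iota_eq_zero]; exact Eventually.of_forall fun x => sub_self _)
  have e₁ := t ⟨_, hF'⟩ (by rw [iota_eq_zero]; exact Eventually.of_forall fun x => sub_self _)
  filter_upwards [e₀, e₁, hr, hid.eventually (hol_ev_diff hf), hid.eventually (hol_ev_diff hg)] 
    with x a0 a1 a2 d1 d2
  have hfd : HasFDerivAt (fun p : ℂ × V => f p.2 - p.1) 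
      ((fderiv ℂ f x).comp (ContinuousLinearMap.snd ℂ ℂ V) - ContinuousLinearMap.fst ℂ ℂ V) (f x, x) := by
    refine HasFDerivAt.sub ?_ hasFDerivAt_fst
    exact HasFDerivAt.comp (g := f) (f := Prod.snd) (f x, x) d1.hasFDerivAt hasFDerivAt_snd
  have hgd : HasFDerivAt (fun p : ℂ × V => g p.2) 
      ((fderiv ℂ g x).comp (ContinuousLinearMap.snd ℂ ℂ V)) (f x, x) :=
    HasFDerivAt.comp (g := g) (f := Prod.snd) (f x, x) d2.hasFDerivAt hasFDerivAt_snd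
  simp only [hfd.fderiv] at a0 a1
  simp only [hgd.fderiv]
  have b0 := hξ₀ x
  have b1 := hξ x
  simp at a0 a1 b0 b1 ⊢
  rw [b0] at a0
  rw [b1] at a1
  have := a2 (ξ₀ x).2 (ξ x).2
  rw [sub_eq_zero] at a0
  rw [sub_zero] at a1
  rw [a0, a1] at this
  simpa using this

theorem star0 (𝓕 : Ultrafilter V) (h𝓕 : (𝓕 : Filter V) ≤ 𝓝 0) (f g : V → ℂ) (hf : ContDiffAt ℂ 1 f 0)
    (hg : ContDiffAt ℂ 1 g 0) (hf0 : f 0 = 0) (hg0 : g 0 = 0) 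
    (hr : ∀ᶠ x in (𝓕 : Filter V), RankLE f g x) (hne : ∀ᶠ x in (𝓕 : Filter V), f x ≠ 0) :
    ∃ A ∈ 𝓕, ∀ ε > 0, ∃ δ > 0, ∀ x ∈ A, ‖f x‖ < δ → 
      ∃ y, ‖y‖ < ε ∧ RankLE f g y ∧ f y = f x ∧ g y = g x := by
  have hft : Tendsto f 𝓕 (𝓝 0) := by
    have := hf.continuousAt.tendsto.mono_left h𝓕
    rwa [hf0] at this
  have hgt : Tendsto g 𝓕 (𝓝 0) := by
    have := hg.continuousAt.tendsto.mono_left h𝓕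
    rwa [hg0] at this
  have hid : Tendsto (fun x : V => x) 𝓕 (𝓝 0) := h𝓕
  obtain ⟨N, β, σ, hN, hσ, hpar⟩ := param 𝓕 f g hft hgt hne (main_alg 𝓕 h𝓕 f g hf hg hf0 hr hne)
  have hσ0 : ∀ᶠ x in (𝓕 : Filter V), σ x ≠ 0 := by
    filter_upwards [hpar, hne] with x a1 a2 a3
    rw [a1.1, a3, zero_pow hN.ne'] at a2
    exact a2 rfl
  refine ⟨{x | ∃ s : ℂ, s ≠ 0 ∧ f x = s ^ N ∧ g x = β.1 s}, ?_, ?_⟩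
  · filter_upwards [hpar, hσ0] with x a1 a2 using ⟨σ x, a2, a1⟩
  intro ε hε
  set b := Module.finBasis ℂ V with hb
  have hχ : Tendsto (fun x : V => (x, σ x)) 𝓕 (𝓝 (0 : V × ℂ)) := hid.prodMk_nhds hσ
  have cmp : ∀ k : V → ℂ, ContDiffAt ℂ 1 k 0 → ContDiffAt ℂ 1 (fun p : V × ℂ => k p.1) 0 := fun k hk =>
    ContDiffAt.comp (g := k) (f := Prod.fst) (0 : V × ℂ) hk contDiffAt_fst
  have hβ : ContDiffAt ℂ 1 (fun p : V × ℂ => β.1 p.2) 0 := 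
    ContDiffAt.comp (g := β.1) (f := Prod.snd) (0 : V × ℂ) β.2 contDiffAt_snd
  have c1 : ContDiffAt ℂ 1 (fun p : V × ℂ => f p.1 - p.2 ^ N) 0 := (cmp f hf).sub (by fun_prop)
  have c2 : ContDiffAt ℂ 1 (fun p : V × ℂ => g p.1 - β.1 p.2) 0 := (cmp g hg).sub hβ
  have c3 : ∀ q : Fin (Module.finrank ℂ V) × Fin (Module.finrank ℂ V), 
      ContDiffAt ℂ 1 (fun p : V × ℂ => fderiv ℂ f p.1 (b q.1) * fderiv ℂ g p.1 (b q.2) - 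
        fderiv ℂ f p.1 (b q.2) * fderiv ℂ g p.1 (b q.1)) 0 := fun q =>
    ((cmp _ (hol_fderiv hf _)).mul (cmp _ (hol_fderiv hg _))).sub 
      ((cmp _ (hol_fderiv hf _)).mul (cmp _ (hol_fderiv hg _)))
  have key := thmN 𝓕 _ (V × ℂ) (Nat.lt_succ_self _) (ContinuousLinearMap.snd ℂ V ℂ) 
    (fun x => (x, σ x)) hχ hσ0 
    ({(⟨_, c1⟩ : HolRing (V × ℂ)), (⟨_, c2⟩ : HolRing (V × ℂ))} ∪ 
      Set.range fun q => (⟨_, c3 q⟩ : HolRing (V × ℂ)))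
    ((Set.toFinite _).union (Set.finite_range _))
    (by
      rintro φ ((rfl | rfl) | ⟨q, rfl⟩)
      · rw [iota_eq_zero]
        filter_upwards [hpar] with x hx using sub_eq_zero.2 hx.1
      · rw [iota_eq_zero]
        filter_upwards [hpar] with x hx using sub_eq_zero.2 hx.2
      · rw [iota_eq_zero]
        filter_upwards [hr] with x hx using sub_eq_zero.2 (hx _ _))
    1 (by rw [map_one]; exact one_ne_zero) ε hε
  rw [eventually_nhdsWithin_iff] at key
  obtain ⟨ρ, hρ, key⟩ := Metric.eventually_nhds_iff_ball.1 key
  refine ⟨ρ ^ N, by positivity, ?_⟩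
  rintro x ⟨s, hs0, hs1, hs2⟩ hx
  rw [hs1, norm_pow] at hx
  have hsρ : ‖s‖ < ρ := lt_of_pow_lt_pow_left₀ N hρ.le hx
  obtain ⟨⟨y, c⟩, hy1, hy2, hy3, -⟩ := key s (by simpa using hsρ) hs0
  have hc : c = s := hy2
  subst hc
  refine ⟨y, lt_of_le_of_lt (norm_fst_le (y, c)) hy1, ?_, ?_, ?_⟩
  · exact rank_basis f g y b fun i j => hy3 _ (Or.inr ⟨(i, j), rfl⟩)
  · rw [hs1]
    exact sub_eq_zero.1 (hy3 _ (Or.inl (Or.inl rfl)))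
  · rw [hs2]
    exact sub_eq_zero.1 (hy3 _ (Or.inl (Or.inr rfl)))

theorem star (𝓕 : Ultrafilter V) (h𝓕 : (𝓕 : Filter V) ≤ 𝓝 0) (f g : V → ℂ) (hf : ContDiffAt ℂ 1 f 0)
    (hg : ContDiffAt ℂ 1 g 0) (hf0 : f 0 = 0) (hg0 : g 0 = 0) 
    (hr : ∀ᶠ x in (𝓕 : Filter V), RankLE f g x) :
    ∃ A ∈ 𝓕, ∀ ε > 0, ∃ δ > 0, ∀ x ∈ A, ‖f x‖ < δ → ‖g x‖ < δ →
      ∃ y, ‖y‖ < ε ∧ RankLE f g y ∧ f y = f x ∧ g y = g x := by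
  rcases 𝓕.em (fun x => f x = 0) with h1 | h1
  · rcases 𝓕.em (fun x => g x = 0) with h2 | h2
    · have h0 : RankLE f g 0 := by
        intro v w
        have c1 : ContinuousAt (fun x => fderiv ℂ f x v * fderiv ℂ g x w) 0 :=
          ((hol_fderiv hf v).mul (hol_fderiv hg w)).continuousAt
        have c2 : ContinuousAt (fun x => fderiv ℂ f x w * fderiv ℂ g x v) 0 :=
          ((hol_fderiv hf w).mul (hol_fderiv hg v)).continuousAt
        refine tendsto_nhds_unique (c1.tendsto.mono_left h𝓕) 
          ((tendsto_congr' ?_).2 (c2.tendsto.mono_left h𝓕))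
        filter_upwards [hr] with x hx using hx v w
      refine ⟨{x | f x = 0 ∧ g x = 0}, h1.and h2, fun ε hε => ⟨1, one_pos, fun x hx _ _ => 
        ⟨0, by simpa using hε, h0, by rw [hf0, hx.1], by rw [hg0, hx.2]⟩⟩⟩
    · obtain ⟨A, hA, h⟩ := star0 𝓕 h𝓕 g f hg hf hg0 hf0 (by
        filter_upwards [hr] with x hx v w
        linear_combination -(hx v w)) h2
      refine ⟨A, hA, fun ε hε => ?_⟩
      obtain ⟨δ, hδ, h⟩ := h ε hε
      refine ⟨δ, hδ, fun x hx _ hgx => ?_⟩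
      obtain ⟨y, a1, a2, a3, a4⟩ := h x hx hgx
      exact ⟨y, a1, fun v w => by linear_combination -(a2 v w), a4, a3⟩
  · obtain ⟨A, hA, h⟩ := star0 𝓕 h𝓕 f g hf hg hf0 hg0 hr h1
    refine ⟨A, hA, fun ε hε => ?_⟩
    obtain ⟨δ, hδ, h⟩ := h ε hε
    exact ⟨δ, hδ, fun x hx hfx _ => h x hx hfx⟩

theorem germ_image (f g : V → ℂ) (hf : ContDiffAt ℂ 1 f 0)
    (hg : ContDiffAt ℂ 1 g 0) (hf0 : f 0 = 0) (hg0 : g 0 = 0) :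
    ∃ ε₀ > 0, ∀ ε > 0, ∃ δ > 0, ∀ x, ‖x‖ < ε₀ → RankLE f g x → ‖f x‖ < δ → ‖g x‖ < δ →
      ∃ y, ‖y‖ < ε ∧ RankLE f g y ∧ f y = f x ∧ g y = g x := by
  set good : Set V → Prop := fun A => ∀ ε > 0, ∃ δ > 0, ∀ x ∈ A, ‖f x‖ < δ → ‖g x‖ < δ →
      ∃ y, ‖y‖ < ε ∧ RankLE f g y ∧ f y = f x ∧ g y = g x with hgood
  have g0 : good ∅ := fun ε hε => ⟨1, one_pos, fun x hx => hx.elim⟩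
  have g1 : ∀ t, good t → ∀ s ⊆ t, good s := fun t ht s hs ε hε => by
    obtain ⟨δ, hδ, h⟩ := ht ε hε
    exact ⟨δ, hδ, fun x hx => h x (hs hx)⟩
  have g2 : ∀ s, good s → ∀ t, good t → good (s ∪ t) := fun s hs t ht ε hε => by
    obtain ⟨δ, hδ, h⟩ := hs ε hε
    obtain ⟨δ', hδ', h'⟩ := ht ε hε
    refine ⟨min δ δ', lt_min hδ hδ', fun x hx a b => ?_⟩
    rcases hx with hx | hx
    · exact h x hx (a.trans_le (min_le_left _ _)) (b.trans_le (min_le_left _ _))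
    · exact h' x hx (a.trans_le (min_le_right _ _)) (b.trans_le (min_le_right _ _))
  have hbot : (𝓝 (0:V) ⊓ 𝓟 {x | RankLE f g x}) ⊓ Filter.comk good g0 g1 g2 = ⊥ := by
    by_contra hne
    have : NeBot ((𝓝 (0:V) ⊓ 𝓟 {x | RankLE f g x}) ⊓ Filter.comk good g0 g1 g2) := ⟨hne⟩
    set 𝓕 := Ultrafilter.of ((𝓝 (0:V) ⊓ 𝓟 {x | RankLE f g x}) ⊓ Filter.comk good g0 g1 g2) 
    have hle : (𝓕 : Filter V) ≤ _ := Ultrafilter.of_le _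
    obtain ⟨A, hA, hAg⟩ := star 𝓕 (hle.trans (inf_le_left.trans inf_le_left)) f g hf hg hf0 hg0 
      (le_principal_iff.1 (hle.trans (inf_le_left.trans inf_le_right)))
    have hAc : Aᶜ ∈ 𝓕 := (hle.trans inf_le_right) (by
      rw [mem_comk, compl_compl]; exact hAg)
    exact Ultrafilter.compl_mem_iff_notMem.1 hAc hA
  obtain ⟨S, hS, T, hT, hST⟩ := Filter.inf_eq_bot_iff.1 hbot
  rw [mem_comk] at hT
  have hSg : good S := g1 _ hT S fun x hx hxT => by
    have : x ∈ S ∩ T := ⟨hx, hxT⟩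
    rw [hST] at this; exact this
  rw [mem_inf_principal] at hS
  obtain ⟨ε₀, hε₀, hball⟩ := Metric.eventually_nhds_iff_ball.1 hS
  refine ⟨ε₀, hε₀, fun ε hε => ?_⟩
  obtain ⟨δ, hδ, h⟩ := hSg ε hε
  exact ⟨δ, hδ, fun x hx hxr => h x (hball x (by simpa using hx) hxr)⟩

theorem rank_iff (f g : V → ℂ) (x : V) (hf : DifferentiableAt ℂ f x) (hg : DifferentiableAt ℂ g x) :
    ¬ Surjective (fderiv ℂ (fun x => (f x, g x)) x) ↔ RankLE f g x := by
  have h1 : fderiv ℂ (fun x => (f x, g x)) x = (fderiv ℂ f x).prod (fderiv ℂ g x) := 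
    (hf.hasFDerivAt.prodMk hg.hasFDerivAt).fderiv
  rw [h1]
  constructor
  · intro hs v w
    by_contra hne
    apply hs
    rintro ⟨a, b⟩
    have hD : fderiv ℂ f x v * fderiv ℂ g x w - fderiv ℂ f x w * fderiv ℂ g x v ≠ 0 := sub_ne_zero.2 hne
    set D := fderiv ℂ f x v * fderiv ℂ g x w - fderiv ℂ f x w * fderiv ℂ g x v with hDD
    refine ⟨((a * fderiv ℂ g x w - b * fderiv ℂ f x w) / D) • v + 
      ((b * fderiv ℂ f x v - a * fderiv ℂ g x v) / D) • w, ?_⟩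
    rw [ContinuousLinearMap.prod_apply]
    refine Prod.ext ?_ ?_
    · simp only [map_add, map_smul, smul_eq_mul]
      rw [div_mul_eq_mul_div, div_mul_eq_mul_div, ← add_div, div_eq_iff hD, hDD]; ring
    · simp only [map_add, map_smul, smul_eq_mul]
      rw [div_mul_eq_mul_div, div_mul_eq_mul_div, ← add_div, div_eq_iff hD, hDD]; ring
  · intro h hs
    obtain ⟨v, hv⟩ := hs (1, 0)
    obtain ⟨w, hw⟩ := hs (0, 1)
    simp only [ContinuousLinearMap.prod_apply, Prod.mk.injEq] at hv hw
    have := h v w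
    rw [hv.1, hv.2, hw.1, hw.2] at this
    simp at this
end

/-- For any holomorphic map germ `F = (f,g) : (ℂⁿ,0) → (ℂ²,0)`, `n ≥ 2`, the image
`F(Sing F)` of the singular locus is well-defined as a set germ at the origin. -/
theorem stmt_4 (n : ℕ) (hn : 2 ≤ n)
    (U : Set (EuclideanSpace ℂ (Fin n))) (hU : IsOpen U)
    (h0U : (0 : EuclideanSpace ℂ (Fin n)) ∈ U)
    (f g : EuclideanSpace ℂ (Fin n) → ℂ)
    (hf : AnalyticOnNhd ℂ f U) (hg : AnalyticOnNhd ℂ g U)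
    (hf0 : f 0 = 0) (hg0 : g 0 = 0) :
    ∃ ε₀ > 0, ∀ ε ε', 0 < ε → ε < ε₀ → 0 < ε' → ε' < ε₀ → ∃ δ > 0,
      (fun x => (f x, g x)) ''
          ({x ∈ U | ¬ Function.Surjective (fderiv ℂ (fun x => (f x, g x)) x)} ∩ ball 0 ε)
          ∩ ball (0 : ℂ × ℂ) δ =
      (fun x => (f x, g x)) ''
          ({x ∈ U | ¬ Function.Surjective (fderiv ℂ (fun x => (f x, g x)) x)} ∩ ball 0 ε')
          ∩ ball (0 : ℂ × ℂ) δ := by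
  obtain ⟨ε₀, hε₀, key⟩ := germ_image f g (hf 0 h0U).contDiffAt (hg 0 h0U).contDiffAt hf0 hg0
  obtain ⟨ρ, hρ, hρU⟩ := Metric.isOpen_iff.1 hU 0 h0U
  have main : ∀ ε ε', ε < ε₀ → 0 < ε' → ∃ δ > 0, ∀ d ≤ δ,
      (fun x => (f x, g x)) ''
          ({x ∈ U | ¬ Function.Surjective (fderiv ℂ (fun x => (f x, g x)) x)} ∩ ball 0 ε)
          ∩ ball (0 : ℂ × ℂ) d ⊆
      (fun x => (f x, g x)) ''
          ({x ∈ U | ¬ Function.Surjective (fderiv ℂ (fun x => (f x, g x)) x)} ∩ ball 0 ε')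
          ∩ ball (0 : ℂ × ℂ) d := by
    intro ε ε' hε hε'
    obtain ⟨δ, hδ, h⟩ := key (min ε' ρ) (lt_min hε' hρ)
    refine ⟨δ, hδ, fun d hd => ?_⟩
    rintro _ ⟨⟨x, ⟨⟨hxU, hxs⟩, hxε⟩, rfl⟩, hxd⟩
    have hxn : ‖((f x, g x) : ℂ × ℂ)‖ < δ := (mem_ball_zero_iff.1 hxd).trans_le hd
    rw [rank_iff f g x (hf x hxU).differentiableAt (hg x hxU).differentiableAt] at hxs
    obtain ⟨y, hy, hyr, hyf, hyg⟩ := h x ((mem_ball_zero_iff.1 hxε).trans hε) hxs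
      ((norm_fst_le (f x, g x)).trans_lt hxn) ((norm_snd_le (f x, g x)).trans_lt hxn)
    have hyU : y ∈ U := hρU (mem_ball_zero_iff.2 (hy.trans_le (min_le_right _ _)))
    refine ⟨⟨y, ⟨⟨hyU, ?_⟩, mem_ball_zero_iff.2 (hy.trans_le (min_le_left _ _))⟩, ?_⟩, hxd⟩
    · exact (rank_iff f g y (hf y hyU).differentiableAt (hg y hyU).differentiableAt).2 hyr
    · simp only [hyf, hyg]
  refine ⟨ε₀, hε₀, fun ε ε' h1 h2 h3 h4 => ?_⟩
  obtain ⟨δ, hδ, A⟩ := main ε ε' h2 h3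
  obtain ⟨δ', hδ', B⟩ := main ε' ε h4 h1
  exact ⟨min δ δ', lt_min hδ hδ', Set.Subset.antisymm (A _ (min_le_left _ _)) (B _ (min_le_right _ _))⟩
end
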